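/- Nazarov–Sodin law of large numbers: Let f be a centered stationary Gaussian field on ℝⁿ with covariance kernel K and almost surely C¹ sample paths, whose spectral measure ρ (the finite symmetric Borel measure on ℝⁿ with K(x) = ∫ e^{−2πi x·t} dρ(t)) satisfies: (1) ∫ |t|⁴ dρ(t) < ∞; (2) ρ has no atoms; (3) the support of ρ is not contained in any linear hyperplane. Let S be a bounded open convex subset of ℝⁿ containing the origin, and for R > 0 let N_S(R, f) denote the number of nodal domains of f (connected components of {x : f(x) ≠ 0}) that are contained in the rescaled set R·S. Then there exists a constant c ≥ 0 such that N_S(R, f)/(Rⁿ · Vol(S)) → c as R → ∞, almost surely and in L¹. -/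

import Mathlib

open MeasureTheory ProbabilityTheory
open scoped RealInnerProductSpace Pointwise

/-- `f` is a centered stationary Gaussian field on `ℝᵈ` with covariance kernel `K`,
under the probability measure `P`: every finite linear combination `Σ cᵢ f(xᵢ)` is a
centered Gaussian random variable with variance `Σᵢⱼ cᵢ cⱼ K(xᵢ − xⱼ)`. -/
def IsStationaryGaussianField {d : ℕ} {Ω : Type*} [MeasurableSpace Ω]
    (f : EuclideanSpace ℝ (Fin d) → Ω → ℝ) (K : EuclideanSpace ℝ (Fin d) → ℝ)
    (P : Measure Ω) : Prop :=
  (∀ x, Measurable (f x)) ∧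
  ∀ (k : ℕ) (c : Fin k → ℝ) (x : Fin k → EuclideanSpace ℝ (Fin d)),
    Measure.map (fun ω => ∑ i, c i * f (x i) ω) P =
      gaussianReal 0 (∑ i, ∑ j, c i * c j * K (x i - x j)).toNNReal

/-- The number of connected components of `U` that are contained in `W`. -/
noncomputable def componentCountIn {X : Type*} [TopologicalSpace X] (U W : Set X) : ℕ :=
  Nat.card {C : Set X // (∃ x ∈ U, C = connectedComponentIn U x) ∧ C ⊆ W}

namespace NodalCount

open Set Filter Topology
open scoped ENNReal NNReal

set_option linter.unusedSectionVars false

section PathSpace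

variable {E : Type*} [NormedAddCommGroup E] [InnerProductSpace ℝ E] [FiniteDimensional ℝ E]

instance pathMeasurableSpace {X : Type*} [TopologicalSpace X] : MeasurableSpace C(X, ℝ) := borel _

instance pathBorelSpace {X : Type*} [TopologicalSpace X] : BorelSpace C(X, ℝ) := ⟨rfl⟩

theorem measurable_of_eval {Ω : Type*} [MeasurableSpace Ω] {F : Ω → C(E, ℝ)}
    (hF : ∀ x, Measurable fun ω => F ω x) : Measurable F := by
  have hsub : ∀ (K : Set E), IsCompact K → ∀ U : Set ℝ, IsOpen U →
      MeasurableSet (F ⁻¹' {f | MapsTo f K U}) := by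
    intro K hK U hU
    obtain ⟨D, hDK, hDc, hD⟩ : ∃ D ⊆ K, D.Countable ∧ K ⊆ closure D :=
      TopologicalSpace.IsSeparable.exists_countable_dense_subset
        (TopologicalSpace.IsSeparable.of_separableSpace K)
    have key : F ⁻¹' {f | MapsTo f K U} =
        ⋃ n : ℕ, ⋂ x ∈ D, {ω | ENNReal.ofReal (1 / (n + 1)) ≤ Metric.infEDist (F ω x) Uᶜ} := by
      ext ω
      simp only [mem_preimage, mem_ofPred_eq, mem_iUnion, mem_iInter]
      constructor
      · intro h
        have hc : IsCompact (F ω '' K) := hK.image (F ω).continuous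
        have hdisj : Disjoint (F ω '' K) Uᶜ := by
          rw [Set.disjoint_compl_right_iff_subset]; exact h.image_subset
        obtain ⟨r, hr, hrd⟩ := Metric.exists_pos_forall_lt_edist hc hU.isClosed_compl hdisj
        obtain ⟨n, hn⟩ := exists_nat_one_div_lt (show (0 : ℝ) < r from by exact_mod_cast hr)
        refine ⟨n, fun x hx => ?_⟩
        refine Metric.le_infEDist.2 fun y hy => ?_
        refine le_trans ?_ (hrd _ (mem_image_of_mem _ (hDK hx)) y hy).le
        rw [← ENNReal.ofReal_coe_nnreal]
        exact ENNReal.ofReal_le_ofReal hn.le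
      · rintro ⟨n, hn⟩ x hx
        have hcl : IsClosed {x | ENNReal.ofReal (1 / ((n : ℝ) + 1)) ≤
            Metric.infEDist (F ω x) Uᶜ} :=
          isClosed_le continuous_const (Metric.continuous_infEDist.comp (F ω).continuous)
        have hx' := (hcl.closure_subset_iff.2 hn) (hD hx)
        by_contra hxU
        have : Metric.infEDist (F ω x) Uᶜ = 0 := Metric.infEDist_zero_of_mem hxU
        simp only [mem_ofPred_eq, this] at hx'
        have : (0 : ℝ) < 1 / ((n : ℝ) + 1) := by positivity
        simp only [nonpos_iff_eq_zero, ENNReal.ofReal_eq_zero] at hx'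
        linarith
    rw [key]
    refine MeasurableSet.iUnion fun n => MeasurableSet.biInter hDc fun x _ => ?_
    exact measurableSet_le measurable_const
      (Metric.continuous_infEDist.measurable.comp (hF x))
  have hb : (borel C(E, ℝ)) = MeasurableSpace.generateFrom
      (image2 (fun K U => {f : C(E, ℝ) | MapsTo f K U}) {K | IsCompact K} {U | IsOpen U}) :=
    borel_eq_generateFrom_of_subbasis ContinuousMap.compactOpen_eq
  have : @Measurable _ _ _ (borel C(E, ℝ)) F := by
    rw [hb]
    refine measurable_generateFrom ?_
    rintro _ ⟨K, hK, U, hU, rfl⟩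
    exact hsub K hK U hU
  exact this

theorem measurable_eval (x : E) : Measurable fun f : C(E, ℝ) => f x :=
  (continuous_eval_const x).measurable

/-- The path translated by `x`. -/
def shift (x : E) (f : C(E, ℝ)) : C(E, ℝ) := f.comp ⟨fun y => x + y, by fun_prop⟩

@[simp] theorem shift_apply (x y : E) (f : C(E, ℝ)) : shift x f y = f (x + y) := rfl

theorem shift_shift (x y : E) (f : C(E, ℝ)) : shift x (shift y f) = shift (y + x) f := by
  ext z; simp [add_assoc]

theorem continuous_shift_uncurry : Continuous fun p : E × C(E, ℝ) => shift p.1 p.2 := by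
  refine ContinuousMap.continuous_of_continuous_uncurry _ ?_
  have : Continuous fun q : (E × C(E, ℝ)) × E => q.1.2 (q.1.1 + q.2) := by fun_prop
  exact this

theorem measurable_shift_uncurry [MeasurableSpace E] [BorelSpace E] :
    Measurable fun p : E × C(E, ℝ) => shift p.1 p.2 :=
  continuous_shift_uncurry.measurable

theorem measurable_shift (x : E) : Measurable (shift x : C(E, ℝ) → C(E, ℝ)) :=
  (continuous_shift_uncurry.comp (Continuous.prodMk_right x)).measurable

/-- The linear functional `f ↦ ∑ₓ c x * f x`. -/
def ev (c : E →₀ ℝ) (f : C(E, ℝ)) : ℝ := c.sum fun x a => a * f x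

theorem continuous_ev (c : E →₀ ℝ) : Continuous (ev c) := by
  unfold ev Finsupp.sum
  exact continuous_finsetSum _ fun x _ => by fun_prop

theorem measurable_ev (c : E →₀ ℝ) : Measurable (ev c) := (continuous_ev c).measurable

theorem ev_add (c c' : E →₀ ℝ) (f : C(E, ℝ)) : ev (c + c') f = ev c f + ev c' f := by
  unfold ev
  exact Finsupp.sum_add_index' (by simp) (by intros; ring)

theorem ev_smul (r : ℝ) (c : E →₀ ℝ) (f : C(E, ℝ)) : ev (r • c) f = r * ev c f := by
  unfold ev
  rw [Finsupp.sum_smul_index (by simp), Finsupp.mul_sum]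
  simp [mul_assoc]

theorem ev_zero (f : C(E, ℝ)) : ev 0 f = 0 := by simp [ev]

theorem ev_single (x : E) (a : ℝ) (f : C(E, ℝ)) : ev (Finsupp.single x a) f = a * f x := by
  simp [ev]

theorem ev_sum {ι : Type*} (s : Finset ι) (c : ι → E →₀ ℝ) (f : C(E, ℝ)) :
    ev (∑ i ∈ s, c i) f = ∑ i ∈ s, ev (c i) f := by
  classical
  induction s using Finset.induction_on with
  | empty => simp [ev_zero]
  | insert a s ha ih => rw [Finset.sum_insert ha, Finset.sum_insert ha, ev_add, ih]

theorem ev_shift (c : E →₀ ℝ) (x : E) (f : C(E, ℝ)) :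
    ev c (shift x f) = ev (c.mapDomain (x + ·)) f := by
  unfold ev
  rw [Finsupp.sum_mapDomain_index (by simp) (by intros; ring)]
  simp

/-- Two finite measures on path space with the same characteristic functional coincide. -/
theorem ext_of_charFunctional {ν₁ ν₂ : Measure C(E, ℝ)} [IsFiniteMeasure ν₁] [IsFiniteMeasure ν₂]
    (h : ∀ c : E →₀ ℝ, ∫ f, Complex.exp (ev c f * Complex.I) ∂ν₁ =
      ∫ f, Complex.exp (ev c f * Complex.I) ∂ν₂) : ν₁ = ν₂ := by
  have hcoe : Measurable (fun f : C(E, ℝ) => (f : E → ℝ)) :=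
    measurable_pi_lambda _ measurable_eval
  have hmarg : ∀ I : Finset E, (ν₂.map (fun f : C(E, ℝ) => (f : E → ℝ))).map I.restrict =
      (ν₁.map (fun f : C(E, ℝ) => (f : E → ℝ))).map I.restrict := by
    intro I
    rw [Measure.map_map (Finset.measurable_restrict I) hcoe,
      Measure.map_map (Finset.measurable_restrict I) hcoe]
    set R : C(E, ℝ) → (I → ℝ) := I.restrict ∘ (fun f : C(E, ℝ) => (f : E → ℝ)) with hR
    have hRm : Measurable R := (Finset.measurable_restrict I).comp hcoe
    refine (MeasurableEquiv.toLp 2 (I → ℝ)).map_measurableEquiv_injective ?_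
    refine Measure.ext_of_charFun (funext fun t => ?_)
    rw [charFun_apply, charFun_apply]
    rw [integral_map_equiv, integral_map_equiv,
      integral_map hRm.aemeasurable
        (by refine Continuous.aestronglyMeasurable ?_; simp only [MeasurableEquiv.coe_toLp]; fun_prop),
      integral_map hRm.aemeasurable
        (by refine Continuous.aestronglyMeasurable ?_; simp only [MeasurableEquiv.coe_toLp]; fun_prop)]
    have hin : ∀ f : C(E, ℝ), ⟪(MeasurableEquiv.toLp 2 (I → ℝ)) (R f), t⟫ =
        ev (∑ i : I, Finsupp.single (i : E) (t i)) f := by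
      intro f
      rw [ev_sum]
      simp only [ev_single, MeasurableEquiv.coe_toLp, PiLp.inner_apply, hR]
      simp
    simp only [hin]
    exact (h _).symm
  have heq : ν₁.map (fun f : C(E, ℝ) => (f : E → ℝ)) = ν₂.map (fun f : C(E, ℝ) => (f : E → ℝ)) :=
    IsProjectiveLimit.unique
      (P := fun I : Finset E => (ν₁.map (fun f : C(E, ℝ) => (f : E → ℝ))).map I.restrict)
      (fun I => rfl) hmarg
  ext s hs
  have hle : ∀ s : Set C(E, ℝ), MeasurableSet s → ∃ t : Set (E → ℝ), MeasurableSet t ∧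
      (fun f : C(E, ℝ) => (f : E → ℝ)) ⁻¹' t = s := by
    intro s hs
    have : @Measurable _ _ (MeasurableSpace.comap (fun f : C(E, ℝ) => (f : E → ℝ)) inferInstance)
        _ (id : C(E, ℝ) → C(E, ℝ)) := by
      refine @measurable_of_eval E _ _ _ _ (MeasurableSpace.comap _ _) _ fun x => ?_
      exact (measurable_pi_apply x).comp (comap_measurable (fun f : C(E, ℝ) => (f : E → ℝ)))
    exact this hs
  obtain ⟨t, ht, rfl⟩ := hle s hs
  rw [← Measure.map_apply hcoe ht, heq, Measure.map_apply hcoe ht]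

end PathSpace

section Ergodic

variable {E : Type*} [NormedAddCommGroup E] [InnerProductSpace ℝ E] [FiniteDimensional ℝ E]
  [MeasureSpace E] [BorelSpace E] [(volume : Measure E).IsAddHaarMeasure]

theorem volume_closedBall_mul (x : E) {a r : ℝ} (ha : 0 ≤ a) (hr : 0 ≤ r) :
    volume (Metric.closedBall x (a * r)) =
      ENNReal.ofReal a ^ Module.finrank ℝ E * volume (Metric.closedBall (0 : E) r) := by
  rw [Measure.addHaar_closedBall _ _ (by positivity), Measure.addHaar_closedBall _ _ hr,
    ← mul_assoc, mul_pow, ENNReal.ofReal_mul (by positivity), ENNReal.ofReal_pow ha]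

/-- Weak-type estimate for the (truncated, centred) Hardy–Littlewood maximal operator. -/
theorem volume_maximal_le {φ : E → ℝ≥0∞} {s : ℝ} (hs : 0 < s) (N : ℕ) (r : ℝ) (a : ℝ≥0∞) :
    a * volume {x ∈ Metric.closedBall (0 : E) r | ∃ n : ℕ, 1 ≤ n ∧ n ≤ N ∧
      a * volume (Metric.closedBall (0 : E) (n * s)) <
        ∫⁻ y in Metric.closedBall x (n * s), φ y} ≤
    5 ^ Module.finrank ℝ E * ∫⁻ y in Metric.closedBall (0 : E) (r + N * s), φ y := by
  set T := {x ∈ Metric.closedBall (0 : E) r | ∃ n : ℕ, 1 ≤ n ∧ n ≤ N ∧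
      a * volume (Metric.closedBall (0 : E) (n * s)) <
        ∫⁻ y in Metric.closedBall x (n * s), φ y} with hT
  have hT' : ∀ x ∈ T, ∃ n : ℕ, 1 ≤ n ∧ n ≤ N ∧
      a * volume (Metric.closedBall (0 : E) (n * s)) <
        ∫⁻ y in Metric.closedBall x (n * s), φ y := fun x hx => hx.2
  choose! n hn1 hnN hn using hT'
  have hnN' : ∀ x ∈ T, (n x : ℝ) * s ≤ N * s := fun x hx => by
    have : (n x : ℝ) ≤ N := by exact_mod_cast hnN x hx
    gcongr
  have hpos : ∀ x ∈ T, 0 < (n x : ℝ) * s := fun x hx => by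
    have : (1 : ℝ) ≤ n x := by exact_mod_cast hn1 x hx
    positivity
  obtain ⟨u, huT, hdisj, hcov⟩ := Vitali.exists_disjoint_subfamily_covering_enlargement_closedBall
    T (fun x : E => x) (fun x => n x * s) (N * s) hnN' 5 (by norm_num)
  have hu : u.Countable := by
    refine hdisj.countable_of_nonempty_interior fun x hx => ?_
    exact ⟨x, mem_interior_iff_mem_nhds.2 (Metric.closedBall_mem_nhds _ (hpos x (huT hx)))⟩
  have hsub : T ⊆ ⋃ b ∈ u, Metric.closedBall b (5 * (n b * s)) := by
    intro x hx
    obtain ⟨b, hb, hxb⟩ := hcov x hx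
    exact mem_biUnion hb (hxb (Metric.mem_closedBall_self (hpos x hx).le))
  have := hu.to_subtype
  calc a * volume T ≤ a * ∑' b : u, volume (Metric.closedBall (b : E) (5 * (n b * s))) := by
        gcongr
        exact (measure_mono hsub).trans (measure_biUnion_le _ hu _)
    _ = 5 ^ Module.finrank ℝ E *
          ∑' b : u, a * volume (Metric.closedBall (0 : E) (n b * s)) := by
        simp_rw [volume_closedBall_mul _ (show (0 : ℝ) ≤ 5 by norm_num)
          (hpos _ (huT (Subtype.prop _))).le]
        rw [ENNReal.tsum_mul_left, ENNReal.tsum_mul_left]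
        norm_num
        ring
    _ ≤ 5 ^ Module.finrank ℝ E *
          ∑' b : u, ∫⁻ y in Metric.closedBall (b : E) (n b * s), φ y := by
        gcongr with b
        exact (hn b (huT b.2)).le
    _ = 5 ^ Module.finrank ℝ E *
          ∫⁻ y in ⋃ b ∈ u, Metric.closedBall (b : E) (n b * s), φ y := by
        rw [lintegral_biUnion hu (fun b _ => Metric.isClosed_closedBall.measurableSet) hdisj]
    _ ≤ _ := by
        gcongr
        refine iUnion₂_subset fun b hb => ?_
        refine Metric.closedBall_subset_closedBall' ?_
        have h1 := hnN' b (huT hb)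
        have h2 : dist b 0 ≤ r := (huT hb).1
        linarith

variable {μ : Measure C(E, ℝ)} [IsProbabilityMeasure μ]

theorem lintegral_shift (hinv : ∀ x : E, μ.map (shift x) = μ) {H : C(E, ℝ) → ℝ≥0∞}
    (hH : Measurable H) (x : E) : ∫⁻ f, H (shift x f) ∂μ = ∫⁻ f, H f ∂μ := by
  conv_rhs => rw [← hinv x, lintegral_map hH (measurable_shift x)]

theorem measurable_comp_shift {β : Type*} [MeasurableSpace β] {H : C(E, ℝ) → β}
    (hH : Measurable H) : Measurable fun p : C(E, ℝ) × E => H (shift p.2 p.1) :=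
  hH.comp (measurable_shift_uncurry.comp measurable_swap)

theorem lintegral_lintegral_shift (hinv : ∀ x : E, μ.map (shift x) = μ) {H : C(E, ℝ) → ℝ≥0∞}
    (hH : Measurable H) (W : Set E) :
    ∫⁻ f, (∫⁻ x in W, H (shift x f)) ∂μ = volume W * ∫⁻ f, H f ∂μ := by
  rw [lintegral_lintegral_swap (measurable_comp_shift hH).aemeasurable]
  simp [lintegral_shift hinv hH, mul_comm]

theorem maximal_truncated (hinv : ∀ x : E, μ.map (shift x) = μ) {H : C(E, ℝ) → ℝ≥0∞}
    (hH : Measurable H) {s : ℝ} (hs : 0 < s) (N : ℕ) (hN : 0 < N) (a : ℝ≥0∞) :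
    a * μ {f | ∃ n : ℕ, 1 ≤ n ∧ n ≤ N ∧ a * volume (Metric.closedBall (0 : E) (n * s)) <
        ∫⁻ y in Metric.closedBall (0 : E) (n * s), H (shift y f)} ≤
      10 ^ Module.finrank ℝ E * ∫⁻ f, H f ∂μ := by
  set B := {f | ∃ n : ℕ, 1 ≤ n ∧ n ≤ N ∧ a * volume (Metric.closedBall (0 : E) (n * s)) <
        ∫⁻ y in Metric.closedBall (0 : E) (n * s), H (shift y f)} with hB
  have hBm : MeasurableSet B := by
    simp only [hB, ofPred_exists, ofPred_and]
    refine MeasurableSet.iUnion fun n => (MeasurableSet.const _).inter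
      ((MeasurableSet.const _).inter ?_)
    exact measurableSet_lt measurable_const (measurable_comp_shift hH).lintegral_prod_right'
  set r : ℝ := N * s
  have hNs : 0 < r := by positivity
  set V := volume (Metric.closedBall (0 : E) r)
  have hV0 : V ≠ 0 := (Metric.measure_closedBall_pos _ _ hNs).ne'
  have hVt : V ≠ ∞ := measure_closedBall_lt_top.ne
  have h1 : a * (μ B * V) ≤ 5 ^ Module.finrank ℝ E *
      ∫⁻ f, (∫⁻ y in Metric.closedBall (0 : E) (r + N * s), H (shift y f)) ∂μ := by
    have hind : Measurable (B.indicator (1 : C(E, ℝ) → ℝ≥0∞)) :=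
      measurable_one.indicator hBm
    have := lintegral_lintegral_shift hinv hind (Metric.closedBall (0 : E) r)
    rw [lintegral_indicator_one hBm] at this
    rw [mul_comm (μ B), ← this, ← lintegral_const_mul _
      (measurable_comp_shift hind).lintegral_prod_right', ← lintegral_const_mul _
      (measurable_comp_shift hH).lintegral_prod_right']
    refine lintegral_mono fun f => ?_
    refine le_trans ?_ (volume_maximal_le (φ := fun y => H (shift y f)) hs N r a)
    gcongr
    have hm : MeasurableSet {x : E | shift x f ∈ B} :=
      (measurable_shift_uncurry.comp (measurable_id.prodMk measurable_const)) hBm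
    have : (fun x : E => B.indicator (1 : C(E, ℝ) → ℝ≥0∞) (shift x f)) =
        {x : E | shift x f ∈ B}.indicator 1 := by
      ext x; simp [indicator]
    rw [this, lintegral_indicator_one hm, Measure.restrict_apply hm]
    refine measure_mono fun x hx => ⟨hx.2, ?_⟩
    obtain ⟨n, hn1, hnN, hn⟩ := hx.1
    refine ⟨n, hn1, hnN, hn.trans_le ?_⟩
    simp only [shift_shift]
    have hpre : Metric.closedBall (0 : E) (n * s) =
        (fun y => x + y) ⁻¹' Metric.closedBall x (n * s) := by
      simp
    rw [hpre]
    exact ((measurePreserving_add_left volume x).setLIntegral_comp_preimage_emb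
      (measurableEmbedding_addLeft x) (fun y => H (shift y f)) _).le
  rw [lintegral_lintegral_shift hinv hH] at h1
  have h2 : volume (Metric.closedBall (0 : E) (r + N * s)) = 2 ^ Module.finrank ℝ E * V := by
    have : r + N * s = 2 * r := by ring
    rw [this, volume_closedBall_mul _ (by norm_num) hNs.le]
    norm_num
    rfl
  rw [h2] at h1
  have h3 : a * μ B * V ≤ 10 ^ Module.finrank ℝ E * (∫⁻ f, H f ∂μ) * V := by
    have h10 : (10 : ℝ≥0∞) ^ Module.finrank ℝ E = 5 ^ Module.finrank ℝ E * 2 ^ Module.finrank ℝ E := by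
      rw [← mul_pow]; norm_num
    rw [h10]
    calc a * μ B * V = a * (μ B * V) := by ring
      _ ≤ _ := h1
      _ = _ := by ring
  exact (ENNReal.mul_le_mul_iff_left hV0 hVt).1 h3

theorem maximal_inequality (hinv : ∀ x : E, μ.map (shift x) = μ) {H : C(E, ℝ) → ℝ≥0∞}
    (hH : Measurable H) {s : ℝ} (hs : 0 < s) (a : ℝ≥0∞) :
    a * μ {f | ∃ n : ℕ, 1 ≤ n ∧ a * volume (Metric.closedBall (0 : E) (n * s)) <
        ∫⁻ y in Metric.closedBall (0 : E) (n * s), H (shift y f)} ≤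
      10 ^ Module.finrank ℝ E * ∫⁻ f, H f ∂μ := by
  have : {f | ∃ n : ℕ, 1 ≤ n ∧ a * volume (Metric.closedBall (0 : E) (n * s)) <
        ∫⁻ y in Metric.closedBall (0 : E) (n * s), H (shift y f)} =
      ⋃ N : ℕ, {f | ∃ n : ℕ, 1 ≤ n ∧ n ≤ N + 1 ∧
        a * volume (Metric.closedBall (0 : E) (n * s)) <
        ∫⁻ y in Metric.closedBall (0 : E) (n * s), H (shift y f)} := by
    ext f
    simp only [mem_ofPred_eq, mem_iUnion]
    exact ⟨fun ⟨n, h1, h2⟩ => ⟨n, n, h1, by omega, h2⟩, fun ⟨_, n, h1, _, h2⟩ => ⟨n, h1, h2⟩⟩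
  rw [this, Monotone.measure_iUnion, ENNReal.mul_iSup]
  · exact iSup_le fun N => maximal_truncated hinv hH hs (N + 1) (by omega) a
  · intro N M hNM f
    simp only [mem_ofPred_eq]
    exact fun ⟨n, h1, h2, h3⟩ => ⟨n, h1, by omega, h3⟩

end Ergodic

section ErgodicAverages

variable {E : Type*} [NormedAddCommGroup E] [InnerProductSpace ℝ E] [FiniteDimensional ℝ E]
  [MeasureSpace E] [BorelSpace E] [(volume : Measure E).IsAddHaarMeasure]

/-- The average of `H` over the translates of `f` by the points of `R • S`. -/
noncomputable def avg (S : Set E) (H : C(E, ℝ) → ℝ) (R : ℝ) (f : C(E, ℝ)) : ℝ :=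
  (∫ x in R • S, H (shift x f)) / (R ^ Module.finrank ℝ E * (volume S).toReal)

/-- The pointwise ergodic theorem holds for the observable `H`. -/
def Good (μ : Measure C(E, ℝ)) (S : Set E) (H : C(E, ℝ) → ℝ) : Prop :=
  Measurable H ∧ Integrable H μ ∧
    ∀ᵐ f ∂μ, Tendsto (fun n : ℕ => avg S H n f) atTop (𝓝 (∫ f, H f ∂μ))

theorem volume_smul_set (S : Set E) {R : ℝ} (hR : 0 ≤ R) :
    volume (R • S) = ENNReal.ofReal (R ^ Module.finrank ℝ E) * volume S := by
  rw [Measure.addHaar_smul, abs_of_nonneg (by positivity)]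

theorem smul_subset_closedBall {S : Set E} {s : ℝ} (hS : S ⊆ Metric.closedBall 0 s) {R : ℝ}
    (hR : 0 ≤ R) : R • S ⊆ Metric.closedBall 0 (R * s) := by
  rintro _ ⟨x, hx, rfl⟩
  have := hS hx
  simp only [mem_closedBall_zero_iff] at this ⊢
  rw [norm_smul, Real.norm_of_nonneg hR]
  gcongr

variable {μ : Measure C(E, ℝ)} [IsProbabilityMeasure μ]

theorem ae_integrableOn_shift (hinv : ∀ x : E, μ.map (shift x) = μ) {H : C(E, ℝ) → ℝ}
    (hH : Measurable H) (hi : Integrable H μ) :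
    ∀ᵐ f ∂μ, ∀ r : ℝ, IntegrableOn (fun x => H (shift x f)) (Metric.closedBall (0 : E) r) := by
  have : ∀ᵐ f ∂μ, ∀ n : ℕ,
      IntegrableOn (fun x => H (shift x f)) (Metric.closedBall (0 : E) n) := by
    rw [ae_all_iff]
    intro n
    have h := lintegral_lintegral_shift hinv hH.enorm (Metric.closedBall (0 : E) n)
    have hfin : ∫⁻ f, (∫⁻ x in Metric.closedBall (0 : E) n, ‖H (shift x f)‖ₑ) ∂μ ≠ ∞ := by
      rw [h]
      exact ENNReal.mul_ne_top measure_closedBall_lt_top.ne hi.2.ne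
    filter_upwards [ae_lt_top (measurable_comp_shift hH.enorm).lintegral_prod_right' hfin] with f hf
    refine ⟨?_, hf⟩
    exact (hH.comp (measurable_shift_uncurry.comp
      (measurable_id.prodMk measurable_const))).aestronglyMeasurable
  filter_upwards [this] with f hf r
  obtain ⟨n, hn⟩ := exists_nat_ge r
  exact (hf n).mono_set (Metric.closedBall_subset_closedBall hn)

theorem Good.add (hinv : ∀ x : E, μ.map (shift x) = μ) {S : Set E} {s : ℝ}
    (hS : S ⊆ Metric.closedBall 0 s) {H G : C(E, ℝ) → ℝ}
    (hH : Good μ S H) (hG : Good μ S G) : Good μ S (fun f => H f + G f) := by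
  refine ⟨hH.1.add hG.1, hH.2.1.add hG.2.1, ?_⟩
  filter_upwards [hH.2.2, hG.2.2, ae_integrableOn_shift hinv hH.1 hH.2.1,
    ae_integrableOn_shift hinv hG.1 hG.2.1] with f h1 h2 h3 h4
  rw [integral_add hH.2.1 hG.2.1]
  refine (h1.add h2).congr fun n => ?_
  have hs := smul_subset_closedBall hS (Nat.cast_nonneg (α := ℝ) n)
  rw [avg, avg, avg, integral_add ((h3 _).mono_set hs) ((h4 _).mono_set hs), add_div]

theorem Good.const_mul {S : Set E} {H : C(E, ℝ) → ℝ} (hH : Good μ S H) (a : ℝ) :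
    Good μ S (fun f => a * H f) := by
  refine ⟨hH.1.const_mul a, hH.2.1.const_mul a, ?_⟩
  filter_upwards [hH.2.2] with f h1
  rw [integral_const_mul]
  refine (h1.const_mul a).congr fun n => ?_
  rw [avg, avg, integral_const_mul, mul_div_assoc]

theorem good_const {S : Set E} (hS0 : volume S ≠ 0) (hSt : volume S ≠ ∞) (a : ℝ) :
    Good μ S (fun _ => a) := by
  refine ⟨measurable_const, integrable_const a, Eventually.of_forall fun f => ?_⟩
  have h : ∀ n : ℕ, 1 ≤ n → a = avg S (fun _ => a) n f := by
    intro n hn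
    have hn' : (0 : ℝ) < n := by exact_mod_cast hn
    rw [avg, setIntegral_const, Measure.real, volume_smul_set _ hn'.le, ENNReal.toReal_mul,
      ENNReal.toReal_ofReal (by positivity), smul_eq_mul]
    have : (volume S).toReal ≠ 0 := (ENNReal.toReal_pos hS0 hSt).ne'
    field_simp
  simp only [integral_const, probReal_univ, one_smul]
  exact tendsto_const_nhds.congr' (eventually_atTop.2 ⟨1, h⟩)

theorem good_of_approx (hinv : ∀ x : E, μ.map (shift x) = μ) {S : Set E} {s : ℝ} (hs : 0 < s)
    (hS : S ⊆ Metric.closedBall 0 s) (hS0 : volume S ≠ 0)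
    {H : C(E, ℝ) → ℝ} (hH : Measurable H) (hi : Integrable H μ)
    (happ : ∀ ε > 0, ∃ G, Good μ S G ∧ ∫ f, |H f - G f| ∂μ ≤ ε) : Good μ S H := by
  refine ⟨hH, hi, ?_⟩
  have hSt : volume S ≠ ∞ := ((measure_mono hS).trans_lt measure_closedBall_lt_top).ne
  have hSpos : 0 < (volume S).toReal := ENNReal.toReal_pos hS0 hSt
  set v := (volume (Metric.closedBall (0 : E) s)).toReal with hv
  have hvpos : 0 < v := ENNReal.toReal_pos (Metric.measure_closedBall_pos _ _ hs).ne'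
    measure_closedBall_lt_top.ne
  set κ := v / (volume S).toReal with hκ
  have hκpos : 0 < κ := div_pos hvpos hSpos
  set c := ∫ f, H f ∂μ with hc
  suffices hη : ∀ k : ℕ, ∀ᵐ f ∂μ, ∀ᶠ n : ℕ in atTop, |avg S H n f - c| ≤ 3 * (1 / (k + 1)) by
    rw [← ae_all_iff] at hη
    filter_upwards [hη] with f hf
    rw [Metric.tendsto_nhds]
    intro ε hε
    obtain ⟨k, hk⟩ := exists_nat_one_div_lt (show 0 < ε / 3 by positivity)
    filter_upwards [hf k] with n hn
    rw [Real.dist_eq]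
    linarith
  intro k
  set η : ℝ := 1 / (k + 1) with hηdef
  have hηpos : 0 < η := by positivity
  set a : ℝ≥0∞ := ENNReal.ofReal (η / κ) with ha
  have ha0 : a ≠ 0 := by simp only [ha, ne_eq, ENNReal.ofReal_eq_zero, not_le]; positivity
  rw [ae_iff]
  have hle : ∀ ε : ℝ, 0 < ε → ε ≤ η →
      a * μ {f | ¬ ∀ᶠ n : ℕ in atTop, |avg S H n f - c| ≤ 3 * η} ≤
        10 ^ Module.finrank ℝ E * ENNReal.ofReal ε := by
    intro ε hε hεη
    obtain ⟨G, hG, hGε⟩ := happ ε hε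
    have hDm : Measurable fun f => H f - G f := hH.sub hG.1
    have hDi : Integrable (fun f => H f - G f) μ := hi.sub hG.2.1
    have hmax := maximal_inequality hinv hDm.enorm hs a
    have hDint : ∫⁻ f, ‖H f - G f‖ₑ ∂μ ≤ ENNReal.ofReal ε := by
      rw [← ofReal_integral_norm_eq_lintegral_enorm hDi]
      exact ENNReal.ofReal_le_ofReal hGε
    refine le_trans ?_ (hmax.trans (by gcongr))
    have hsub : {f | ¬ ∀ᶠ n : ℕ in atTop, |avg S H n f - c| ≤ 3 * η} ≤ᵐ[μ]
        {f | ∃ n : ℕ, 1 ≤ n ∧ a * volume (Metric.closedBall (0 : E) (n * s)) <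
          ∫⁻ y in Metric.closedBall (0 : E) (n * s), ‖H (shift y f) - G (shift y f)‖ₑ} := ?_
    · exact mul_le_mul_right (measure_mono_ae hsub) _
    filter_upwards [hG.2.2, ae_integrableOn_shift hinv hH hi,
      ae_integrableOn_shift hinv hG.1 hG.2.1] with f h1 h2 h3 hbad
    by_contra hcon
    refine hbad ?_
    have hcon' : ∀ n : ℕ, 1 ≤ n → ∫⁻ y in Metric.closedBall (0 : E) (n * s),
        ‖H (shift y f) - G (shift y f)‖ₑ ≤ a * volume (Metric.closedBall (0 : E) (n * s)) := by
      intro n hn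
      by_contra hlt
      exact hcon ⟨n, hn, not_le.1 hlt⟩
    have hGc : |∫ f, G f ∂μ - c| ≤ η := by
      rw [hc, ← integral_sub hG.2.1 hi]
      refine (abs_integral_le_integral_abs).trans ?_
      simp_rw [abs_sub_comm (G _)]
      exact hGε.trans hεη
    have hev := (Metric.tendsto_nhds.1 h1) η hηpos
    filter_upwards [hev, eventually_ge_atTop 1] with n hn hn1
    rw [Real.dist_eq] at hn
    have hn' : (0 : ℝ) < n := by exact_mod_cast hn1
    have hsub := smul_subset_closedBall hS hn'.le
    have hden : 0 < (n : ℝ) ^ Module.finrank ℝ E * (volume S).toReal := by positivity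
    have hdiff : |avg S H n f - avg S G n f| ≤ η := by
      rw [avg, avg, ← sub_div, ← integral_sub ((h2 _).mono_set hsub) ((h3 _).mono_set hsub),
        abs_div, abs_of_pos hden, div_le_iff₀ hden]
      have h_intble : IntegrableOn (fun x => H (shift x f) - G (shift x f))
        (Metric.closedBall (0 : E) (n * s)) := (h2 _).sub (h3 _)
      calc |∫ x in (n : ℝ) • S, (H (shift x f) - G (shift x f))|
          ≤ ∫ x in (n : ℝ) • S, |H (shift x f) - G (shift x f)| := abs_integral_le_integral_abs
        _ ≤ ∫ x in Metric.closedBall (0 : E) (n * s), |H (shift x f) - G (shift x f)| :=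
            setIntegral_mono_set h_intble.abs (Eventually.of_forall fun x => abs_nonneg _)
              hsub.eventuallyLE
        _ = (∫⁻ x in Metric.closedBall (0 : E) (n * s),
              ‖H (shift x f) - G (shift x f)‖ₑ).toReal := by
            rw [← integral_norm_eq_lintegral_enorm h_intble.1]; rfl
        _ ≤ (a * volume (Metric.closedBall (0 : E) (n * s))).toReal := by
            refine ENNReal.toReal_mono ?_ (hcon' n hn1)
            exact ENNReal.mul_ne_top ENNReal.ofReal_ne_top measure_closedBall_lt_top.ne
        _ = η / κ * (n ^ Module.finrank ℝ E * v) := by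
            rw [volume_closedBall_mul _ hn'.le hs.le, ENNReal.toReal_mul, ENNReal.toReal_mul,
              ENNReal.toReal_pow, ENNReal.toReal_ofReal hn'.le, ha,
              ENNReal.toReal_ofReal (by positivity)]
        _ = η * (n ^ Module.finrank ℝ E * (volume S).toReal) := by
            rw [hκ]; field_simp
    calc |avg S H n f - c| = |(avg S H n f - avg S G n f) + (avg S G n f - ∫ f, G f ∂μ) +
          (∫ f, G f ∂μ - c)| := by ring_nf
      _ ≤ _ := abs_add_three _ _ _
      _ ≤ 3 * η := by linarith
  have hz : a * μ {f | ¬ ∀ᶠ n : ℕ in atTop, |avg S H n f - c| ≤ 3 * η} = 0 := by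
    have hlim : Tendsto (fun ε : ℝ => 10 ^ Module.finrank ℝ E * ENNReal.ofReal ε)
        (𝓝[>] 0) (𝓝 (10 ^ Module.finrank ℝ E * ENNReal.ofReal 0)) := by
      refine ENNReal.Tendsto.const_mul ?_ (Or.inr (ENNReal.pow_ne_top (by norm_num)))
      exact (ENNReal.continuous_ofReal.tendsto 0).mono_left nhdsWithin_le_nhds
    rw [ENNReal.ofReal_zero, mul_zero] at hlim
    refine le_antisymm (ge_of_tendsto hlim ?_) zero_le
    filter_upwards [Ioc_mem_nhdsGT hηpos] with ε hε
    exact hle ε hε.1 hε.2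
  exact (mul_eq_zero.1 hz).resolve_left ha0

theorem good_coboundary {S : Set E} {s : ℝ} (hinv : ∀ x : E, μ.map (shift x) = μ)
    (hS : S ⊆ Metric.closedBall 0 s) (hSo : IsOpen S) (hSc : Convex ℝ S) (h0 : (0 : E) ∈ S)
    {H : C(E, ℝ) → ℝ} (hH : Measurable H) {M : ℝ} (hM : ∀ f, |H f| ≤ M) (y : E) :
    Good μ S (fun f => H f - H (shift y f)) := by
  have hHi : Integrable H μ := Integrable.of_bound hH.aestronglyMeasurable M
    (Eventually.of_forall fun f => hM f)
  have hHy : Measurable fun f => H (shift y f) := hH.comp (measurable_shift y)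
  have hHyi : Integrable (fun f => H (shift y f)) μ :=
    Integrable.of_bound hHy.aestronglyMeasurable M (Eventually.of_forall fun f => hM _)
  refine ⟨hH.sub hHy, hHi.sub hHyi, Eventually.of_forall fun f => ?_⟩
  have hz : ∫ f, (H f - H (shift y f)) ∂μ = 0 := by
    rw [integral_sub hHi hHyi, sub_eq_zero]
    conv_lhs => rw [← hinv y]
    rw [integral_map (measurable_shift y).aemeasurable hH.aestronglyMeasurable]
  rw [hz]
  have hSpos : 0 < (volume S).toReal := ENNReal.toReal_pos (hSo.measure_pos _ ⟨0, h0⟩).ne'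
    ((measure_mono hS).trans_lt measure_closedBall_lt_top).ne
  obtain ⟨a, ha, hya⟩ : ∃ a : ℝ, 0 ≤ a ∧ y ∈ a • S := by
    obtain ⟨r, hr, hrS⟩ := Metric.isOpen_iff.1 hSo 0 h0
    refine ⟨2 * (‖y‖ + 1) / r, by positivity, ?_⟩
    rw [mem_smul_set_iff_inv_smul_mem₀ (by positivity)]
    refine hrS ?_
    rw [mem_ball_zero_iff, norm_smul, Real.norm_of_nonneg (by positivity), inv_div,
      div_mul_eq_mul_div, div_lt_iff₀ (by positivity)]
    nlinarith [norm_nonneg y]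
  set D := Module.finrank ℝ E
  have hvol : ∀ R : ℝ, 0 ≤ R → (volume (R • S)).toReal = R ^ D * (volume S).toReal := by
    intro R hR
    rw [volume_smul_set _ hR, ENNReal.toReal_mul, ENNReal.toReal_ofReal (by positivity)]
  have hψm : Measurable fun x : E => H (shift x f) :=
    hH.comp (measurable_shift_uncurry.comp (measurable_id.prodMk measurable_const))
  have hbound : ∀ n : ℕ, 1 ≤ n →
      |avg S (fun f => H f - H (shift y f)) n f| ≤ 2 * M * ((1 + a / n) ^ D - 1) := by
    intro n hn
    have hn' : (0 : ℝ) < n := by exact_mod_cast hn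
    have hM0 : 0 ≤ M := (abs_nonneg _).trans (hM f)
    set U := ((n : ℝ) + a) • S with hU
    have hUeq : U = (n : ℝ) • S + a • S := hSc.add_smul hn'.le ha
    have hUt : volume U ≠ ∞ :=
      ((measure_mono (smul_subset_closedBall hS (by positivity))).trans_lt
        measure_closedBall_lt_top).ne
    have hψU : IntegrableOn (fun x : E => H (shift x f)) U :=
      Measure.integrableOn_of_bounded hUt hψm.aestronglyMeasurable
        (M := M) (Eventually.of_forall fun x => hM _)
    have key : ∀ A : Set E, MeasurableSet A → A ⊆ U →
        (volume A).toReal = (n : ℝ) ^ D * (volume S).toReal →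
        |(∫ x in U, H (shift x f)) - ∫ x in A, H (shift x f)| ≤
          M * (((n + a) ^ D - n ^ D) * (volume S).toReal) := by
      intro A hA hAU hAv
      have hUA := setIntegral_sdiff hA hψU hAU
      rw [← hUA]
      have := norm_setIntegral_le_of_norm_le_const (μ := volume) (s := U \ A)
        (f := fun x : E => H (shift x f)) (C := M)
        ((measure_mono sdiff_subset).trans_lt hUt.lt_top) (fun x _ => hM _)
      refine this.trans (le_of_eq ?_)
      rw [Measure.real, measure_sdiff hAU hA.nullMeasurableSet
        ((measure_mono hAU).trans_lt hUt.lt_top).ne, ENNReal.toReal_sub_of_le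
        (measure_mono hAU) hUt, hAv, hU, hvol _ (by positivity)]
      ring
    have hnS : MeasurableSet ((n : ℝ) • S) := (hSo.smul₀ hn'.ne').measurableSet
    have k1 := key ((n : ℝ) • S) hnS (by
      rw [hUeq]; intro x hx
      exact ⟨x, hx, 0, ⟨0, h0, by simp⟩, by simp⟩) (hvol _ hn'.le)
    set A := (fun x => x + -y) ⁻¹' ((n : ℝ) • S) with hA
    have k2 := key A ((measurable_add_const _) hnS) (by
      intro x hx
      rw [hUeq]
      exact ⟨x + -y, hx, y, hya, by simp⟩) (by
      rw [hA, measure_preimage_add_right, hvol _ hn'.le])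
    have hAint : ∫ x in A, H (shift x f) = ∫ x in (n : ℝ) • S, H (shift y (shift x f)) := by
      have := (measurePreserving_add_right (volume : Measure E) (-y)).setIntegral_preimage_emb
        (measurableEmbedding_addRight (-y)) (fun x => H (shift (x + y) f)) ((n : ℝ) • S)
      simp only [neg_add_cancel_right] at this
      rw [hA, this]
      simp only [shift_shift]
    have i1 : IntegrableOn (fun x : E => H (shift x f)) ((n : ℝ) • S) :=
      hψU.mono_set (by
        rw [hUeq]; intro x hx
        exact ⟨x, hx, 0, ⟨0, h0, by simp⟩, by simp⟩)
    have i2 : IntegrableOn (fun x : E => H (shift y (shift x f))) ((n : ℝ) • S) := by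
      refine Measure.integrableOn_of_bounded (M := M) ?_ ?_ (Eventually.of_forall fun x => hM _)
      · exact ((measure_mono (smul_subset_closedBall hS (by positivity))).trans_lt
          measure_closedBall_lt_top).ne
      · exact (hHy.comp (measurable_shift_uncurry.comp
          (measurable_id.prodMk measurable_const))).aestronglyMeasurable
    have hden : 0 < (n : ℝ) ^ D * (volume S).toReal := by positivity
    rw [avg, integral_sub i1 i2, ← hAint, abs_div, abs_of_pos hden, div_le_iff₀ hden]
    have : 2 * M * ((1 + a / n) ^ D - 1) * ((n : ℝ) ^ D * (volume S).toReal) =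
        2 * (M * (((n + a) ^ D - n ^ D) * (volume S).toReal)) := by
      have : ((n : ℝ) + a) = n * (1 + a / n) := by field_simp
      rw [this, mul_pow]; ring
    rw [this, abs_sub_le_iff]
    rw [abs_sub_le_iff] at k1 k2
    constructor <;> linarith [k1.1, k1.2, k2.1, k2.2]
  have hlim : Tendsto (fun n : ℕ => 2 * M * ((1 + a / n) ^ D - 1)) atTop (𝓝 0) := by
    have h1 : Tendsto (fun n : ℕ => a / (n : ℝ)) atTop (𝓝 0) :=
      tendsto_const_div_atTop_nhds_zero_nat a
    have := (((h1.const_add 1).pow D).sub_const 1).const_mul (2 * M)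
    simpa using this
  refine squeeze_zero_norm' (eventually_atTop.2 ⟨1, fun n hn => ?_⟩) hlim
  exact hbound n hn

end ErgodicAverages

section Wiener

variable {E : Type*} [NormedAddCommGroup E] [InnerProductSpace ℝ E] [FiniteDimensional ℝ E]
  [MeasurableSpace E] [BorelSpace E]

theorem charFun_sub (ν : Measure E) [IsFiniteMeasure ν] (u : E) :
    charFun ((ν.prod ν).map fun p => p.1 - p.2) u = ((‖charFun ν u‖ ^ 2 : ℝ) : ℂ) := by
  rw [charFun_apply, integral_map (by fun_prop) (by fun_prop)]
  have h : ∀ p : E × E, Complex.exp (⟪p.1 - p.2, u⟫ * Complex.I) =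
      Complex.exp (⟪p.1, u⟫ * Complex.I) * Complex.exp (⟪p.2, -u⟫ * Complex.I) := by
    intro p
    rw [← Complex.exp_add, inner_sub_left, inner_neg_right]
    push_cast; ring_nf
  simp_rw [h]
  rw [integral_prod_mul (fun t : E => Complex.exp (⟪t, u⟫ * Complex.I))
    (fun t : E => Complex.exp (⟪t, -u⟫ * Complex.I)), ← charFun_apply, ← charFun_apply,
    charFun_neg, Complex.mul_conj, Complex.normSq_eq_norm_sq]

theorem prod_diagonal_eq_zero (ν : Measure E) [IsFiniteMeasure ν] (h : ∀ t, ν {t} = 0) :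
    ((ν.prod ν).map fun p => p.1 - p.2) {0} = 0 := by
  rw [Measure.map_apply (by fun_prop) (measurableSet_singleton 0),
    Measure.prod_apply ((by fun_prop : Measurable fun p : E × E => p.1 - p.2)
      (measurableSet_singleton 0))]
  refine (lintegral_congr fun t => ?_).trans lintegral_zero
  have : Prod.mk t ⁻¹' ((fun p : E × E => p.1 - p.2) ⁻¹' {0}) = {t} := by
    ext s; simp [sub_eq_zero, eq_comm]
  rw [this, h]

theorem tendsto_integral_charFun (ν : Measure E) [IsFiniteMeasure ν] (h : ∀ t, ν {t} = 0)
    (x : E) : Tendsto (fun n : ℕ => ∫ g, ‖charFun ν ((n : ℝ) • g - x)‖ ^ 2 ∂(stdGaussian E))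
      atTop (𝓝 0) := by
  set η := (ν.prod ν).map fun p : E × E => p.1 - p.2 with hη
  have key : ∀ n : ℕ, ((∫ g, ‖charFun ν ((n : ℝ) • g - x)‖ ^ 2 ∂(stdGaussian E) : ℝ) : ℂ) =
      ∫ w, Complex.exp (-(⟪w, x⟫ * Complex.I)) *
        ((Real.exp (-(n * ‖w‖) ^ 2 / 2) : ℝ) : ℂ) ∂η := by
    intro n
    rw [← integral_complex_ofReal]
    simp_rw [← charFun_sub, charFun_apply]
    rw [integral_integral_swap]
    · refine integral_congr_ae (Eventually.of_forall fun w => ?_)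
      have e1 : ∀ g : E, Complex.exp (⟪w, (n : ℝ) • g - x⟫ * Complex.I) =
          Complex.exp (-(⟪w, x⟫ * Complex.I)) *
            Complex.exp (⟪g, (n : ℝ) • w⟫ * Complex.I) := by
        intro g
        rw [← Complex.exp_add, inner_sub_right, inner_smul_right, inner_smul_right,
          real_inner_comm]
        push_cast; ring_nf
      simp only [e1]
      rw [integral_const_mul, ← charFun_apply, charFun_stdGaussian, norm_smul]
      simp
    · refine Integrable.of_bound (C := 1) ?_ (Eventually.of_forall fun p => ?_)
      · exact Continuous.aestronglyMeasurable (by simp only [Function.uncurry_def]; fun_prop)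
      · simp only [Function.uncurry_def]
        rw [Complex.norm_exp_ofReal_mul_I]
  have hlim : Tendsto (fun n : ℕ => ∫ w, Complex.exp (-(⟪w, x⟫ * Complex.I)) *
        ((Real.exp (-(n * ‖w‖) ^ 2 / 2) : ℝ) : ℂ) ∂η) atTop (𝓝 (∫ _, (0 : ℂ) ∂η)) := by
    refine tendsto_integral_of_dominated_convergence (fun _ => 1) ?_ (integrable_const _) ?_ ?_
    · intro n
      exact Continuous.aestronglyMeasurable (by fun_prop)
    · intro n
      refine Eventually.of_forall fun w => ?_
      rw [norm_mul, ← neg_mul, ← Complex.ofReal_neg, Complex.norm_exp_ofReal_mul_I, one_mul,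
        Complex.norm_real, Real.norm_of_nonneg (Real.exp_nonneg _)]
      refine Real.exp_le_one_iff.2 ?_
      have := sq_nonneg (n * ‖w‖); linarith
    · have h0 : ∀ᵐ w ∂η, w ≠ 0 := by
        rw [ae_iff]; simpa using prod_diagonal_eq_zero ν h
      filter_upwards [h0] with w hw
      have : Tendsto (fun n : ℕ => Real.exp (-(n * ‖w‖) ^ 2 / 2)) atTop (𝓝 0) := by
        refine Real.tendsto_exp_atBot.comp ?_
        have h1 : Tendsto (fun n : ℕ => (n : ℝ) * ‖w‖) atTop atTop :=
          tendsto_natCast_atTop_atTop.atTop_mul_const (norm_pos_iff.2 hw)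
        have h2 := (tendsto_pow_atTop (two_ne_zero)).comp h1
        have h3 := tendsto_neg_atTop_atBot.comp h2
        have h4 := h3.atBot_div_const (show (0:ℝ) < 2 by norm_num)
        exact h4
      have h5 : Tendsto (fun n : ℕ => ((Real.exp (-(n * ‖w‖) ^ 2 / 2) : ℝ) : ℂ)) atTop
          (𝓝 ((0 : ℝ) : ℂ)) := (Complex.continuous_ofReal.tendsto 0).comp this
      simpa using h5.const_mul (Complex.exp (-(⟪w, x⟫ * Complex.I)))
  rw [integral_zero] at hlim
  have := (Complex.continuous_re.tendsto 0).comp hlim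
  refine this.congr fun n => ?_
  rw [Function.comp_apply, ← key, Complex.ofReal_re]

/-- **Wiener's lemma**: the characteristic function of an atomless
measure is simultaneously small at some translate of any finite set of points. -/
theorem exists_norm_charFun_lt (ν : Measure E) [IsFiniteMeasure ν] (h : ∀ t, ν {t} = 0)
    (s : Finset E) {ε : ℝ} (hε : 0 < ε) : ∃ y, ∀ x ∈ s, ‖charFun ν (y - x)‖ < ε := by
  have hlim : Tendsto (fun n : ℕ => ∑ x ∈ s, ∫ g, ‖charFun ν ((n : ℝ) • g - x)‖ ^ 2
      ∂(stdGaussian E)) atTop (𝓝 0) := by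
    simpa using tendsto_finsetSum s fun x _ => tendsto_integral_charFun ν h x
  obtain ⟨n, hn⟩ := (hlim.eventually_lt_const (show 0 < ε ^ 2 by positivity)).exists
  have h_intble : ∀ x : E, Integrable (fun g => ‖charFun ν ((n : ℝ) • g - x)‖ ^ 2)
      (stdGaussian E) := by
    intro x
    refine Integrable.of_bound (C := ν.real univ ^ 2) ?_ (Eventually.of_forall fun g => ?_)
    · exact (((measurable_charFun (μ := ν)).comp (by fun_prop : Measurable
        fun g : E => (n : ℝ) • g - x)).norm.pow_const 2).aestronglyMeasurable
    · rw [Real.norm_of_nonneg (by positivity)]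
      gcongr
      exact norm_charFun_le _
  rw [← integral_finsetSum _ fun x _ => h_intble x] at hn
  obtain ⟨g, hg⟩ : ∃ g, ∑ x ∈ s, ‖charFun ν ((n : ℝ) • g - x)‖ ^ 2 < ε ^ 2 := by
    by_contra! hcon
    have := integral_mono (integrable_const (ε ^ 2)) (integrable_finsetSum _ fun x _ => h_intble x)
      hcon (μ := stdGaussian E)
    simp only [integral_const, probReal_univ, one_smul] at this
    exact absurd hn (not_lt.2 this)
  refine ⟨(n : ℝ) • g, fun x hx => ?_⟩
  have h1 := Finset.single_le_sum (f := fun x => ‖charFun ν ((n : ℝ) • g - x)‖ ^ 2)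
    (fun x _ => by positivity) hx
  exact lt_of_pow_lt_pow_left₀ 2 hε.le (h1.trans_lt hg)

end Wiener

section Spectral

variable {E : Type*} [NormedAddCommGroup E] [InnerProductSpace ℝ E] [FiniteDimensional ℝ E]

/-- The Fourier transform of the finitely supported signed measure `c`. -/
noncomputable def ft (c : E →₀ ℝ) (t : E) : ℂ :=
  c.sum fun x a => (a : ℂ) * Complex.exp ((-2 * Real.pi * ⟪x, t⟫ : ℝ) * Complex.I)

theorem ft_add (c c' : E →₀ ℝ) (t : E) : ft (c + c') t = ft c t + ft c' t := by
  unfold ft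
  exact Finsupp.sum_add_index' (by simp) (by intros; push_cast; ring)

theorem ft_smul (r : ℝ) (c : E →₀ ℝ) (t : E) : ft (r • c) t = r * ft c t := by
  unfold ft
  rw [Finsupp.sum_smul_index (by simp), Finsupp.mul_sum]
  simp [mul_assoc]

theorem ft_single (x : E) (a : ℝ) (t : E) :
    ft (Finsupp.single x a) t =
      a * Complex.exp ((-2 * Real.pi * ⟪x, t⟫ : ℝ) * Complex.I) := by
  simp [ft]

theorem ft_zero (t : E) : ft (0 : E →₀ ℝ) t = 0 := by simp [ft]

theorem ft_sum {ι : Type*} (s : Finset ι) (c : ι → E →₀ ℝ) (t : E) :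
    ft (∑ i ∈ s, c i) t = ∑ i ∈ s, ft (c i) t := by
  classical
  induction s using Finset.induction_on with
  | empty => simp [ft_zero]
  | insert a s ha ih => rw [Finset.sum_insert ha, Finset.sum_insert ha, ft_add, ih]

theorem ft_mapDomain (c : E →₀ ℝ) (y t : E) : ft (c.mapDomain (y + ·)) t =
    Complex.exp ((-2 * Real.pi * ⟪y, t⟫ : ℝ) * Complex.I) * ft c t := by
  unfold ft
  rw [Finsupp.sum_mapDomain_index (by simp) (by intros; push_cast; ring), Finsupp.mul_sum]
  refine Finsupp.sum_congr fun x _ => ?_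
  rw [inner_add_left]
  push_cast
  rw [mul_add, add_mul, Complex.exp_add]
  ring

theorem continuous_ft (c : E →₀ ℝ) : Continuous (ft c) := by
  unfold ft Finsupp.sum
  fun_prop

theorem norm_ft_le (c : E →₀ ℝ) (t : E) : ‖ft c t‖ ≤ c.sum fun _ a => |a| := by
  unfold ft
  refine (norm_sum_le _ _).trans (Finset.sum_le_sum fun x _ => ?_)
  rw [norm_mul, Complex.norm_exp_ofReal_mul_I, mul_one, Complex.norm_real, Real.norm_eq_abs]

variable [MeasurableSpace E] [BorelSpace E]

/-- The variance of the linear functional `ev c` under the Gaussian law with spectral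
measure `ρ`. -/
noncomputable def var (ρ : Measure E) (c : E →₀ ℝ) : ℝ := ∫ t, ‖ft c t‖ ^ 2 ∂ρ

theorem integrable_norm_ft_sq (ρ : Measure E) [IsFiniteMeasure ρ] (c : E →₀ ℝ) :
    Integrable (fun t => ‖ft c t‖ ^ 2) ρ := by
  refine Integrable.of_bound (C := (c.sum fun _ a => |a|) ^ 2)
    ((continuous_ft c).norm.pow 2).aestronglyMeasurable (Eventually.of_forall fun t => ?_)
  rw [Real.norm_of_nonneg (by positivity)]
  gcongr
  exact norm_ft_le c t

theorem var_nonneg (ρ : Measure E) (c : E →₀ ℝ) : 0 ≤ var ρ c :=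
  integral_nonneg fun t => by positivity

theorem var_shift (ρ : Measure E) (c : E →₀ ℝ) (y : E) :
    var ρ (c.mapDomain (y + ·)) = var ρ c := by
  unfold var
  simp_rw [ft_mapDomain, norm_mul, Complex.norm_exp_ofReal_mul_I, one_mul]

/-- `μ` is the centered stationary Gaussian law on path space with spectral measure `ρ`. -/
def HasSpectralMeasure (μ : Measure C(E, ℝ)) (ρ : Measure E) : Prop :=
  ∀ c : E →₀ ℝ, ∫ f, Complex.exp (ev c f * Complex.I) ∂μ = (Real.exp (-var ρ c / 2) : ℝ)

variable {μ : Measure C(E, ℝ)} [IsProbabilityMeasure μ] {ρ : Measure E} [IsFiniteMeasure ρ]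

theorem HasSpectralMeasure.map_shift (h : HasSpectralMeasure μ ρ) (x : E) :
    μ.map (shift x) = μ := by
  have : IsProbabilityMeasure (μ.map (shift x : C(E, ℝ) → C(E, ℝ))) :=
    Measure.isProbabilityMeasure_map (measurable_shift x).aemeasurable
  refine ext_of_charFunctional fun c => ?_
  rw [integral_map (measurable_shift x).aemeasurable]
  · simp_rw [ev_shift]
    rw [h, h, var_shift]
  · exact Continuous.aestronglyMeasurable (by have := continuous_ev c; fun_prop)

/-- The squared modulus of the Fourier transform of `c`, as a density for `ρ`. -/
noncomputable def weighted (ρ : Measure E) (c : E →₀ ℝ) : Measure E :=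
  (ρ.withDensity fun t => ENNReal.ofReal (‖ft c t‖ ^ 2)).map fun t => (2 * Real.pi) • t

instance (c : E →₀ ℝ) : IsFiniteMeasure (weighted ρ c) := by
  have : IsFiniteMeasure (ρ.withDensity fun t => ENNReal.ofReal (‖ft c t‖ ^ 2)) :=
    isFiniteMeasure_withDensity_ofReal (integrable_norm_ft_sq ρ c).2
  unfold weighted
  infer_instance

theorem weighted_singleton (hρ : ∀ t, ρ {t} = 0) (c : E →₀ ℝ) (t : E) :
    weighted ρ c {t} = 0 := by
  unfold weighted
  rw [Measure.map_apply (by fun_prop) (measurableSet_singleton t)]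
  refine withDensity_absolutelyContinuous _ _ ?_
  have : (fun t : E => (2 * Real.pi) • t) ⁻¹' {t} ⊆ {(2 * Real.pi)⁻¹ • t} := by
    rintro s hs
    rw [mem_preimage, mem_singleton_iff] at hs
    rw [mem_singleton_iff, ← hs, smul_smul, inv_mul_cancel₀ (by positivity), one_smul]
  exact measure_mono_null this (hρ _)

theorem var_sub_shift (c : E →₀ ℝ) (x y : E) :
    var ρ (c.mapDomain (x + ·) + (-1 : ℝ) • c.mapDomain (y + ·)) =
      2 * var ρ c - 2 * (charFun (weighted ρ c) (x - y)).re := by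
  have h1 : (charFun (weighted ρ c) (x - y)).re =
      ∫ t, ‖ft c t‖ ^ 2 * Real.cos (2 * Real.pi * ⟪x - y, t⟫) ∂ρ := by
    rw [charFun_apply, weighted, integral_map (by fun_prop) (by fun_prop),
      integral_withDensity_eq_integral_toReal_smul]
    rotate_left
    · exact ((continuous_ft c).norm.pow 2).measurable.ennreal_ofReal
    · exact Eventually.of_forall fun _ => ENNReal.ofReal_lt_top
    have := integral_re (μ := ρ) (𝕜 := ℂ) (f := fun t => (ENNReal.ofReal (‖ft c t‖ ^ 2)).toReal •
        Complex.exp (⟪(2 * Real.pi) • t, x - y⟫ * Complex.I)) (by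
      refine Integrable.of_bound (C := (c.sum fun _ a => |a|) ^ 2) ?_
        (Eventually.of_forall fun t => ?_)
      · have := continuous_ft c
        have h2 : ∀ t, (ENNReal.ofReal (‖ft c t‖ ^ 2)).toReal = ‖ft c t‖ ^ 2 := fun t =>
          ENNReal.toReal_ofReal (by positivity)
        simp_rw [h2]
        exact Continuous.aestronglyMeasurable (by fun_prop)
      · rw [norm_smul, Complex.norm_exp_ofReal_mul_I, mul_one, ENNReal.toReal_ofReal (by positivity),
          Real.norm_of_nonneg (by positivity)]
        gcongr
        exact norm_ft_le c t)
    simp only [RCLike.re_eq_complex_re] at this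
    rw [← this]
    refine integral_congr_ae (Eventually.of_forall fun t => ?_)
    simp only [Complex.real_smul]
    rw [Complex.re_ofReal_mul, Complex.exp_ofReal_mul_I_re,
      ENNReal.toReal_ofReal (by positivity), inner_smul_left, real_inner_comm]
    simp
  have hi : Integrable (fun t => ‖ft c t‖ ^ 2 * Real.cos (2 * Real.pi * ⟪x - y, t⟫)) ρ := by
    refine (integrable_norm_ft_sq ρ c).mul_bdd (c := 1)
      (Continuous.aestronglyMeasurable (by fun_prop)) (Eventually.of_forall fun t => ?_)
    exact Real.abs_cos_le_one _
  rw [h1, var, var, ← integral_const_mul, ← integral_const_mul, ← integral_sub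
    ((integrable_norm_ft_sq ρ c).const_mul 2) (hi.const_mul 2)]
  refine integral_congr_ae (Eventually.of_forall fun t => ?_)
  simp only
  rw [ft_add, ft_smul, ft_mapDomain, ft_mapDomain]
  have e : Complex.exp ((-2 * Real.pi * ⟪x, t⟫ : ℝ) * Complex.I) * ft c t + ((-1 : ℝ) : ℂ) *
      (Complex.exp ((-2 * Real.pi * ⟪y, t⟫ : ℝ) * Complex.I) * ft c t) =
      (Complex.exp ((-2 * Real.pi * ⟪x, t⟫ : ℝ) * Complex.I) -
      Complex.exp ((-2 * Real.pi * ⟪y, t⟫ : ℝ) * Complex.I)) * ft c t := by push_cast; ring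
  rw [e, norm_mul, mul_pow]
  have e2 : ‖Complex.exp ((-2 * Real.pi * ⟪x, t⟫ : ℝ) * Complex.I) -
      Complex.exp ((-2 * Real.pi * ⟪y, t⟫ : ℝ) * Complex.I)‖ ^ 2 =
      2 - 2 * Real.cos (2 * Real.pi * ⟪x - y, t⟫) := by
    rw [← Complex.normSq_eq_norm_sq, Complex.normSq_apply, Complex.sub_re, Complex.sub_im,
      Complex.exp_ofReal_mul_I_re, Complex.exp_ofReal_mul_I_re, Complex.exp_ofReal_mul_I_im,
      Complex.exp_ofReal_mul_I_im, inner_sub_left, mul_sub (2 * Real.pi), Real.cos_sub]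
    simp only [neg_mul, Real.cos_neg, Real.sin_neg]
    nlinarith [Real.sin_sq_add_cos_sq (2 * Real.pi * ⟪x, t⟫),
      Real.sin_sq_add_cos_sq (2 * Real.pi * ⟪y, t⟫)]
  rw [e2]; ring

end Spectral

section Trig

variable {E : Type*} [NormedAddCommGroup E] [InnerProductSpace ℝ E] [FiniteDimensional ℝ E]

/-- The exponential of the linear functional `ev c`. -/
noncomputable def trig (c : E →₀ ℝ) (f : C(E, ℝ)) : ℂ := Complex.exp (ev c f * Complex.I)

theorem continuous_trig (c : E →₀ ℝ) : Continuous (trig c) := by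
  have := continuous_ev c
  unfold trig; fun_prop

theorem norm_trig (c : E →₀ ℝ) (f : C(E, ℝ)) : ‖trig c f‖ = 1 :=
  Complex.norm_exp_ofReal_mul_I _

theorem trig_shift (c : E →₀ ℝ) (x : E) (f : C(E, ℝ)) :
    trig c (shift x f) = trig (c.mapDomain (x + ·)) f := by
  rw [trig, trig, ev_shift]

theorem trig_mul_conj (c c' : E →₀ ℝ) (f : C(E, ℝ)) :
    trig c f * (starRingEnd ℂ) (trig c' f) = trig (c + (-1 : ℝ) • c') f := by
  rw [trig, trig, trig, ← Complex.exp_conj, map_mul, Complex.conj_ofReal, Complex.conj_I,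
    ← Complex.exp_add, ev_add, ev_smul]
  push_cast; ring_nf

variable {μ : Measure C(E, ℝ)} [IsProbabilityMeasure μ]

theorem integrable_trig (c : E →₀ ℝ) : Integrable (trig c) μ :=
  Integrable.of_bound (C := 1) (continuous_trig c).aestronglyMeasurable
    (Eventually.of_forall fun f => (norm_trig c f).le)

variable [MeasureSpace E] [BorelSpace E] [(volume : Measure E).IsAddHaarMeasure]
variable {ρ : Measure E} [IsFiniteMeasure ρ]

theorem integral_trig_sub_mul_conj (h : HasSpectralMeasure μ ρ) (c : E →₀ ℝ) (x y : E) :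
    ∫ f, ((trig (c.mapDomain (x + ·)) f - (Real.exp (-var ρ c / 2) : ℝ)) *
      (starRingEnd ℂ) (trig (c.mapDomain (y + ·)) f - (Real.exp (-var ρ c / 2) : ℝ))).re ∂μ =
      Real.exp (-var ρ c) * (Real.exp (charFun (weighted ρ c) (x - y)).re - 1) := by
  set φ := Real.exp (-var ρ c / 2) with hφ
  have hx : ∫ f, trig (c.mapDomain (x + ·)) f ∂μ = φ := by
    have := h (c.mapDomain (x + ·)); rwa [var_shift] at this
  have hy : ∫ f, trig (c.mapDomain (y + ·)) f ∂μ = φ := by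
    have := h (c.mapDomain (y + ·)); rwa [var_shift] at this
  have hxy : ∫ f, trig (c.mapDomain (x + ·) + (-1 : ℝ) • c.mapDomain (y + ·)) f ∂μ =
      (Real.exp (-var ρ c) * Real.exp (charFun (weighted ρ c) (x - y)).re : ℝ) := by
    have := h (c.mapDomain (x + ·) + (-1 : ℝ) • c.mapDomain (y + ·))
    rw [var_sub_shift] at this
    rw [← Real.exp_add]
    refine this.trans ?_
    congr 2; ring
  have e : ∀ f, ((trig (c.mapDomain (x + ·)) f - (φ : ℝ)) *
      (starRingEnd ℂ) (trig (c.mapDomain (y + ·)) f - (φ : ℝ))).re =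
      (trig (c.mapDomain (x + ·) + (-1 : ℝ) • c.mapDomain (y + ·)) f).re -
        φ * (trig (c.mapDomain (x + ·)) f).re - φ * (trig (c.mapDomain (y + ·)) f).re + φ ^ 2 := by
    intro f
    rw [← trig_mul_conj, map_sub, Complex.conj_ofReal]
    simp only [Complex.mul_re, Complex.sub_re, Complex.sub_im, Complex.conj_re, Complex.conj_im,
      Complex.ofReal_re, Complex.ofReal_im]
    ring
  have hre : ∀ c : E →₀ ℝ, Integrable (fun f => (trig c f).re) μ := fun c => (integrable_trig c).re
  have hir : ∀ c : E →₀ ℝ, ∫ f, (trig c f).re ∂μ = (∫ f, trig c f ∂μ).re := fun c =>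
    integral_re (𝕜 := ℂ) (integrable_trig c)
  simp_rw [e]
  have quad : ∀ u v w : C(E, ℝ) → ℝ, Integrable u μ → Integrable v μ → Integrable w μ →
      ∫ f, (u f - φ * v f - φ * w f + φ ^ 2) ∂μ =
        ∫ f, u f ∂μ - φ * ∫ f, v f ∂μ - φ * ∫ f, w f ∂μ + φ ^ 2 := by
    intro u v w hu hv hw
    have h1 : Integrable (fun f => u f - φ * v f) μ := hu.sub (hv.const_mul _)
    have h2 : Integrable (fun f => u f - φ * v f - φ * w f) μ := h1.sub (hw.const_mul _)
    rw [integral_add h2 (integrable_const _), integral_sub h1 (hw.const_mul _),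
      integral_sub hu (hv.const_mul _), integral_const_mul, integral_const_mul]
    simp
  rw [quad _ _ _ (hre _) (hre _) (hre _), hir, hir, hir, hx, hy, hxy]
  simp only [Complex.ofReal_re]
  have : φ ^ 2 = Real.exp (-var ρ c) := by
    rw [hφ, ← Real.exp_nat_mul]; congr 1; push_cast; ring
  rw [← this]; ring

theorem Good.sum (hinv : ∀ x : E, μ.map (shift x) = μ) {S : Set E} {s : ℝ}
    (hS : S ⊆ Metric.closedBall 0 s) (hS0 : volume S ≠ 0) {ι : Type*} (t : Finset ι)
    {H : ι → C(E, ℝ) → ℝ} (hH : ∀ i, Good μ S (H i)) : Good μ S (fun f => ∑ i ∈ t, H i f) := by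
  classical
  induction t using Finset.induction_on with
  | empty =>
    simpa using good_const hS0 ((measure_mono hS).trans_lt measure_closedBall_lt_top).ne 0
  | insert a t ha ih =>
    simp_rw [Finset.sum_insert ha]
    exact (hH a).add hinv hS ih

theorem exists_decorrelated (hρ : ∀ t, ρ {t} = 0) (c : E →₀ ℝ) {ε : ℝ} (hε : 0 < ε) :
    ∃ y : ℕ → E, ∀ m n, m ≠ n → |(charFun (weighted ρ c) (y m - y n)).re| < ε := by
  let r : E → E → Prop := fun x y => ‖charFun (weighted ρ c) (x - y)‖ < ε
  have hsymm : ∀ x y, r x y → r y x := by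
    intro x y h
    change ‖charFun (weighted ρ c) (y - x)‖ < ε
    rw [← neg_sub, charFun_neg, RCLike.norm_conj]
    exact h
  have : Std.Symm r := ⟨hsymm⟩
  obtain ⟨y, -, hy⟩ := exists_seq_of_forall_finset_exists' (fun _ : E => True) r (by
    intro s _
    obtain ⟨y, hy⟩ := exists_norm_charFun_lt (weighted ρ c) (weighted_singleton hρ c) s hε
    exact ⟨y, trivial, fun x hx => hsymm _ _ (hy x hx)⟩)
  exact ⟨y, fun m n hmn => (Complex.abs_re_le_norm _).trans_lt (hy hmn)⟩

theorem good_trig (h : HasSpectralMeasure μ ρ) (hρ : ∀ t, ρ {t} = 0) {S : Set E} {s : ℝ}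
    (hs : 0 < s) (hS : S ⊆ Metric.closedBall 0 s) (hSo : IsOpen S) (hSc : Convex ℝ S)
    (h0 : (0 : E) ∈ S) (c : E →₀ ℝ) (z : ℂ) : Good μ S (fun f => (z * trig c f).re) := by
  have hinv := h.map_shift
  have hS0 : volume S ≠ 0 := (hSo.measure_pos _ ⟨0, h0⟩).ne'
  have hSt : volume S ≠ ∞ := ((measure_mono hS).trans_lt measure_closedBall_lt_top).ne
  have hm : Measurable fun f => (z * trig c f).re :=
    (Complex.continuous_re.comp (continuous_const.mul (continuous_trig c))).measurable
  have hb : ∀ f, |(z * trig c f).re| ≤ ‖z‖ := by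
    intro f
    refine (Complex.abs_re_le_norm _).trans ?_
    rw [norm_mul, norm_trig, mul_one]
  have hi : Integrable (fun f => (z * trig c f).re) μ :=
    Integrable.of_bound hm.aestronglyMeasurable ‖z‖ (Eventually.of_forall hb)
  refine good_of_approx hinv hs hS hS0 hm hi fun ε hε => ?_
  set η := ε / (‖z‖ + 1) with hη
  have hηpos : 0 < η := by positivity
  set δ := min 1 (η ^ 2 / 4) with hδ
  have hδpos : 0 < δ := by positivity
  obtain ⟨y, hy⟩ := exists_decorrelated (ρ := ρ) hρ c hδpos
  obtain ⟨N, hN⟩ := exists_nat_one_div_lt (show 0 < η ^ 2 / 2 by positivity)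
  set n := N + 1 with hn
  have hnpos : (0 : ℝ) < n := by positivity
  set φ := Real.exp (-var ρ c / 2) with hφ
  set D : C(E, ℝ) → ℂ := fun f =>
    ∑ j ∈ Finset.range n, (trig (c.mapDomain (y j + ·)) f - (φ : ℝ)) with hD
  have hDc : Continuous D :=
    continuous_finsetSum _ fun j _ => (continuous_trig _).sub continuous_const
  have hDb : ∀ f, ‖D f‖ ≤ n * (1 + φ) := by
    intro f
    refine (norm_sum_le _ _).trans ?_
    have : ∀ j ∈ Finset.range n, ‖trig (c.mapDomain (y j + ·)) f - (φ : ℝ)‖ ≤ 1 + φ := by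
      intro j _
      refine (norm_sub_le _ _).trans ?_
      rw [norm_trig, Complex.norm_real, Real.norm_of_nonneg (Real.exp_nonneg _)]
    refine (Finset.sum_le_sum this).trans (le_of_eq ?_)
    simp [mul_add]
  have hDsq : ∫ f, ‖D f‖ ^ 2 ∂μ ≤ n ^ 2 * η ^ 2 := by
    have e : ∀ f, ‖D f‖ ^ 2 = ∑ j ∈ Finset.range n, ∑ k ∈ Finset.range n,
        ((trig (c.mapDomain (y j + ·)) f - (φ : ℝ)) *
          (starRingEnd ℂ) (trig (c.mapDomain (y k + ·)) f - (φ : ℝ))).re := by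
      intro f
      have : ((‖D f‖ ^ 2 : ℝ) : ℂ) = D f * (starRingEnd ℂ) (D f) := by
        rw [Complex.mul_conj, Complex.normSq_eq_norm_sq]
      have h2 := congrArg Complex.re this
      rw [Complex.ofReal_re] at h2
      rw [h2, hD]
      simp only [map_sum, Finset.sum_mul_sum, Complex.re_sum]
    have h_intble : ∀ j k : ℕ, Integrable (fun f => ((trig (c.mapDomain (y j + ·)) f - (φ : ℝ)) *
          (starRingEnd ℂ) (trig (c.mapDomain (y k + ·)) f - (φ : ℝ))).re) μ := by
      intro j k
      refine Integrable.of_bound (C := (1 + φ) * (1 + φ)) ?_ (Eventually.of_forall fun f => ?_)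
      · have h1 := continuous_trig (c.mapDomain (y j + ·))
        have h2 := continuous_trig (c.mapDomain (y k + ·))
        exact Continuous.aestronglyMeasurable (by fun_prop)
      · refine (Complex.abs_re_le_norm _).trans ?_
        rw [norm_mul, RCLike.norm_conj]
        have : ∀ c : E →₀ ℝ, ‖trig c f - (φ : ℝ)‖ ≤ 1 + φ := by
          intro c
          refine (norm_sub_le _ _).trans ?_
          rw [norm_trig, Complex.norm_real, Real.norm_of_nonneg (Real.exp_nonneg _)]
        gcongr <;> exact this _
    simp_rw [e]
    rw [integral_finsetSum _ fun j _ => integrable_finsetSum _ fun k _ => h_intble j k]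
    have : ∀ j ∈ Finset.range n, ∫ f, ∑ k ∈ Finset.range n,
        ((trig (c.mapDomain (y j + ·)) f - (φ : ℝ)) *
          (starRingEnd ℂ) (trig (c.mapDomain (y k + ·)) f - (φ : ℝ))).re ∂μ ≤
        1 + n * (2 * δ) := by
      intro j hj
      rw [integral_finsetSum _ fun k _ => h_intble j k]
      simp_rw [hφ, integral_trig_sub_mul_conj h]
      have hle : ∀ k ∈ Finset.range n, Real.exp (-var ρ c) *
          (Real.exp (charFun (weighted ρ c) (y j - y k)).re - 1) ≤
          (if k = j then 1 else 0) + 2 * δ := by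
        intro k _
        split_ifs with hkj
        · subst hkj
          have h1 := var_sub_shift (ρ := ρ) c (y k) (y k)
          have h2 := var_nonneg ρ (c.mapDomain (y k + ·) + (-1 : ℝ) • c.mapDomain (y k + ·))
          have h3 : Real.exp (-var ρ c) * Real.exp (charFun (weighted ρ c) (y k - y k)).re ≤ 1 := by
            rw [← Real.exp_add]
            exact Real.exp_le_one_iff.2 (by linarith)
          have := Real.exp_nonneg (-var ρ c)
          nlinarith
        · have h1 := hy j k (Ne.symm hkj)
          have h2 := Real.abs_exp_sub_one_le (h1.le.trans (min_le_left _ _))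
          have h3 : Real.exp (-var ρ c) ≤ 1 :=
            Real.exp_le_one_iff.2 (by linarith [var_nonneg ρ c])
          calc _ ≤ Real.exp (-var ρ c) * (2 * δ) := by
                gcongr
                exact (le_abs_self _).trans (h2.trans (by linarith))
            _ ≤ 1 * (2 * δ) := by gcongr
            _ = 0 + 2 * δ := by ring
      refine (Finset.sum_le_sum hle).trans (le_of_eq ?_)
      rw [Finset.sum_add_distrib, Finset.sum_ite_eq', if_pos hj]
      simp
    refine (Finset.sum_le_sum this).trans ?_
    rw [Finset.sum_const, Finset.card_range, nsmul_eq_mul]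
    have h1 : (1 : ℝ) ≤ n * (η ^ 2 / 2) := by
      have : (1 : ℝ) / n < η ^ 2 / 2 := by rw [hn]; push_cast; exact hN
      rw [div_lt_iff₀ hnpos] at this
      linarith
    have h2 : δ ≤ η ^ 2 / 4 := min_le_right _ _
    calc (n : ℝ) * (1 + n * (2 * δ)) ≤ n * (n * (η ^ 2 / 2) + n * (2 * (η ^ 2 / 4))) := by gcongr
      _ = n ^ 2 * η ^ 2 := by ring
  have hDint : Integrable (fun f => ‖D f‖) μ :=
    Integrable.of_bound hDc.norm.aestronglyMeasurable (n * (1 + φ))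
      (Eventually.of_forall fun f => by rw [norm_norm]; exact hDb f)
  have hDint2 : Integrable (fun f => ‖D f‖ ^ 2) μ :=
    Integrable.of_bound (hDc.norm.pow 2).aestronglyMeasurable ((n * (1 + φ)) ^ 2)
      (Eventually.of_forall fun f => by
        rw [Real.norm_of_nonneg (by positivity)]; gcongr; exact hDb f)
  have hD1 : ∫ f, ‖D f‖ ∂μ ≤ n * η := by
    have hpt : ∀ f, ‖D f‖ ≤ (1 / (2 * (n * η))) * ‖D f‖ ^ 2 + n * η / 2 := by
      intro f
      have : 0 < n * η := by positivity
      have h3 : (1 / (2 * (n * η))) * ‖D f‖ ^ 2 + n * η / 2 - ‖D f‖ =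
          (‖D f‖ - n * η) ^ 2 / (2 * (n * η)) := by field_simp; ring
      have h4 : 0 ≤ (‖D f‖ - n * η) ^ 2 / (2 * (n * η)) := by positivity
      linarith
    refine (integral_mono hDint ((hDint2.const_mul _).add (integrable_const _)) hpt).trans ?_
    simp only [Pi.add_apply]
    rw [integral_add (hDint2.const_mul _) (integrable_const _), integral_const_mul]
    simp only [integral_const, probReal_univ, one_smul]
    calc _ ≤ 1 / (2 * (n * η)) * (n ^ 2 * η ^ 2) + n * η / 2 := by gcongr
      _ = n * η := by field_simp; ring
  refine ⟨fun f => (∑ j ∈ Finset.range n, (1 / (n : ℝ)) *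
    ((z * trig c f).re - (z * trig c (shift (y j) f)).re)) + φ * z.re, ?_, ?_⟩
  · refine Good.add hinv hS (Good.sum hinv hS hS0 _ fun j => ?_) (good_const hS0 hSt _)
    exact (good_coboundary hinv hS hSo hSc h0 hm hb (y j)).const_mul _
  · have e : ∀ f, (z * trig c f).re - ((∑ j ∈ Finset.range n, (1 / (n : ℝ)) *
        ((z * trig c f).re - (z * trig c (shift (y j) f)).re)) + φ * z.re) =
        (1 / n) * (z * D f).re := by
      intro f
      have h1 : (z * D f).re = (∑ j ∈ Finset.range n, (z * trig c (shift (y j) f)).re) -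
          n * (φ * z.re) := by
        have : z * D f = (∑ j ∈ Finset.range n, z * trig c (shift (y j) f)) -
            ((n * φ : ℝ) : ℂ) * z := by
          simp only [hD, Finset.mul_sum, mul_sub, Finset.sum_sub_distrib, trig_shift,
            Finset.sum_const, Finset.card_range, nsmul_eq_mul]
          push_cast; ring
        rw [this, Complex.sub_re, Complex.re_sum, Complex.re_ofReal_mul, mul_assoc]
      rw [← Finset.mul_sum, Finset.sum_sub_distrib, h1, Finset.sum_const, Finset.card_range,
        nsmul_eq_mul]
      field_simp
      ring
    simp_rw [e]
    calc ∫ f, |1 / n * (z * D f).re| ∂μ ≤ ∫ f, (1 / n * ‖z‖) * ‖D f‖ ∂μ := by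
          refine integral_mono_of_nonneg (Eventually.of_forall fun f => abs_nonneg _)
            (hDint.const_mul _) (Eventually.of_forall fun f => ?_)
          simp only
          rw [abs_mul, abs_of_nonneg (by positivity), mul_assoc, ← norm_mul]
          gcongr
          exact Complex.abs_re_le_norm _
      _ ≤ (1 / n * ‖z‖) * (n * η) := by
          rw [integral_const_mul]; gcongr
      _ = ‖z‖ * η := by field_simp
      _ ≤ (‖z‖ + 1) * η := by gcongr; linarith
      _ = ε := by rw [hη]; field_simp

end Trig

section Density

variable {E : Type*} [NormedAddCommGroup E] [InnerProductSpace ℝ E] [FiniteDimensional ℝ E]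
variable {μ : Measure C(E, ℝ)} [IsProbabilityMeasure μ]

theorem ae_eq_zero_of_forall_trig {h : C(E, ℝ) → ℝ} (hm : Measurable h) (hi : Integrable h μ)
    (h0 : ∀ c (z : ℂ), ∫ f, h f * (z * trig c f).re ∂μ = 0) : h =ᵐ[μ] 0 := by
  have hip : Integrable (fun f => h f + |h f|) μ := hi.add hi.abs
  set p : C(E, ℝ) → ℝ≥0∞ := fun f => ENNReal.ofReal (h f) with hp
  set q : C(E, ℝ) → ℝ≥0∞ := fun f => ENNReal.ofReal (-h f) with hq
  have hpm : Measurable p := hm.ennreal_ofReal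
  have hqm : Measurable q := hm.neg.ennreal_ofReal
  have : IsFiniteMeasure (μ.withDensity p) := isFiniteMeasure_withDensity_ofReal hi.2
  have : IsFiniteMeasure (μ.withDensity q) := isFiniteMeasure_withDensity_ofReal hi.neg.2
  have hc : ∀ c, ∫ f, (h f : ℂ) * trig c f ∂μ = 0 := by
    intro c
    have hI : Integrable (fun f => (h f : ℂ) * trig c f) μ :=
      hi.ofReal.mul_bdd (c := 1) (continuous_trig c).aestronglyMeasurable
        (Eventually.of_forall fun f => (norm_trig c f).le)
    have hr := integral_re (𝕜 := ℂ) hI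
    have him := integral_im (𝕜 := ℂ) hI
    simp only [RCLike.re_eq_complex_re, RCLike.im_eq_complex_im, Complex.re_ofReal_mul,
      Complex.im_ofReal_mul] at hr him
    refine Complex.ext ?_ ?_
    · rw [← hr]
      simpa using h0 c 1
    · rw [← him]
      have := h0 c (-Complex.I)
      simpa using this
  have heq : μ.withDensity p = μ.withDensity q := by
    refine ext_of_charFunctional fun c => ?_
    rw [integral_withDensity_eq_integral_toReal_smul hpm
      (Eventually.of_forall fun _ => ENNReal.ofReal_lt_top),
      integral_withDensity_eq_integral_toReal_smul hqm
      (Eventually.of_forall fun _ => ENNReal.ofReal_lt_top)]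
    have hpI : Integrable (fun f => (p f).toReal • Complex.exp (ev c f * Complex.I)) μ := by
      simp_rw [Complex.real_smul]
      refine Integrable.mul_bdd (c := 1) (Integrable.ofReal ?_)
        (continuous_trig c).aestronglyMeasurable
        (Eventually.of_forall fun f => (norm_trig c f).le)
      exact integrable_toReal_of_lintegral_ne_top hpm.aemeasurable hi.lintegral_lt_top.ne
    have hqI : Integrable (fun f => (q f).toReal • Complex.exp (ev c f * Complex.I)) μ := by
      simp_rw [Complex.real_smul]
      refine Integrable.mul_bdd (c := 1) (Integrable.ofReal ?_)
        (continuous_trig c).aestronglyMeasurable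
        (Eventually.of_forall fun f => (norm_trig c f).le)
      exact integrable_toReal_of_lintegral_ne_top hqm.aemeasurable hi.neg.lintegral_lt_top.ne
    rw [← sub_eq_zero, ← integral_sub hpI hqI, ← hc c]
    refine integral_congr_ae (Eventually.of_forall fun f => ?_)
    simp only
    rw [← sub_smul, hp, hq, Complex.real_smul]
    congr 2
    simp only [ENNReal.toReal_ofReal']
    exact max_zero_sub_eq_self _
  have := (withDensity_eq_iff_of_sigmaFinite hpm.aemeasurable hqm.aemeasurable).1 heq
  filter_upwards [this] with f hf
  simp only [hp, hq] at hf
  simp only [Pi.zero_apply]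
  rcases le_total (h f) 0 with hle | hle
  · rw [ENNReal.ofReal_of_nonpos hle, eq_comm, ENNReal.ofReal_eq_zero] at hf
    linarith
  · rw [ENNReal.ofReal_of_nonpos (by linarith : -h f ≤ 0), ENNReal.ofReal_eq_zero] at hf
    linarith

variable [MeasureSpace E] [BorelSpace E] [(volume : Measure E).IsAddHaarMeasure]
variable {ρ : Measure E} [IsFiniteMeasure ρ]

theorem integral_abs_sub_le_norm (h g : Lp ℝ 2 μ) : ∫ f, |h f - g f| ∂μ ≤ ‖h - g‖ := by
  have h1 : ∫ f, |h f - g f| ∂μ = (eLpNorm (h - g : Lp ℝ 2 μ) 1 μ).toReal := by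
    rw [eLpNorm_one_eq_lintegral_enorm, ← integral_norm_eq_lintegral_enorm
      (Lp.aestronglyMeasurable _)]
    refine integral_congr_ae ?_
    filter_upwards [Lp.coeFn_sub h g] with f hf
    rw [hf]; rfl
  rw [h1, Lp.norm_def]
  refine ENNReal.toReal_mono (Lp.eLpNorm_ne_top _) ?_
  exact eLpNorm_le_eLpNorm_of_exponent_le (by norm_num) (Lp.aestronglyMeasurable _)

theorem Good.congr_ae (hinv : ∀ x : E, μ.map (shift x) = μ) {S : Set E} {s : ℝ} (hs : 0 < s)
    (hS : S ⊆ Metric.closedBall 0 s) (hS0 : volume S ≠ 0) {G H : C(E, ℝ) → ℝ}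
    (hG : Good μ S G) (hH : Measurable H) (h : G =ᵐ[μ] H) : Good μ S H := by
  refine good_of_approx hinv hs hS hS0 hH (hG.2.1.congr h) fun ε hε => ⟨G, hG, ?_⟩
  rw [integral_eq_zero_of_ae]
  · exact hε.le
  · filter_upwards [h] with f hf; simp [hf]

theorem good_of_integrable (h : HasSpectralMeasure μ ρ) (hρ : ∀ t, ρ {t} = 0) {S : Set E} {s : ℝ}
    (hs : 0 < s) (hS : S ⊆ Metric.closedBall 0 s) (hSo : IsOpen S) (hSc : Convex ℝ S)
    (h0 : (0 : E) ∈ S) {H : C(E, ℝ) → ℝ} (hH : Measurable H) (hHi : Integrable H μ) :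
    Good μ S H := by
  have hinv := h.map_shift
  have hS0 : volume S ≠ 0 := (hSo.measure_pos _ ⟨0, h0⟩).ne'
  have hSt : volume S ≠ ∞ := ((measure_mono hS).trans_lt measure_closedBall_lt_top).ne
  have hLm : ∀ g : Lp ℝ 2 μ, Measurable g := fun g => (Lp.stronglyMeasurable g).measurable
  let W : Submodule ℝ (Lp ℝ 2 μ) :=
    { carrier := {g | Good μ S g}
      add_mem' := by
        intro a b ha hb
        exact (Good.add hinv hS ha hb).congr_ae hinv hs hS hS0 (hLm _) (Lp.coeFn_add a b).symm
      zero_mem' := by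
        exact (good_const hS0 hSt 0).congr_ae hinv hs hS hS0 (hLm _) (Lp.coeFn_zero _ _ _).symm
      smul_mem' := by
        intro r a ha
        exact (Good.const_mul ha r).congr_ae hinv hs hS hS0 (hLm _) (Lp.coeFn_smul r a).symm }
  have hWc : IsClosed (W : Set (Lp ℝ 2 μ)) := by
    refine isClosed_of_closure_subset fun g hg => ?_
    refine good_of_approx hinv hs hS hS0 (hLm g)
      ((Lp.memLp g).integrable (by norm_num)) fun ε hε => ?_
    obtain ⟨b, hb, hbg⟩ := Metric.mem_closure_iff.1 hg ε hε
    refine ⟨b, hb, (integral_abs_sub_le_norm g b).trans ?_⟩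
    rw [← dist_eq_norm]; exact hbg.le
  have hWtop : W = ⊤ := by
    have : CompleteSpace W := hWc.completeSpace_coe
    rw [← Submodule.orthogonal_eq_bot_iff, Submodule.eq_bot_iff]
    intro g hg
    rw [Submodule.mem_orthogonal] at hg
    have hz : g =ᵐ[μ] 0 := by
      refine ae_eq_zero_of_forall_trig (hLm g) ((Lp.memLp g).integrable (by norm_num)) fun c z => ?_
      have hG := good_trig h hρ hs hS hSo hSc h0 c z
      have hmem : MemLp (fun f => (z * trig c f).re) 2 μ := by
        refine MemLp.of_bound hG.1.aestronglyMeasurable ‖z‖ (Eventually.of_forall fun f => ?_)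
        refine (Complex.abs_re_le_norm _).trans ?_
        rw [norm_mul, norm_trig, mul_one]
      have hw : hmem.toLp _ ∈ W := hG.congr_ae hinv hs hS hS0 (hLm _) hmem.coeFn_toLp.symm
      have h1 := hg _ hw
      rw [L2.inner_def] at h1
      rw [← h1]
      refine integral_congr_ae ?_
      filter_upwards [hmem.coeFn_toLp] with f hf
      rw [hf]; rfl
    exact Lp.eq_zero_iff_ae_eq_zero.2 hz
  refine good_of_approx hinv hs hS hS0 hH hHi fun ε hε => ?_
  set T : ℕ → C(E, ℝ) → ℝ := fun n f => if |H f| ≤ n then H f else 0 with hT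
  have hTm : ∀ n, Measurable (T n) := fun n =>
    Measurable.ite (measurableSet_le hH.abs measurable_const) hH measurable_const
  have hTg : ∀ n, Good μ S (T n) := by
    intro n
    have hmem : MemLp (T n) 2 μ := by
      refine MemLp.of_bound (hTm n).aestronglyMeasurable n (Eventually.of_forall fun f => ?_)
      simp only [hT]
      split_ifs with hle
      · exact hle
      · simp
    have hw : hmem.toLp _ ∈ W := by rw [hWtop]; trivial
    exact Good.congr_ae hinv hs hS hS0 hw (hTm n) hmem.coeFn_toLp
  have hlim : Tendsto (fun n => ∫ f, |H f - T n f| ∂μ) atTop (𝓝 (∫ _, (0 : ℝ) ∂μ)) := by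
    refine tendsto_integral_of_dominated_convergence (fun f => |H f|)
      (fun n => (hH.sub (hTm n)).abs.aestronglyMeasurable) hHi.abs ?_ ?_
    · intro n
      refine Eventually.of_forall fun f => ?_
      simp only [hT, Real.norm_eq_abs, abs_abs]
      split_ifs <;> simp
    · refine Eventually.of_forall fun f => ?_
      obtain ⟨N, hN⟩ := exists_nat_ge |H f|
      refine tendsto_const_nhds.congr' (eventually_atTop.2 ⟨N, fun n hn => ?_⟩)
      have : |H f| ≤ n := hN.trans (by exact_mod_cast hn)
      simp [hT, this]
  rw [integral_zero] at hlim
  obtain ⟨n, hn⟩ := (hlim.eventually_lt_const hε).exists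
  exact ⟨T n, hTg n, hn.le⟩

/-- The pointwise ergodic theorem along real dilations, for nonnegative observables. -/
theorem Good.tendsto_real (hinv : ∀ x : E, μ.map (shift x) = μ) {S : Set E} {s : ℝ}
    (hS : S ⊆ Metric.closedBall 0 s) (hSo : IsOpen S) (hSc : Convex ℝ S) (h0 : (0 : E) ∈ S)
    {H : C(E, ℝ) → ℝ} (hH : Good μ S H) (hpos : ∀ f, 0 ≤ H f) :
    ∀ᵐ f ∂μ, Tendsto (fun R : ℝ => avg S H R f) atTop (𝓝 (∫ f, H f ∂μ)) := by
  filter_upwards [hH.2.2, ae_integrableOn_shift hinv hH.1 hH.2.1] with f h1 h2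
  have hSpos : 0 < (volume S).toReal := ENNReal.toReal_pos (hSo.measure_pos _ ⟨0, h0⟩).ne'
    ((measure_mono hS).trans_lt measure_closedBall_lt_top).ne
  set D := Module.finrank ℝ E
  set I : ℝ → ℝ := fun R => ∫ x in R • S, H (shift x f) with hI
  have hmono : ∀ a b : ℝ, 0 ≤ a → a ≤ b → I a ≤ I b := by
    intro a b ha hab
    refine setIntegral_mono_set ((h2 _).mono_set (smul_subset_closedBall hS (ha.trans hab)))
      (Eventually.of_forall fun x => hpos _) (LE.le.eventuallyLE ?_)
    rintro _ ⟨x, hx, rfl⟩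
    rcases eq_or_lt_of_le ha with rfl | ha'
    · exact ⟨0, h0, by simp⟩
    · have hb : 0 < b := ha'.trans_le hab
      refine ⟨(a / b) • x, ?_, ?_⟩
      · exact (hSc.starConvex h0).smul_mem hx (by positivity) ((div_le_one hb).2 hab)
      · simp only [smul_smul]; congr 1; field_simp
  have hInn : ∀ a, 0 ≤ I a := fun a => integral_nonneg fun x => hpos _
  have hfl : Tendsto (fun R : ℝ => ((⌊R⌋₊ : ℕ) : ℝ) / R) atTop (𝓝 1) :=
    tendsto_nat_floor_div_atTop
  have hce : Tendsto (fun R : ℝ => ((⌈R⌉₊ : ℕ) : ℝ) / R) atTop (𝓝 1) :=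
    tendsto_nat_ceil_div_atTop
  have hlo : Tendsto (fun R : ℝ => (((⌊R⌋₊ : ℕ) : ℝ) / R) ^ D * avg S H (⌊R⌋₊ : ℕ) f) atTop
      (𝓝 (1 ^ D * ∫ f, H f ∂μ)) := (hfl.pow D).mul (h1.comp tendsto_nat_floor_atTop)
  have hhi : Tendsto (fun R : ℝ => (((⌈R⌉₊ : ℕ) : ℝ) / R) ^ D * avg S H (⌈R⌉₊ : ℕ) f) atTop
      (𝓝 (1 ^ D * ∫ f, H f ∂μ)) := (hce.pow D).mul (h1.comp tendsto_nat_ceil_atTop)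
  rw [one_pow, one_mul] at hlo hhi
  have hform : ∀ a R : ℝ, 0 < a → 0 < R → (a / R) ^ D * avg S H a f =
      I a / (R ^ D * (volume S).toReal) := by
    intro a R ha hR
    simp only [avg, hI, D]
    rw [div_pow]
    field_simp
  refine tendsto_of_tendsto_of_tendsto_of_le_of_le' hlo hhi ?_ ?_
  · filter_upwards [eventually_ge_atTop 1] with R hR
    have : (0 : ℝ) < (⌊R⌋₊ : ℕ) := by exact_mod_cast Nat.floor_pos.2 hR
    have hR0 : 0 < R := by linarith
    rw [hform _ _ this hR0, avg]
    gcongr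
    exact hmono _ _ this.le (Nat.floor_le hR0.le)
  · filter_upwards [eventually_ge_atTop 1] with R hR
    have hR0 : 0 < R := by linarith
    have : (0 : ℝ) < (⌈R⌉₊ : ℕ) := by exact_mod_cast Nat.ceil_pos.2 hR0
    rw [hform _ _ this hR0, avg]
    gcongr
    exact hmono _ _ hR0.le (Nat.le_ceil R)

end Density

section Components

variable {E : Type*} [NormedAddCommGroup E] [InnerProductSpace ℝ E] [FiniteDimensional ℝ E]

/-- The nodal domain of `f` containing `x`; it is empty if `f x = 0`. -/
def cc (f : C(E, ℝ)) (x : E) : Set E := connectedComponentIn {x | f x ≠ 0} x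

theorem isOpen_ne_zero (f : C(E, ℝ)) : IsOpen {x | f x ≠ 0} :=
  isOpen_ne_fun f.continuous continuous_const

theorem isOpen_cc (f : C(E, ℝ)) (x : E) : IsOpen (cc f x) :=
  (isOpen_ne_zero f).connectedComponentIn

theorem cc_subset (f : C(E, ℝ)) (x : E) : cc f x ⊆ {x | f x ≠ 0} := connectedComponentIn_subset _ _

theorem mem_cc {f : C(E, ℝ)} {x : E} (h : f x ≠ 0) : x ∈ cc f x := mem_connectedComponentIn h

theorem cc_eq {f : C(E, ℝ)} {x y : E} (h : y ∈ cc f x) : cc f y = cc f x :=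
  (connectedComponentIn_eq h).symm

theorem cc_shift (f : C(E, ℝ)) (x y : E) : cc (shift x f) y = (fun z => x + z) ⁻¹' cc f (x + y) := by
  by_cases hy : f (x + y) ≠ 0
  · have h := (Homeomorph.addLeft x).image_connectedComponentIn (s := {z | shift x f z ≠ 0})
      (x := y) hy
    have himg : (Homeomorph.addLeft x) '' {z | shift x f z ≠ 0} = {z | f z ≠ 0} := by
      ext z
      simp only [mem_image, mem_ofPred_eq, shift_apply, Homeomorph.coe_addLeft]
      exact ⟨by rintro ⟨w, hw, rfl⟩; exact hw, fun hz => ⟨-x + z, by simpa using hz, by simp⟩⟩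
    rw [himg] at h
    unfold cc
    simp only [Homeomorph.coe_addLeft] at h
    rw [← h, preimage_image_eq _ (add_right_injective x)]
  · have h1 : cc f (x + y) = ∅ := connectedComponentIn_eq_empty (by simpa using hy)
    have h2 : cc (shift x f) y = ∅ := connectedComponentIn_eq_empty (by simpa using hy)
    rw [h1, h2, preimage_empty]

theorem isOpen_cc_zero : IsOpen {p : C(E, ℝ) × E | p.2 ∈ cc p.1 0} := by
  rw [isOpen_iff_mem_nhds]
  rintro ⟨f, y⟩ (hy : y ∈ cc f 0)
  have h0 : f 0 ≠ 0 := by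
    by_contra h
    have : cc f 0 = ∅ := connectedComponentIn_eq_empty (by simpa using h)
    rw [this] at hy
    exact hy
  have hc : IsConnected (cc f 0) := isConnected_connectedComponentIn_iff.2 h0
  have hp : IsPathConnected (cc f 0) := (isOpen_cc f 0).isConnected_iff_isPathConnected.1 hc
  obtain ⟨γ, hγ⟩ := hp.joinedIn 0 (mem_cc h0) y hy
  obtain ⟨r, hr, hball⟩ := Metric.nhds_basis_closedBall.mem_iff.1 ((isOpen_cc f 0).mem_nhds hy)
  set K : Set E := range γ ∪ Metric.closedBall y r with hK
  have hKc : IsCompact K := (isCompact_range γ.continuous).union (isCompact_closedBall y r)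
  have hKp : IsPreconnected K := by
    refine IsPreconnected.union y ⟨1, γ.target⟩ (Metric.mem_closedBall_self hr.le) ?_ ?_
    · exact isPreconnected_range γ.continuous
    · exact (convex_closedBall y r).isPreconnected
  have hKU : MapsTo f K {0}ᶜ := by
    rintro z (⟨t, rfl⟩ | hz)
    · exact cc_subset f 0 (hγ t)
    · exact cc_subset f 0 (hball hz)
  have hn : {f' : C(E, ℝ) | MapsTo f' K {0}ᶜ} ∈ 𝓝 f :=
    (ContinuousMap.isOpen_setOfPred_mapsTo hKc isOpen_compl_singleton).mem_nhds hKU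
  filter_upwards [prod_mem_nhds hn (Metric.closedBall_mem_nhds y hr)] with p hp
  have hsub : K ⊆ cc p.1 0 :=
    hKp.subset_connectedComponentIn (Or.inl ⟨0, γ.source⟩) fun z hz => hp.1 hz
  exact hsub (Or.inr hp.2)

/-- The nodal domains of `f` that are contained in `A`. -/
def comps (f : C(E, ℝ)) (A : Set E) : Set (Set E) :=
  {C | (∃ x ∈ {x | f x ≠ 0}, C = connectedComponentIn {x | f x ≠ 0} x) ∧ C ⊆ A}

theorem pairwise_disjoint_comps (f : C(E, ℝ)) (A : Set E) :
    (comps f A).PairwiseDisjoint id := by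
  rintro _ ⟨⟨x, -, rfl⟩, -⟩ _ ⟨⟨y, -, rfl⟩, -⟩ hne
  by_contra hd
  obtain ⟨z, hz1, hz2⟩ := not_disjoint_iff.1 hd
  exact hne ((connectedComponentIn_eq hz1).trans (connectedComponentIn_eq hz2).symm)

variable [MeasureSpace E] [BorelSpace E] [(volume : Measure E).IsAddHaarMeasure]

theorem measurable_volume_cc : Measurable fun f : C(E, ℝ) => volume (cc f 0) :=
  measurable_measure_prodMk_left (ν := (volume : Measure E)) (isOpen_cc_zero (E := E)).measurableSet

theorem measurableSet_cc_subset (L : ℝ) :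
    MeasurableSet {f : C(E, ℝ) | f 0 ≠ 0 ∧ cc f 0 ⊆ Metric.closedBall 0 L} := by
  refine MeasurableSet.inter ?_ ?_
  · exact (measurableSet_singleton 0).compl.preimage (measurable_eval (0 : E))
  · have : {f : C(E, ℝ) | cc f 0 ⊆ Metric.closedBall 0 L}ᶜ =
        Prod.fst '' ({p : C(E, ℝ) × E | p.2 ∈ cc p.1 0} ∩ {p | L < ‖p.2‖}) := by
      ext f
      simp only [mem_compl_iff, mem_ofPred_eq, not_subset, mem_closedBall_zero_iff, not_le,
        mem_image, mem_inter_iff, Prod.exists, exists_and_right, exists_eq_right]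
    refine MeasurableSet.of_compl ?_
    change MeasurableSet {f : C(E, ℝ) | cc f 0 ⊆ Metric.closedBall 0 L}ᶜ
    rw [this]
    refine (isOpenMap_fst _ (isOpen_cc_zero.inter ?_)).measurableSet
    exact isOpen_lt continuous_const continuous_snd.norm

open Classical in
/-- The reciprocal volume of the nodal domain of the origin, if it lies in the ball of
radius `L`. -/
noncomputable def density (L : ℝ) (f : C(E, ℝ)) : ℝ≥0∞ :=
  if f 0 ≠ 0 ∧ cc f 0 ⊆ Metric.closedBall 0 L then (volume (cc f 0))⁻¹ else 0

theorem measurable_density (L : ℝ) : Measurable (density L : C(E, ℝ) → ℝ≥0∞) :=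
  Measurable.ite (measurableSet_cc_subset L) measurable_volume_cc.inv measurable_const

theorem density_mono {L L' : ℝ} (h : L ≤ L') (f : C(E, ℝ)) : density L f ≤ density L' f := by
  unfold density
  split_ifs with h1 h2
  · exact le_rfl
  · exact absurd ⟨h1.1, h1.2.trans (Metric.closedBall_subset_closedBall h)⟩ h2
  · exact zero_le
  · exact le_rfl

/-- The reciprocal volume of the nodal domain of the origin, if it is bounded. -/
noncomputable def totalDensity (f : C(E, ℝ)) : ℝ≥0∞ := ⨆ n : ℕ, density n f

theorem measurable_totalDensity : Measurable (totalDensity : C(E, ℝ) → ℝ≥0∞) :=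
  Measurable.iSup fun n => measurable_density n

theorem density_le_totalDensity (L : ℝ) (f : C(E, ℝ)) : density L f ≤ totalDensity f := by
  obtain ⟨n, hn⟩ := exists_nat_ge L
  exact (density_mono hn f).trans (le_iSup (fun n : ℕ => density n f) n)

theorem volume_cc_shift (f : C(E, ℝ)) (x : E) : volume (cc (shift x f) 0) = volume (cc f x) := by
  rw [cc_shift, measure_preimage_add, add_zero]

theorem le_totalDensity_shift {f : C(E, ℝ)} {C A : Set E} (hC : C ∈ comps f A)
    (hA : Bornology.IsBounded A) {x : E} (hx : x ∈ C) :
    (volume C)⁻¹ ≤ totalDensity (shift x f) := by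
  obtain ⟨⟨y, hy, rfl⟩, hCA⟩ := hC
  have hfx : f x ≠ 0 := connectedComponentIn_subset _ _ hx
  have hcc : cc f x = connectedComponentIn {x | f x ≠ 0} y := (connectedComponentIn_eq hx).symm
  obtain ⟨L, hL⟩ := (hA.subset hCA).subset_closedBall x
  refine le_trans ?_ (density_le_totalDensity L _)
  unfold density
  rw [if_pos, volume_cc_shift, hcc]
  refine ⟨by simpa using hfx, ?_⟩
  rw [cc_shift, add_zero, hcc]
  intro z hz
  have := hL hz
  simpa [dist_eq_norm] using this

theorem card_le_lintegral {f : C(E, ℝ)} {A : Set E} (hA : Bornology.IsBounded A)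
    (F : Finset (Set E)) (hF : (F : Set (Set E)) ⊆ comps f A) :
    (F.card : ℝ≥0∞) ≤ ∫⁻ x in A, totalDensity (shift x f) := by
  have hmeas : ∀ C ∈ F, MeasurableSet C := by
    intro C hC
    obtain ⟨⟨y, -, rfl⟩, -⟩ := hF hC
    exact (isOpen_cc f y).measurableSet
  calc (F.card : ℝ≥0∞) = ∑ C ∈ F, 1 := by simp
    _ ≤ ∑ C ∈ F, ∫⁻ x in C, totalDensity (shift x f) := by
        refine Finset.sum_le_sum fun C hC => ?_
        have hCc := hF hC
        obtain ⟨⟨y, hy, hCy⟩, hCA⟩ := hF hC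
        have h0 : volume C ≠ 0 := by
          rw [hCy]
          exact ((isOpen_cc f y).measure_pos _ ⟨y, mem_cc hy⟩).ne'
        have ht : volume C ≠ ∞ := (hA.subset hCA).measure_lt_top.ne
        calc (1 : ℝ≥0∞) = ∫⁻ x in C, (volume C)⁻¹ := by
              rw [setLIntegral_const, ENNReal.inv_mul_cancel h0 ht]
          _ ≤ _ := setLIntegral_mono' (hmeas C hC) fun x hx => le_totalDensity_shift hCc hA hx
    _ = ∫⁻ x in ⋃ C ∈ F, C, totalDensity (shift x f) := by
        exact (lintegral_biUnion_finset (t := id) (fun C hC C' hC' h =>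
          pairwise_disjoint_comps f A (hF hC) (hF hC') h) hmeas _).symm
    _ ≤ _ := lintegral_mono_set (iUnion₂_subset fun C hC => (hF hC).2)

theorem encard_le_of_forall_finset {α : Type*} {s : Set α} {a : ℝ≥0∞}
    (h : ∀ F : Finset α, (F : Set α) ⊆ s → (F.card : ℝ≥0∞) ≤ a) : (s.encard : ℝ≥0∞) ≤ a := by
  by_cases hs : s.Finite
  · have := h hs.toFinset (by simp)
    rwa [hs.encard_eq_coe_toFinset_card]
  · have htop : a = ∞ := by
      refine ENNReal.eq_top_of_forall_nnreal_le fun r => ?_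
      obtain ⟨n, hn⟩ := exists_nat_ge r
      obtain ⟨F, hF, hFn⟩ := (show s.Infinite from hs).exists_subset_card_eq n
      have := h F hF
      rw [hFn] at this
      refine le_trans ?_ this
      exact_mod_cast hn
    rw [htop]; exact le_top

theorem encard_comps_le {f : C(E, ℝ)} {A : Set E} (hA : Bornology.IsBounded A) :
    ((comps f A).encard : ℝ≥0∞) ≤ ∫⁻ x in A, totalDensity (shift x f) :=
  encard_le_of_forall_finset fun F hF => card_le_lintegral hA F hF

theorem lintegral_density_le {f : C(E, ℝ)} {A A' : Set E} {L : ℝ}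
    (hA : ∀ x ∈ A', Metric.closedBall x L ⊆ A)
    (hA' : MeasurableSet A') :
    ∫⁻ x in A', density L (shift x f) ≤ ((comps f A).encard : ℝ≥0∞) := by
  by_cases hs : (comps f A).Finite
  swap
  · rw [Set.Infinite.encard_eq hs]; exact le_top
  rw [hs.encard_eq_coe_toFinset_card]
  have hmeas : ∀ C ∈ comps f A, MeasurableSet C := by
    rintro C ⟨⟨y, -, rfl⟩, -⟩
    exact (isOpen_cc f y).measurableSet
  calc ∫⁻ x in A', density L (shift x f)
      ≤ ∫⁻ x in A', ∑ C ∈ hs.toFinset, C.indicator (fun _ => (volume C)⁻¹) x := by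
        refine setLIntegral_mono' hA' fun x hx => ?_
        unfold density
        split_ifs with h
        swap
        · exact zero_le
        rw [cc_shift, add_zero] at h
        have hfx : f x ≠ 0 := by simpa using h.1
        have hsub : cc f x ⊆ Metric.closedBall x L := by
          intro z hz
          have : -x + z ∈ Metric.closedBall (0 : E) L := h.2 (by simpa using hz)
          rw [mem_closedBall_zero_iff] at this
          rwa [mem_closedBall_iff_norm, ← neg_add_eq_sub]
        have hmem : cc f x ∈ hs.toFinset := by
          rw [Set.Finite.mem_toFinset]
          exact ⟨⟨x, hfx, rfl⟩, hsub.trans (hA x hx)⟩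
        refine le_trans (le_of_eq ?_) (Finset.single_le_sum (fun C _ => zero_le) hmem)
        rw [indicator_of_mem (mem_cc hfx), volume_cc_shift]
    _ = ∑ C ∈ hs.toFinset, ∫⁻ x in A', C.indicator (fun _ => (volume C)⁻¹) x := by
        refine lintegral_finsetSum' _ fun C hC => ?_
        exact (measurable_const.indicator (hmeas C ((Set.Finite.mem_toFinset _).1 hC))).aemeasurable
    _ ≤ ∑ C ∈ hs.toFinset, 1 := by
        refine Finset.sum_le_sum fun C hC => ?_
        refine (setLIntegral_le_lintegral _ _).trans ?_
        rw [lintegral_indicator (hmeas C ((Set.Finite.mem_toFinset _).1 hC)), setLIntegral_const]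
        exact ENNReal.inv_mul_le_one _
    _ = _ := by simp

end Components

section Grid

variable {d : ℕ}

theorem norm_le_sum_abs (x : EuclideanSpace ℝ (Fin d)) : ‖x‖ ≤ ∑ i, |x i| := by
  conv_lhs => rw [← (EuclideanSpace.basisFun (Fin d) ℝ).sum_repr x]
  refine (norm_sum_le _ _).trans (Finset.sum_le_sum fun i _ => ?_)
  rw [norm_smul]
  simp

/-- The `i`-th coordinate vector, scaled by `δ`. -/
noncomputable def step (δ : ℝ) (i : Fin d) : EuclideanSpace ℝ (Fin d) :=
  EuclideanSpace.single i δ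

theorem norm_step (δ : ℝ) (i : Fin d) : ‖step δ i‖ = |δ| := by
  simp [step]

/-- The point of the lattice `δ ℤᵈ` with index `n`. -/
noncomputable def gridPoint (δ : ℝ) (n : Fin d → ℤ) : EuclideanSpace ℝ (Fin d) :=
  WithLp.toLp 2 fun i => δ * n i

/-- The origin is a local extremum of `f` relative to its neighbours in `δ ℤᵈ`. -/
def IsGridExtr (δ : ℝ) (f : C(EuclideanSpace ℝ (Fin d), ℝ)) : Prop :=
  (∀ i, f (step δ i) ≤ f 0 ∧ f (-step δ i) ≤ f 0) ∨
    (∀ i, f 0 ≤ f (step δ i) ∧ f 0 ≤ f (-step δ i))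

theorem measurableSet_isGridExtr (δ : ℝ) :
    MeasurableSet {f : C(EuclideanSpace ℝ (Fin d), ℝ) | IsGridExtr δ f} := by
  have h : ∀ x y : EuclideanSpace ℝ (Fin d),
      MeasurableSet {f : C(EuclideanSpace ℝ (Fin d), ℝ) | f x ≤ f y} := fun x y =>
    measurableSet_le (measurable_eval x) (measurable_eval y)
  have heq : {f : C(EuclideanSpace ℝ (Fin d), ℝ) | IsGridExtr δ f} =
      (⋂ i, {f | f (step δ i) ≤ f 0} ∩ {f | f (-step δ i) ≤ f 0}) ∪
        ⋂ i, {f | f 0 ≤ f (step δ i)} ∩ {f | f 0 ≤ f (-step δ i)} := by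
    ext f
    simp [IsGridExtr]
  rw [heq]
  exact (MeasurableSet.iInter fun i => (h _ _).inter (h _ _)).union
    (MeasurableSet.iInter fun i => (h _ _).inter (h _ _))

/-- The indices of the lattice points in the cube of half side `M`. -/
noncomputable def gridIndex (d M : ℕ) : Finset (Fin d → ℤ) :=
  Fintype.piFinset fun _ => Finset.Icc (-(M : ℤ)) M

theorem card_gridIndex (d M : ℕ) : (gridIndex d M).card = (2 * M + 1) ^ d := by
  rw [gridIndex, Fintype.card_piFinset]
  simp only [Int.card_Icc, Finset.prod_const, Finset.card_univ, Fintype.card_fin]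
  congr 1; omega

theorem exists_gridPoint_near {δ : ℝ} (hδ : 0 < δ) (x : EuclideanSpace ℝ (Fin d)) :
    ∃ n, ‖gridPoint δ n - x‖ ≤ d * δ := by
  refine ⟨fun i => round (x i / δ), (norm_le_sum_abs _).trans ?_⟩
  have : ∀ i ∈ Finset.univ, |(gridPoint δ (fun i => round (x i / δ)) - x) i| ≤ δ := by
    intro i _
    have h := abs_sub_round (x i / δ)
    have h2 : (gridPoint δ (fun i => round (x i / δ)) - x) i =
        -(δ * (x i / δ - round (x i / δ))) := by
      simp only [gridPoint, PiLp.sub_apply]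
      field_simp
      ring
    rw [h2, abs_neg, abs_mul, abs_of_pos hδ]
    nlinarith
  refine (Finset.sum_le_sum this).trans ?_
  simp

theorem finite_gridPoint_mem {δ : ℝ} (hδ : 0 < δ) {C : Set (EuclideanSpace ℝ (Fin d))}
    {r : ℝ} (hC : C ⊆ Metric.closedBall 0 r) {M : ℕ} (hM : r ≤ δ * M) {n : Fin d → ℤ}
    (hn : gridPoint δ n ∈ C) : n ∈ gridIndex d M := by
  have h1 := hC hn
  rw [mem_closedBall_zero_iff] at h1
  rw [gridIndex, Fintype.mem_piFinset]
  intro i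
  have h2 : |δ * n i| ≤ δ * M := by
    have := PiLp.norm_apply_le (gridPoint δ n) i
    simp only [gridPoint, Real.norm_eq_abs] at this
    exact this.trans (h1.trans hM)
  rw [abs_mul, abs_of_pos hδ] at h2
  have h3 : |(n i : ℝ)| ≤ M := le_of_mul_le_mul_left h2 hδ
  rw [Finset.mem_Icc, ← abs_le]
  exact_mod_cast h3

theorem exists_isGridExtr (f : C(EuclideanSpace ℝ (Fin d), ℝ))
    {C : Set (EuclideanSpace ℝ (Fin d))} {r : ℝ}
    (hC : C ∈ comps f (Metric.closedBall 0 r)) :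
    ∃ δ₀ > 0, ∀ δ, 0 < δ → δ ≤ δ₀ → ∀ M : ℕ, r ≤ δ * M →
      ∃ n ∈ gridIndex d M, gridPoint δ n ∈ C ∧ IsGridExtr δ (shift (gridPoint δ n) f) := by
  obtain ⟨⟨x, hx, rfl⟩, hCr⟩ := hC
  have hxC : x ∈ cc f x := mem_cc hx
  have hm : 0 < |f x| := abs_pos.2 hx
  have huc : UniformContinuousOn f (Metric.closedBall 0 (r + 1)) :=
    (isCompact_closedBall _ _).uniformContinuousOn_of_continuous f.continuous.continuousOn
  obtain ⟨δ₁, hδ₁, hf⟩ := Metric.uniformContinuousOn_iff.1 huc (|f x| / 2) (by positivity)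
  obtain ⟨δ₂, hδ₂, hball⟩ := Metric.isOpen_iff.1 (isOpen_cc f x) x hxC
  refine ⟨min (min (δ₁ / (2 * (d + 1))) (δ₂ / (2 * (d + 1)))) 1, by positivity, ?_⟩
  intro δ hδ hδ0 M hM
  have hd1 : d * δ < δ₁ ∧ δ < δ₁ := by
    have : δ ≤ δ₁ / (2 * (d + 1)) := hδ0.trans ((min_le_left _ _).trans (min_le_left _ _))
    rw [le_div_iff₀ (by positivity)] at this
    have : (0 : ℝ) ≤ d := by positivity
    constructor <;> nlinarith
  have hd2 : d * δ < δ₂ := by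
    have : δ ≤ δ₂ / (2 * (d + 1)) := hδ0.trans ((min_le_left _ _).trans (min_le_right _ _))
    rw [le_div_iff₀ (by positivity)] at this
    have : (0 : ℝ) ≤ d := by positivity
    nlinarith
  have hd3 : δ ≤ 1 := hδ0.trans (min_le_right _ _)
  have hsub1 : ∀ z ∈ cc f x, z ∈ Metric.closedBall (0 : EuclideanSpace ℝ (Fin d)) (r + 1) :=
    fun z hz => Metric.closedBall_subset_closedBall (by linarith) (hCr hz)
  obtain ⟨n₀, hn₀⟩ := exists_gridPoint_near hδ x
  have hn₀C : gridPoint δ n₀ ∈ cc f x := hball (by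
    rw [Metric.mem_ball, dist_eq_norm]; exact hn₀.trans_lt hd2)
  have hn₀f : |f x| / 2 < |f (gridPoint δ n₀)| := by
    have := hf _ (hsub1 _ hn₀C) _ (hsub1 _ hxC) (by
      rw [dist_eq_norm]; exact hn₀.trans_lt hd1.1)
    rw [Real.dist_eq] at this
    have := abs_sub_abs_le_abs_sub (f x) (f (gridPoint δ n₀))
    rw [abs_sub_comm] at this
    linarith
  classical
  set G := (gridIndex d M).filter fun n => gridPoint δ n ∈ cc f x with hG
  have hmemG : ∀ n, gridPoint δ n ∈ cc f x → n ∈ G := fun n hn =>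
    Finset.mem_filter.2 ⟨finite_gridPoint_mem hδ hCr hM hn, hn⟩
  obtain ⟨n, hnG, hmax⟩ := G.exists_max_image (fun n => |f (gridPoint δ n)|) ⟨n₀, hmemG _ hn₀C⟩
  obtain ⟨hnI, hnC⟩ := Finset.mem_filter.1 hnG
  refine ⟨n, hnI, hnC, ?_⟩
  have hbig : |f x| / 2 < |f (gridPoint δ n)| := hn₀f.trans_le (hmax _ (hmemG _ hn₀C))
  set v := gridPoint δ n with hv
  have hnb : ∀ z, ‖z - v‖ ≤ δ → |f z - f v| < |f x| / 2 := by
    intro z hz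
    have h1 : z ∈ Metric.closedBall (0 : EuclideanSpace ℝ (Fin d)) (r + 1) := by
      have h2 := hCr hnC
      rw [mem_closedBall_zero_iff] at h2 ⊢
      calc ‖z‖ = ‖v + (z - v)‖ := by congr 1; abel
        _ ≤ ‖v‖ + ‖z - v‖ := norm_add_le _ _
        _ ≤ r + 1 := add_le_add h2 (hz.trans hd3)
    have := hf z h1 v (hsub1 _ hnC) (by rw [dist_eq_norm]; exact hz.trans_lt hd1.2)
    rwa [Real.dist_eq] at this
  have hstay : ∀ w, ‖w‖ ≤ δ → v + w ∈ cc f x := by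
    intro w hw
    have hseg : segment ℝ v (v + w) ⊆ {x | f x ≠ 0} := by
      intro z hz
      rw [segment_eq_image'] at hz
      obtain ⟨θ, hθ, rfl⟩ := hz
      have := hnb (v + θ • (v + w - v)) (by
        rw [add_sub_cancel_left, add_sub_cancel_left, norm_smul, Real.norm_of_nonneg hθ.1]
        have := hθ.2
        have := norm_nonneg w
        nlinarith)
      intro h0
      rw [h0, zero_sub, abs_neg] at this
      linarith
    have := (convex_segment v (v + w)).isPreconnected.subset_connectedComponentIn
      (left_mem_segment ℝ v (v + w)) hseg
    rw [← cc_eq hnC]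
    exact this (right_mem_segment ℝ v (v + w))
  have hup : ∀ i, v + step δ i = gridPoint δ (n + Pi.single i 1) := by
    intro i
    ext j
    simp only [hv, gridPoint, step, PiLp.add_apply, PiLp.single_apply, Pi.add_apply,
      Pi.single_apply]
    split_ifs <;> push_cast <;> ring
  have hdn : ∀ i, v + -step δ i = gridPoint δ (n - Pi.single i 1) := by
    intro i
    ext j
    simp only [hv, gridPoint, step, PiLp.add_apply, PiLp.neg_apply, PiLp.single_apply,
      Pi.sub_apply, Pi.single_apply]
    split_ifs <;> push_cast <;> ring
  have hns : ∀ i, ‖(step δ i : EuclideanSpace ℝ (Fin d))‖ ≤ δ := fun i => by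
    rw [norm_step, abs_of_pos hδ]
  have hns' : ∀ i, ‖(-step δ i : EuclideanSpace ℝ (Fin d))‖ ≤ δ := fun i => by
    rw [norm_neg]; exact hns i
  have hle : ∀ i, |f (v + step δ i)| ≤ |f v| ∧ |f (v + -step δ i)| ≤ |f v| := by
    intro i
    constructor
    · have := hstay _ (hns i)
      rw [hup] at this ⊢
      exact hmax _ (hmemG _ this)
    · have := hstay _ (hns' i)
      rw [hdn] at this ⊢
      exact hmax _ (hmemG _ this)
  unfold IsGridExtr
  simp only [shift_apply, add_zero]
  rcases le_total 0 (f v) with hpos | hneg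
  · left
    intro i
    have := hle i
    rw [abs_of_nonneg hpos] at this
    exact ⟨(le_abs_self _).trans this.1, (le_abs_self _).trans this.2⟩
  · right
    intro i
    have := hle i
    rw [abs_of_nonpos hneg] at this
    exact ⟨by linarith [neg_abs_le (f (v + step δ i))],
      by linarith [neg_abs_le (f (v + -step δ i))]⟩

/-- The mesh sizes. -/
noncomputable def mesh (k : ℕ) : ℝ := 1 / (k + 1)

theorem mesh_pos (k : ℕ) : 0 < mesh k := by unfold mesh; positivity

open Classical in
/-- The number of lattice extrema of `f` in the cube of half side `r`. -/
noncomputable def extrCount (r k : ℕ) (f : C(EuclideanSpace ℝ (Fin d), ℝ)) : ℝ≥0∞ :=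
  ∑ n ∈ gridIndex d (r * (k + 1)),
    {f | IsGridExtr (mesh k) f}.indicator 1 (shift (gridPoint (mesh k) n) f)

theorem measurable_extrCount (r k : ℕ) : Measurable (extrCount (d := d) r k) := by
  refine Finset.measurable_sum _ fun n _ => ?_
  exact (measurable_one.indicator (measurableSet_isGridExtr _)).comp (measurable_shift _)

theorem encard_comps_le_liminf (r : ℕ) (f : C(EuclideanSpace ℝ (Fin d), ℝ)) :
    ((comps f (Metric.closedBall 0 r)).encard : ℝ≥0∞) ≤
      liminf (fun k => extrCount r k f) atTop := by
  refine encard_le_of_forall_finset fun F hF => ?_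
  refine le_liminf_of_le (by isBoundedDefault) ?_
  have hev : ∀ᶠ k in atTop, ∀ C ∈ F, ∃ n ∈ gridIndex d (r * (k + 1)),
      gridPoint (mesh k) n ∈ C ∧ IsGridExtr (mesh k) (shift (gridPoint (mesh k) n) f) := by
    rw [eventually_all_finset]
    intro C hC
    obtain ⟨δ₀, hδ₀, h⟩ := exists_isGridExtr f (hF hC)
    obtain ⟨N, hN⟩ := exists_nat_one_div_lt hδ₀
    filter_upwards [eventually_ge_atTop N] with k hk
    refine h (mesh k) (mesh_pos k) ?_ _ ?_
    · refine le_trans ?_ hN.le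
      unfold mesh
      gcongr
    · refine le_of_eq ?_
      unfold mesh
      push_cast
      field_simp
  filter_upwards [hev] with k hk
  choose! n hn using hk
  classical
  have hinj : Set.InjOn n F := by
    intro C hC C' hC' heq
    by_contra hne
    have := pairwise_disjoint_comps f _ (hF hC) (hF hC') hne
    have h2 := (hn C' hC').2.1
    rw [← heq] at h2
    exact Set.disjoint_left.1 this (hn C hC).2.1 h2
  calc (F.card : ℝ≥0∞) = ∑ m ∈ F.image n, 1 := by
        simp [Finset.card_image_of_injOn hinj]
    _ = ∑ m ∈ F.image n, {f | IsGridExtr (mesh k) f}.indicator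
          (1 : C(EuclideanSpace ℝ (Fin d), ℝ) → ℝ≥0∞)
          (shift (gridPoint (mesh k) m) f) := by
        refine Finset.sum_congr rfl fun m hm => ?_
        obtain ⟨C, hC, rfl⟩ := Finset.mem_image.1 hm
        rw [indicator_of_mem]
        · rfl
        · exact (hn C hC).2.2
    _ ≤ extrCount r k f := by
        refine Finset.sum_le_sum_of_subset fun m hm => ?_
        obtain ⟨C, hC, rfl⟩ := Finset.mem_image.1 hm
        exact (hn C hC).1

variable {μ : Measure C(EuclideanSpace ℝ (Fin d), ℝ)} [IsProbabilityMeasure μ]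

theorem lintegral_extrCount (hinv : ∀ x, μ.map (shift x) = μ) (r k : ℕ) :
    ∫⁻ f, extrCount r k f ∂μ =
      ((2 * (r * (k + 1)) + 1) ^ d : ℕ) * μ {f | IsGridExtr (mesh k) f} := by
  unfold extrCount
  rw [lintegral_finsetSum]
  · simp_rw [lintegral_shift hinv (measurable_one.indicator (measurableSet_isGridExtr _)),
      lintegral_indicator_one (measurableSet_isGridExtr (d := d) _), Finset.sum_const,
      card_gridIndex, nsmul_eq_mul]
  · intro n _
    exact (measurable_one.indicator (measurableSet_isGridExtr _)).comp (measurable_shift _)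

end Grid

section Box

variable {d : ℕ}

/-- Coordinatewise division by `a`. -/
noncomputable def coordDiv (a : Fin d → ℝ) (x : EuclideanSpace ℝ (Fin d)) :
    EuclideanSpace ℝ (Fin d) :=
  WithLp.toLp 2 fun i => x i / a i

theorem continuous_coordDiv (a : Fin d → ℝ) : Continuous (coordDiv a) := by
  unfold coordDiv
  fun_prop

theorem inner_coordDiv_left (a : Fin d → ℝ) (x y : EuclideanSpace ℝ (Fin d)) :
    ⟪coordDiv a x, y⟫ = ⟪x, coordDiv a y⟫ := by
  simp only [PiLp.inner_apply, coordDiv, RCLike.inner_apply, conj_trivial]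
  exact Finset.sum_congr rfl fun i _ => by ring

theorem integral_exp_neg_mul_sq_gaussianReal_le {b : ℝ} (hb : 0 < b) :
    ∫ x, Real.exp (-b * x ^ 2) ∂(gaussianReal 0 1) ≤ 1 / √(2 * b) := by
  rw [integral_gaussianReal_eq_integral_smul one_ne_zero]
  calc ∫ x, gaussianPDFReal 0 1 x • Real.exp (-b * x ^ 2)
      ≤ ∫ x, (√(2 * Real.pi))⁻¹ * Real.exp (-b * x ^ 2) := by
        refine integral_mono_of_nonneg (Eventually.of_forall fun x => ?_)
          ((integrable_exp_neg_mul_sq hb).const_mul _) (Eventually.of_forall fun x => ?_)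
        · exact mul_nonneg (gaussianPDFReal_nonneg _ _ _) (Real.exp_nonneg _)
        · simp only [smul_eq_mul]
          gcongr
          simp only [gaussianPDFReal, NNReal.coe_one, mul_one]
          refine mul_le_of_le_one_right (by positivity) (Real.exp_le_one_iff.2 ?_)
          simp only [neg_div, Left.neg_nonpos_iff]
          positivity
    _ = 1 / √(2 * b) := by
        rw [integral_const_mul, integral_gaussian, ← Real.sqrt_inv,
          ← Real.sqrt_mul (by positivity), one_div, ← Real.sqrt_inv]
        congr 1
        field_simp

theorem integral_exp_norm_coordDiv_le {a : Fin d → ℝ} (ha : ∀ i, 0 < a i) {l : ℝ} (hl : 0 < l) :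
    ∫ ξ, Real.exp (-l * ‖coordDiv a ξ‖ ^ 2 / 2) ∂(stdGaussian (EuclideanSpace ℝ (Fin d))) ≤
      ∏ i, a i / √l := by
  have hc := continuous_coordDiv a
  rw [← map_pi_eq_stdGaussian, integral_map (by fun_prop) (by fun_prop)]
  have h : ∀ x : Fin d → ℝ, Real.exp (-l * ‖coordDiv a (WithLp.toLp 2 x)‖ ^ 2 / 2) =
      ∏ i, Real.exp (-(l / (2 * a i ^ 2)) * x i ^ 2) := by
    intro x
    rw [← Real.exp_sum, EuclideanSpace.real_norm_sq_eq, Finset.mul_sum, Finset.sum_div]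
    congr 1
    refine Finset.sum_congr rfl fun i _ => ?_
    have := (ha i).ne'
    simp only [coordDiv]
    field_simp
  simp_rw [h]
  rw [integral_fintype_prod_eq_prod
    (f := fun i (x : ℝ) => Real.exp (-(l / (2 * a i ^ 2)) * x ^ 2))]
  refine Finset.prod_le_prod (fun i _ => integral_nonneg fun x => by positivity) fun i _ => ?_
  have := ha i
  refine (integral_exp_neg_mul_sq_gaussianReal_le (by positivity)).trans (le_of_eq ?_)
  rw [show 2 * (l / (2 * a i ^ 2)) = l / a i ^ 2 by field_simp, Real.sqrt_div hl.le,
    Real.sqrt_sq this.le, one_div_div]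

/-- A law with Gaussian upper bound on its characteristic function gives mass at most
a constant times the volume to boxes. -/
theorem measure_box_le (ν : Measure (EuclideanSpace ℝ (Fin d))) [IsProbabilityMeasure ν]
    {l : ℝ} (hl : 0 < l) (hν : ∀ u, ‖charFun ν u‖ ≤ Real.exp (-l * ‖u‖ ^ 2 / 2))
    {a : Fin d → ℝ} (ha : ∀ i, 0 < a i) :
    ν.real {x | ∀ i, |x i| ≤ a i} ≤ Real.exp (d / 2) * ∏ i, a i / √l := by
  have hc := continuous_coordDiv a
  set γ := stdGaussian (EuclideanSpace ℝ (Fin d)) with hγ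
  have hswap : ∫ x, charFun γ (coordDiv a x) ∂ν = ∫ ξ, charFun ν (coordDiv a ξ) ∂γ := by
    simp_rw [charFun_apply]
    rw [integral_integral_swap]
    · refine integral_congr_ae (Eventually.of_forall fun ξ => ?_)
      refine integral_congr_ae (Eventually.of_forall fun x => ?_)
      simp only
      rw [← inner_coordDiv_left, real_inner_comm]
    · refine Integrable.of_bound (C := 1) (Continuous.aestronglyMeasurable ?_)
        (Eventually.of_forall fun p => ?_)
      · unfold Function.uncurry
        fun_prop
      · simp only [Function.uncurry]
        rw [Complex.norm_exp_ofReal_mul_I]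
  have hreal : ∫ x, charFun γ (coordDiv a x) ∂ν =
      ((∫ x, Real.exp (-‖coordDiv a x‖ ^ 2 / 2) ∂ν : ℝ) : ℂ) := by
    rw [← integral_complex_ofReal]
    refine integral_congr_ae (Eventually.of_forall fun x => ?_)
    simp only [hγ]
    rw [charFun_stdGaussian]
    push_cast
    rfl
  have hexp : ∫ x, Real.exp (-‖coordDiv a x‖ ^ 2 / 2) ∂ν ≤ ∏ i, a i / √l := by
    refine le_trans ?_ (integral_exp_norm_coordDiv_le ha hl)
    have h0 : 0 ≤ ∫ x, Real.exp (-‖coordDiv a x‖ ^ 2 / 2) ∂ν :=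
      integral_nonneg fun x => by positivity
    rw [← Complex.norm_of_nonneg h0, ← hreal, hswap]
    refine (norm_integral_le_integral_norm _).trans ?_
    refine integral_mono_of_nonneg (Eventually.of_forall fun ξ => by positivity) ?_
      (Eventually.of_forall fun ξ => hν _)
    refine Integrable.of_bound (C := 1) (by fun_prop) (Eventually.of_forall fun ξ => ?_)
    rw [Real.norm_of_nonneg (by positivity), Real.exp_le_one_iff]
    have : 0 ≤ l * ‖coordDiv a ξ‖ ^ 2 := by positivity
    linarith
  have hmeas : MeasurableSet {x : EuclideanSpace ℝ (Fin d) | ∀ i, |x i| ≤ a i} := by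
    have : {x : EuclideanSpace ℝ (Fin d) | ∀ i, |x i| ≤ a i} = ⋂ i, {x | |x i| ≤ a i} := by
      ext; simp
    rw [this]
    exact MeasurableSet.iInter fun i => measurableSet_le (by fun_prop) (by fun_prop)
  calc ν.real {x | ∀ i, |x i| ≤ a i}
      = ∫ x, ({x | ∀ i, |x i| ≤ a i} : Set _).indicator (fun _ => (1 : ℝ)) x ∂ν := by
        rw [integral_indicator hmeas]; simp
    _ ≤ ∫ x, Real.exp (d / 2) * Real.exp (-‖coordDiv a x‖ ^ 2 / 2) ∂ν := by
        refine integral_mono_of_nonneg (Eventually.of_forall fun x => ?_) ?_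
          (Eventually.of_forall fun x => ?_)
        · exact indicator_nonneg (fun _ _ => zero_le_one) _
        · refine Integrable.const_mul ?_ _
          refine Integrable.of_bound (C := 1) (by fun_prop) (Eventually.of_forall fun ξ => ?_)
          rw [Real.norm_of_nonneg (by positivity), Real.exp_le_one_iff]
          have : 0 ≤ ‖coordDiv a ξ‖ ^ 2 := by positivity
          linarith
        · by_cases hx : x ∈ {x : EuclideanSpace ℝ (Fin d) | ∀ i, |x i| ≤ a i}
          swap
          · rw [indicator_of_notMem hx]
            positivity
          rw [indicator_of_mem hx]
          simp only
          rw [← Real.exp_add, Real.one_le_exp_iff, EuclideanSpace.real_norm_sq_eq]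
          have : ∑ i, (coordDiv a x) i ^ 2 ≤ ∑ i : Fin d, 1 := by
            refine Finset.sum_le_sum fun i _ => ?_
            have h1 : |x i| / a i ≤ 1 := (div_le_one (ha i)).2 (hx i)
            have h2 : (coordDiv a x) i ^ 2 = (|x i| / a i) ^ 2 := by
              simp [coordDiv, div_pow]
            rw [h2]
            exact pow_le_one₀ (div_nonneg (abs_nonneg _) (ha i).le) h1
          simp only [Finset.sum_const, Finset.card_univ, Fintype.card_fin, nsmul_eq_mul,
            mul_one] at this
          linarith
    _ ≤ Real.exp (d / 2) * ∏ i, a i / √l := by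
        rw [integral_const_mul]
        gcongr

end Box

section Nondegenerate

variable {E : Type*} [NormedAddCommGroup E] [InnerProductSpace ℝ E] [FiniteDimensional ℝ E]
  [MeasurableSpace E] [BorelSpace E] {ρ : Measure E} [IsFiniteMeasure ρ]

theorem integrable_norm_sq_of_four (h4 : Integrable (fun t : E => ‖t‖ ^ 4) ρ) :
    Integrable (fun t : E => ‖t‖ ^ 2) ρ := by
  refine ((integrable_const (1 : ℝ)).add h4).mono' (by fun_prop)
    (Eventually.of_forall fun t => ?_)
  rw [Real.norm_of_nonneg (by positivity)]
  simp only [Pi.add_apply]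
  nlinarith [sq_nonneg (‖t‖ ^ 2 - 1), sq_nonneg ‖t‖]

theorem integrable_inner_sq (h4 : Integrable (fun t : E => ‖t‖ ^ 4) ρ) (u : E) :
    Integrable (fun t : E => ⟪u, t⟫ ^ 2) ρ := by
  refine ((integrable_norm_sq_of_four h4).const_mul (‖u‖ ^ 2)).mono'
    (Continuous.aestronglyMeasurable (by fun_prop)) (Eventually.of_forall fun t => ?_)
  rw [Real.norm_of_nonneg (by positivity), ← mul_pow, ← sq_abs]
  gcongr
  exact abs_real_inner_le_norm u t

theorem exists_quadratic_lower_bound (h4 : Integrable (fun t : E => ‖t‖ ^ 4) ρ)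
    (hρ : ∀ u : E, u ≠ 0 → ρ {t | ⟪u, t⟫ ≠ 0} ≠ 0) :
    ∃ q : ℝ, 0 < q ∧ ∀ u : E, q * ‖u‖ ^ 2 ≤ ∫ t, ⟪u, t⟫ ^ 2 ∂ρ := by
  rcases (Metric.sphere (0 : E) 1).eq_empty_or_nonempty with he | hne
  · refine ⟨1, one_pos, fun u => ?_⟩
    have hu : u = 0 := by
      by_contra hu
      have : ‖u‖⁻¹ • u ∈ Metric.sphere (0 : E) 1 := by
        rw [mem_sphere_zero_iff_norm, norm_smul, norm_inv, norm_norm,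
          inv_mul_cancel₀ (norm_ne_zero_iff.2 hu)]
      rw [he] at this
      exact this
    simp [hu]
  have hcont : ContinuousOn (fun u : E => ∫ t, ⟪u, t⟫ ^ 2 ∂ρ) (Metric.sphere 0 1) := by
    refine continuousOn_of_dominated (bound := fun t => ‖t‖ ^ 2)
      (fun u _ => Continuous.aestronglyMeasurable (by fun_prop)) (fun u hu => ?_)
      (integrable_norm_sq_of_four h4) (Eventually.of_forall fun t => by fun_prop)
    refine Eventually.of_forall fun t => ?_
    rw [Real.norm_of_nonneg (by positivity), ← sq_abs]
    have := abs_real_inner_le_norm u t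
    rw [mem_sphere_zero_iff_norm.1 hu, one_mul] at this
    gcongr
  obtain ⟨u₀, hu₀, hmin⟩ := (isCompact_sphere (0 : E) 1).exists_isMinOn hne hcont
  have hu₀' : ‖u₀‖ = 1 := mem_sphere_zero_iff_norm.1 hu₀
  refine ⟨∫ t, ⟪u₀, t⟫ ^ 2 ∂ρ, ?_, fun u => ?_⟩
  · refine lt_of_le_of_ne (integral_nonneg fun t => by positivity) fun h0 => ?_
    refine hρ u₀ (norm_ne_zero_iff.1 (by rw [hu₀']; exact one_ne_zero)) ?_
    have := (integral_eq_zero_iff_of_nonneg (fun t => by positivity)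
      (integrable_inner_sq h4 u₀)).1 h0.symm
    rw [Filter.EventuallyEq, ae_iff] at this
    simpa using this
  · by_cases hu : u = 0
    · simp [hu]
    have hn : ‖u‖ ≠ 0 := norm_ne_zero_iff.2 hu
    have hmem : ‖u‖⁻¹ • u ∈ Metric.sphere (0 : E) 1 := by
      rw [mem_sphere_zero_iff_norm, norm_smul, norm_inv, norm_norm, inv_mul_cancel₀ hn]
    have h1 := hmin hmem
    simp only [mem_ofPred_eq, real_inner_smul_left, mul_pow] at h1
    rw [integral_const_mul] at h1
    calc (∫ t, ⟪u₀, t⟫ ^ 2 ∂ρ) * ‖u‖ ^ 2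
        ≤ ((‖u‖⁻¹) ^ 2 * ∫ t, ⟪u, t⟫ ^ 2 ∂ρ) * ‖u‖ ^ 2 := by gcongr
      _ = ∫ t, ⟪u, t⟫ ^ 2 ∂ρ := by field_simp

end Nondegenerate

section Differences

theorem abs_sin_sub_le (x : ℝ) : |Real.sin x - x| ≤ 2 * x ^ 2 := by
  rcases le_total |x| 1 with h | h
  · have h1 := Real.sin_bound h
    have h2 : |x ^ 3 / 6| = |x| ^ 3 / 6 := by rw [abs_div, abs_pow]; norm_num
    have h3 : |Real.sin x - x| ≤ |x| ^ 5 / 100 + |x| ^ 3 / 6 := by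
      rw [← h2]
      have : Real.sin x - x = (Real.sin x - (x - x ^ 3 / 6)) + -(x ^ 3 / 6) := by ring
      rw [this]
      refine (abs_add_le _ _).trans ?_
      rw [abs_neg]
      gcongr
    have h4 : |x| ^ 5 ≤ |x| ^ 2 := pow_le_pow_of_le_one (abs_nonneg _) h (by norm_num)
    have h5 : |x| ^ 3 ≤ |x| ^ 2 := pow_le_pow_of_le_one (abs_nonneg _) h (by norm_num)
    rw [← sq_abs]
    nlinarith [sq_nonneg |x|]
  · have h1 := Real.abs_sin_le_one x
    rw [← sq_abs]
    calc |Real.sin x - x| ≤ |Real.sin x| + |x| := abs_sub _ _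
      _ ≤ 2 * |x| ^ 2 := by nlinarith

theorem abs_two_cos_sub_two_le (x : ℝ) : |2 * Real.cos x - 2| ≤ x ^ 2 := by
  have := Real.one_sub_sq_div_two_le_cos (x := x)
  have := Real.cos_le_one x
  rw [abs_le]
  constructor <;> linarith [sq_nonneg x]

variable {d : ℕ}

/-- Central differences of `f` at the origin. -/
noncomputable def gradVec (δ : ℝ) (f : C(EuclideanSpace ℝ (Fin d), ℝ)) :
    EuclideanSpace ℝ (Fin d) :=
  WithLp.toLp 2 fun i => (f (step δ i) - f (-step δ i)) / (2 * δ)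

/-- Second differences of `f` at the origin. -/
noncomputable def hessVec (δ : ℝ) (f : C(EuclideanSpace ℝ (Fin d), ℝ)) :
    EuclideanSpace ℝ (Fin d) :=
  WithLp.toLp 2 fun i => (f (step δ i) + f (-step δ i) - 2 * f 0) / δ ^ 2

theorem measurable_gradVec (δ : ℝ) : Measurable (gradVec (d := d) δ) := by
  unfold gradVec
  refine (WithLp.measurable_toLp 2 _).comp (measurable_pi_lambda _ fun i => ?_)
  exact ((measurable_eval _).sub (measurable_eval _)).div_const _

theorem measurable_hessVec (δ : ℝ) : Measurable (hessVec (d := d) δ) := by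
  unfold hessVec
  refine (WithLp.measurable_toLp 2 _).comp (measurable_pi_lambda _ fun i => ?_)
  exact (((measurable_eval _).add (measurable_eval _)).sub
    ((measurable_eval _).const_mul _)).div_const _

/-- The functional `f ↦ ⟪gradVec δ f, u⟫`. -/
noncomputable def gradCoeff (δ : ℝ) (u : EuclideanSpace ℝ (Fin d)) :
    EuclideanSpace ℝ (Fin d) →₀ ℝ :=
  ∑ i, (u i / (2 * δ)) • (Finsupp.single (step δ i) 1 + Finsupp.single (-step δ i) (-1))

/-- The functional `f ↦ ⟪hessVec δ f, w⟫`. -/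
noncomputable def hessCoeff (δ : ℝ) (w : EuclideanSpace ℝ (Fin d)) :
    EuclideanSpace ℝ (Fin d) →₀ ℝ :=
  ∑ i, (w i / δ ^ 2) • (Finsupp.single (step δ i) 1 + Finsupp.single (-step δ i) 1 +
    Finsupp.single 0 (-2))

theorem ev_gradCoeff (δ : ℝ) (u : EuclideanSpace ℝ (Fin d))
    (f : C(EuclideanSpace ℝ (Fin d), ℝ)) : ev (gradCoeff δ u) f = ⟪gradVec δ f, u⟫ := by
  simp only [gradCoeff, ev_sum, ev_smul, ev_add, ev_single, gradVec, PiLp.inner_apply,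
    RCLike.inner_apply, conj_trivial]
  exact Finset.sum_congr rfl fun i _ => by ring

theorem ev_hessCoeff (δ : ℝ) (w : EuclideanSpace ℝ (Fin d))
    (f : C(EuclideanSpace ℝ (Fin d), ℝ)) : ev (hessCoeff δ w) f = ⟪hessVec δ f, w⟫ := by
  simp only [hessCoeff, ev_sum, ev_smul, ev_add, ev_single, hessVec, PiLp.inner_apply,
    RCLike.inner_apply, conj_trivial]
  exact Finset.sum_congr rfl fun i _ => by ring

theorem inner_step (δ : ℝ) (i : Fin d) (t : EuclideanSpace ℝ (Fin d)) :
    ⟪step δ i, t⟫ = δ * t i := by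
  simp [step, EuclideanSpace.inner_single_left]

/-- The modulus of the Fourier transform of `gradCoeff δ u`, with sign. -/
noncomputable def gradSymbol (δ : ℝ) (u t : EuclideanSpace ℝ (Fin d)) : ℝ :=
  ∑ i, u i * (Real.sin (2 * Real.pi * (δ * t i)) / δ)

/-- The Fourier transform of `hessCoeff δ w`. -/
noncomputable def hessSymbol (δ : ℝ) (w t : EuclideanSpace ℝ (Fin d)) : ℝ :=
  ∑ i, w i * ((2 * Real.cos (2 * Real.pi * (δ * t i)) - 2) / δ ^ 2)

theorem ft_gradCoeff (δ : ℝ) (u t : EuclideanSpace ℝ (Fin d)) :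
    ft (gradCoeff δ u) t = -Complex.I * gradSymbol δ u t := by
  simp only [gradCoeff, ft_sum, ft_smul, ft_add, ft_single, gradSymbol, inner_neg_left, inner_step]
  push_cast
  rw [Finset.mul_sum]
  refine Finset.sum_congr rfl fun i _ => ?_
  have h1 : (-2 * (Real.pi : ℂ) * (δ * (t i : ℂ))) * Complex.I =
      ((-(2 * Real.pi * (δ * t i)) : ℝ) : ℂ) * Complex.I := by push_cast; ring
  have h2 : (-2 * (Real.pi : ℂ) * -(δ * (t i : ℂ))) * Complex.I =
      (((2 * Real.pi * (δ * t i)) : ℝ) : ℂ) * Complex.I := by push_cast; ring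
  rw [h1, h2, Complex.exp_mul_I, Complex.exp_mul_I]
  push_cast
  rw [Complex.cos_neg, Complex.sin_neg]
  ring

theorem ft_hessCoeff (δ : ℝ) (w t : EuclideanSpace ℝ (Fin d)) :
    ft (hessCoeff δ w) t = hessSymbol δ w t := by
  simp only [hessCoeff, ft_sum, ft_smul, ft_add, ft_single, hessSymbol, inner_neg_left, inner_step,
    inner_zero_left]
  push_cast
  refine Finset.sum_congr rfl fun i _ => ?_
  have h1 : (-2 * (Real.pi : ℂ) * (δ * (t i : ℂ))) * Complex.I =
      ((-(2 * Real.pi * (δ * t i)) : ℝ) : ℂ) * Complex.I := by push_cast; ring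
  have h2 : (-2 * (Real.pi : ℂ) * -(δ * (t i : ℂ))) * Complex.I =
      (((2 * Real.pi * (δ * t i)) : ℝ) : ℂ) * Complex.I := by push_cast; ring
  rw [h1, h2, Complex.exp_mul_I, Complex.exp_mul_I]
  push_cast
  rw [Complex.cos_neg, Complex.sin_neg]
  simp only [mul_zero, zero_mul, Complex.exp_zero]
  ring

variable (ρ : Measure (EuclideanSpace ℝ (Fin d))) [IsFiniteMeasure ρ]

theorem var_gradCoeff (δ : ℝ) (u : EuclideanSpace ℝ (Fin d)) :
    var ρ (gradCoeff δ u) = ∫ t, gradSymbol δ u t ^ 2 ∂ρ := by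
  simp [var, ft_gradCoeff]

theorem var_hessCoeff (δ : ℝ) (u : EuclideanSpace ℝ (Fin d)) :
    var ρ (hessCoeff δ u) = ∫ t, hessSymbol δ u t ^ 2 ∂ρ := by
  simp [var, ft_hessCoeff]

theorem var_gradCoeff_add_hessCoeff (δ : ℝ) (u w : EuclideanSpace ℝ (Fin d)) :
    var ρ (gradCoeff δ u + hessCoeff δ w) = var ρ (gradCoeff δ u) + var ρ (hessCoeff δ w) := by
  unfold var
  rw [← integral_add (integrable_norm_ft_sq ρ _) (integrable_norm_ft_sq ρ _)]
  refine integral_congr_ae (Eventually.of_forall fun t => ?_)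
  simp only
  rw [ft_add, ft_gradCoeff, ft_hessCoeff, ← Complex.normSq_eq_norm_sq, ← Complex.normSq_eq_norm_sq,
    ← Complex.normSq_eq_norm_sq]
  simp [Complex.normSq_apply]
  ring

variable {ρ}

theorem abs_gradSymbol_sub_le {δ : ℝ} (hδ : 0 < δ) (u t : EuclideanSpace ℝ (Fin d)) :
    |gradSymbol δ u t - 2 * Real.pi * ⟪u, t⟫| ≤ 8 * Real.pi ^ 2 * δ * ‖u‖ * ‖t‖ ^ 2 := by
  have h : gradSymbol δ u t - 2 * Real.pi * ⟪u, t⟫ =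
      ∑ i, u i * ((Real.sin (2 * Real.pi * (δ * t i)) - 2 * Real.pi * (δ * t i)) / δ) := by
    simp only [gradSymbol, PiLp.inner_apply, RCLike.inner_apply, conj_trivial, Finset.mul_sum,
      ← Finset.sum_sub_distrib]
    refine Finset.sum_congr rfl fun i _ => ?_
    field_simp
  rw [h, EuclideanSpace.real_norm_sq_eq, Finset.mul_sum]
  refine (Finset.abs_sum_le_sum_abs _ _).trans (Finset.sum_le_sum fun i _ => ?_)
  have h1 := abs_sin_sub_le (2 * Real.pi * (δ * t i))
  have h2 : |u i| ≤ ‖u‖ := by simpa using PiLp.norm_apply_le u i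
  rw [abs_mul, abs_div, abs_of_pos hδ]
  calc |u i| * (|Real.sin (2 * Real.pi * (δ * t i)) - 2 * Real.pi * (δ * t i)| / δ)
      ≤ ‖u‖ * ((2 * (2 * Real.pi * (δ * t i)) ^ 2) / δ) := by gcongr
    _ = 8 * Real.pi ^ 2 * δ * ‖u‖ * t i ^ 2 := by field_simp; ring

/-- Uniform nondegeneracy of the central differences. -/
theorem exists_var_gradCoeff_lower_bound (h4 : Integrable (fun t => ‖t‖ ^ 4) ρ)
    (hρ : ∀ u : EuclideanSpace ℝ (Fin d), u ≠ 0 → ρ {t | ⟪u, t⟫ ≠ 0} ≠ 0) :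
    ∃ l : ℝ, 0 < l ∧ ∀ᶠ δ in 𝓝[>] (0 : ℝ), ∀ u : EuclideanSpace ℝ (Fin d),
      l * ‖u‖ ^ 2 ≤ var ρ (gradCoeff δ u) := by
  obtain ⟨q, hq, hQ⟩ := exists_quadratic_lower_bound h4 hρ
  set M := ∫ t, ‖t‖ ^ 4 ∂ρ with hM
  have hpi := Real.pi_pos
  refine ⟨Real.pi ^ 2 * q, by positivity, ?_⟩
  have hlim : Tendsto (fun δ : ℝ => 64 * Real.pi ^ 4 * δ ^ 2 * M) (𝓝[>] 0) (𝓝 0) := by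
    have : Continuous fun δ : ℝ => 64 * Real.pi ^ 4 * δ ^ 2 * M := by fun_prop
    simpa using (this.tendsto 0).mono_left nhdsWithin_le_nhds
  filter_upwards [hlim.eventually (eventually_lt_nhds (show 0 < Real.pi ^ 2 * q by positivity)),
    self_mem_nhdsWithin] with δ hδ hδ0 u
  have hδ0 : 0 < δ := hδ0
  rw [var_gradCoeff]
  have h_intble : Integrable (fun t => gradSymbol δ u t ^ 2) ρ := by
    have := integrable_norm_ft_sq ρ (gradCoeff δ u)
    simpa [ft_gradCoeff] using this
  have h1 : ∫ t, (2 * Real.pi ^ 2 * ⟪u, t⟫ ^ 2 -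
      64 * Real.pi ^ 4 * δ ^ 2 * ‖u‖ ^ 2 * ‖t‖ ^ 4) ∂ρ ≤ ∫ t, gradSymbol δ u t ^ 2 ∂ρ := by
    refine integral_mono (((integrable_inner_sq h4 u).const_mul _).sub (h4.const_mul _)) h_intble
      fun t => ?_
    have he := abs_gradSymbol_sub_le hδ0 u t
    have he2 : (gradSymbol δ u t - 2 * Real.pi * ⟪u, t⟫) ^ 2 ≤
        (8 * Real.pi ^ 2 * δ * ‖u‖ * ‖t‖ ^ 2) ^ 2 := by
      rw [← sq_abs]
      gcongr
    simp only
    nlinarith [sq_nonneg (2 * gradSymbol δ u t - 2 * Real.pi * ⟪u, t⟫)]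
  rw [integral_sub ((integrable_inner_sq h4 u).const_mul _) (h4.const_mul _), integral_const_mul,
    integral_const_mul, ← hM] at h1
  have h2 := hQ u
  have h3 : 64 * Real.pi ^ 4 * δ ^ 2 * M * ‖u‖ ^ 2 ≤ Real.pi ^ 2 * q * ‖u‖ ^ 2 := by
    gcongr
  have h4' : Real.pi ^ 2 * (q * ‖u‖ ^ 2) ≤ Real.pi ^ 2 * ∫ t, ⟪u, t⟫ ^ 2 ∂ρ := by gcongr
  linarith

theorem var_hessCoeff_single_le (h4 : Integrable (fun t => ‖t‖ ^ 4) ρ) {δ : ℝ} (hδ : 0 < δ)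
    (i : Fin d) :
    var ρ (hessCoeff δ (EuclideanSpace.single i 1)) ≤ 16 * Real.pi ^ 4 * ∫ t, ‖t‖ ^ 4 ∂ρ := by
  rw [var_hessCoeff, ← integral_const_mul]
  refine integral_mono_of_nonneg (Eventually.of_forall fun t => by positivity)
    (h4.const_mul _) (Eventually.of_forall fun t => ?_)
  have h1 : hessSymbol δ (EuclideanSpace.single i 1) t =
      (2 * Real.cos (2 * Real.pi * (δ * t i)) - 2) / δ ^ 2 := by
    simp [hessSymbol]
  have h2 : |t i| ≤ ‖t‖ := by simpa using PiLp.norm_apply_le t i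
  simp only
  rw [h1, ← sq_abs, abs_div, abs_of_pos (show 0 < δ ^ 2 by positivity)]
  calc (|2 * Real.cos (2 * Real.pi * (δ * t i)) - 2| / δ ^ 2) ^ 2
      ≤ ((2 * Real.pi * (δ * t i)) ^ 2 / δ ^ 2) ^ 2 := by
        gcongr
        exact abs_two_cos_sub_two_le _
    _ = 16 * Real.pi ^ 4 * |t i| ^ 4 := by
        rw [show |t i| ^ 4 = t i ^ 4 by rw [← abs_pow]; exact abs_of_nonneg (by positivity)]
        field_simp
        ring
    _ ≤ 16 * Real.pi ^ 4 * ‖t‖ ^ 4 := by gcongr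

end Differences

section Law

variable {E : Type*} [NormedAddCommGroup E] [InnerProductSpace ℝ E] [FiniteDimensional ℝ E]
  [MeasurableSpace E] [BorelSpace E] {ρ : Measure E} [IsFiniteMeasure ρ]
  {μ : Measure C(E, ℝ)} [IsProbabilityMeasure μ]

theorem HasSpectralMeasure.map_ev (h : HasSpectralMeasure μ ρ) (c : E →₀ ℝ) :
    μ.map (ev c) = gaussianReal 0 (var ρ c).toNNReal := by
  have : IsProbabilityMeasure (μ.map (ev c)) :=
    Measure.isProbabilityMeasure_map (measurable_ev c).aemeasurable
  refine Measure.ext_of_charFun (funext fun s => ?_)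
  rw [charFun_apply, integral_map (measurable_ev c).aemeasurable (by fun_prop),
    charFun_gaussianReal]
  have h1 := h (s • c)
  simp_rw [ev_smul] at h1
  have h2 : var ρ (s • c) = s ^ 2 * var ρ c := by
    simp_rw [var, ft_smul, norm_mul, mul_pow, integral_const_mul]
    simp
  simp only [RCLike.inner_apply, conj_trivial]
  rw [h1, h2, Real.coe_toNNReal _ (var_nonneg ρ c)]
  push_cast
  congr 1
  ring

theorem lintegral_exp_mul_ev_le (h : HasSpectralMeasure μ ρ) (c : E →₀ ℝ) {V : ℝ}
    (hV : var ρ c ≤ V) (s : ℝ) :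
    ∫⁻ f, ENNReal.ofReal (Real.exp (s * ev c f)) ∂μ ≤
      ENNReal.ofReal (Real.exp (V * s ^ 2 / 2)) := by
  have h1 := mgf_gaussianReal (h.map_ev c) s
  have h2 : Integrable (fun f => Real.exp (s * ev c f)) μ := by
    have := integrable_exp_mul_gaussianReal (μ := 0) (v := (var ρ c).toNNReal) s
    rw [← h.map_ev c] at this
    exact this.comp_measurable (measurable_ev c)
  rw [← ofReal_integral_eq_lintegral_ofReal h2 (Eventually.of_forall fun f => by positivity)]
  refine ENNReal.ofReal_le_ofReal ?_
  rw [mgf] at h1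
  rw [h1, Real.coe_toNNReal _ (var_nonneg ρ c), zero_mul, zero_add]
  gcongr

end Law

section GridProb

variable {d : ℕ} {ρ : Measure (EuclideanSpace ℝ (Fin d))} [IsFiniteMeasure ρ]
  {μ : Measure C(EuclideanSpace ℝ (Fin d), ℝ)} [IsProbabilityMeasure μ]

theorem indepFun_gradVec_hessVec (h : HasSpectralMeasure μ ρ) (δ : ℝ) :
    IndepFun (gradVec δ) (hessVec δ) μ := by
  have mg := measurable_gradVec (d := d) δ
  have mh := measurable_hessVec (d := d) δ
  rw [indepFun_iff_charFun_prod mg.aemeasurable mh.aemeasurable]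
  intro t
  rw [charFun_apply, charFun_apply, charFun_apply,
    integral_map (by fun_prop) (by fun_prop), integral_map (by fun_prop) (by fun_prop),
    integral_map (by fun_prop) (by fun_prop)]
  simp_rw [WithLp.prod_inner_apply, ← ev_gradCoeff, ← ev_hessCoeff, ← ev_add]
  rw [h, h, h, var_gradCoeff_add_hessCoeff, ← Complex.ofReal_mul, ← Real.exp_add]
  congr 2
  ring

theorem abs_gradVec_le_of_isGridExtr {δ : ℝ} (hδ : 0 < δ) {f : C(EuclideanSpace ℝ (Fin d), ℝ)}
    (h : IsGridExtr δ f) (i : Fin d) : |gradVec δ f i| ≤ δ / 2 * (|hessVec δ f i| + 1) := by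
  have key : |f (step δ i) - f (-step δ i)| ≤ |f (step δ i) + f (-step δ i) - 2 * f 0| := by
    rcases h with h | h
    · obtain ⟨h1, h2⟩ := h i
      rw [abs_of_nonpos (a := f (step δ i) + f (-step δ i) - 2 * f 0) (by linarith), abs_le]
      constructor <;> linarith
    · obtain ⟨h1, h2⟩ := h i
      rw [abs_of_nonneg (a := f (step δ i) + f (-step δ i) - 2 * f 0) (by linarith), abs_le]
      constructor <;> linarith
  simp only [gradVec, hessVec]
  rw [abs_div, abs_div, abs_of_pos (show 0 < 2 * δ by positivity),
    abs_of_pos (show 0 < δ ^ 2 by positivity)]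
  calc |f (step δ i) - f (-step δ i)| / (2 * δ)
      ≤ |f (step δ i) + f (-step δ i) - 2 * f 0| / (2 * δ) := by gcongr
    _ = δ / 2 * (|f (step δ i) + f (-step δ i) - 2 * f 0| / δ ^ 2) := by field_simp
    _ ≤ _ := by gcongr; linarith

theorem prod_abs_add_one_le (hd : 0 < d) (y : Fin d → ℝ) :
    ∏ i, (|y i| + 1) ≤ ∑ i, (Real.exp (d * y i) + Real.exp (-d * y i)) := by
  have : Nonempty (Fin d) := ⟨⟨0, hd⟩⟩
  obtain ⟨j, -, hj⟩ := Finset.exists_max_image Finset.univ (fun i => |y i|) Finset.univ_nonempty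
  calc ∏ i, (|y i| + 1) ≤ ∏ i, Real.exp |y i| :=
        Finset.prod_le_prod (fun i _ => by positivity) fun i _ => Real.add_one_le_exp _
    _ = Real.exp (∑ i, |y i|) := (Real.exp_sum _ _).symm
    _ ≤ Real.exp (d * |y j|) := by
        gcongr
        simpa using Finset.sum_le_sum hj
    _ ≤ Real.exp (d * y j) + Real.exp (-d * y j) := by
        rcases abs_choice (y j) with h | h <;> rw [h]
        · exact le_add_of_nonneg_right (Real.exp_nonneg _)
        · rw [mul_neg, ← neg_mul]
          exact le_add_of_nonneg_left (Real.exp_nonneg _)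
    _ ≤ _ := Finset.single_le_sum (f := fun i => Real.exp (d * y i) + Real.exp (-d * y i))
        (fun i _ => by positivity) (Finset.mem_univ j)

theorem exists_lintegral_prod_hessVec_le (hd : 0 < d) (h : HasSpectralMeasure μ ρ)
    (h4 : Integrable (fun t => ‖t‖ ^ 4) ρ) :
    ∃ C : ℝ≥0∞, C ≠ ∞ ∧ ∀ δ : ℝ, 0 < δ →
      ∫⁻ f, ENNReal.ofReal (∏ i, (|hessVec δ f i| + 1)) ∂μ ≤ C := by
  set V := 16 * Real.pi ^ 4 * ∫ t, ‖t‖ ^ 4 ∂ρ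
  refine ⟨∑ i : Fin d, (ENNReal.ofReal (Real.exp (V * d ^ 2 / 2)) +
    ENNReal.ofReal (Real.exp (V * (-d) ^ 2 / 2))), ENNReal.sum_ne_top.2 fun _ _ => by finiteness, fun δ hδ => ?_⟩
  have hev : ∀ (i : Fin d) f, hessVec δ f i = ev (hessCoeff δ (EuclideanSpace.single i 1)) f := by
    intro i f
    rw [ev_hessCoeff]
    simp [EuclideanSpace.inner_single_right]
  calc ∫⁻ f, ENNReal.ofReal (∏ i, (|hessVec δ f i| + 1)) ∂μ
      ≤ ∫⁻ f, ∑ i, (ENNReal.ofReal (Real.exp (d * hessVec δ f i)) +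
          ENNReal.ofReal (Real.exp (-d * hessVec δ f i))) ∂μ := by
        refine lintegral_mono fun f => ?_
        refine (ENNReal.ofReal_le_ofReal (prod_abs_add_one_le hd _)).trans ?_
        rw [ENNReal.ofReal_sum_of_nonneg fun i _ => by positivity]
        refine Finset.sum_le_sum fun i _ => ?_
        exact ENNReal.ofReal_add_le
    _ = ∑ i, ((∫⁻ f, ENNReal.ofReal (Real.exp (d * hessVec δ f i)) ∂μ) +
          ∫⁻ f, ENNReal.ofReal (Real.exp (-d * hessVec δ f i)) ∂μ) := by
        have hm : ∀ (i : Fin d) (s : ℝ),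
            Measurable fun f => ENNReal.ofReal (Real.exp (s * hessVec δ f i)) := by
          intro i s
          simp_rw [hev]
          have := measurable_ev (hessCoeff δ (EuclideanSpace.single i 1))
          fun_prop
        rw [lintegral_finsetSum]
        · refine Finset.sum_congr rfl fun i _ => ?_
          rw [lintegral_add_left (hm i _)]
        · exact fun i _ => (hm i _).add (hm i _)
    _ ≤ _ := by
        refine Finset.sum_le_sum fun i _ => ?_
        simp_rw [hev]
        exact add_le_add (lintegral_exp_mul_ev_le h _ (var_hessCoeff_single_le h4 hδ i) _)
          (lintegral_exp_mul_ev_le h _ (var_hessCoeff_single_le h4 hδ i) _)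

/-- The origin is a lattice extremum with probability at most the cell volume. -/
theorem exists_measure_isGridExtr_le (hd : 0 < d) (h : HasSpectralMeasure μ ρ)
    (h4 : Integrable (fun t => ‖t‖ ^ 4) ρ)
    (hρ : ∀ u : EuclideanSpace ℝ (Fin d), u ≠ 0 → ρ {t | ⟪u, t⟫ ≠ 0} ≠ 0) :
    ∃ C : ℝ≥0∞, C ≠ ∞ ∧ ∀ᶠ δ in 𝓝[>] (0 : ℝ),
      μ {f | IsGridExtr δ f} ≤ C * ENNReal.ofReal δ ^ d := by
  obtain ⟨l, hl, hvar⟩ := exists_var_gradCoeff_lower_bound h4 hρ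
  obtain ⟨C, hC, hhess⟩ := exists_lintegral_prod_hessVec_le hd h h4
  refine ⟨ENNReal.ofReal (Real.exp (d / 2) * (1 / (2 * √l)) ^ d) * C, by finiteness, ?_⟩
  filter_upwards [hvar, self_mem_nhdsWithin] with δ hδ hδ0
  have hδ0 : 0 < δ := hδ0
  have mg := measurable_gradVec (d := d) δ
  have mh := measurable_hessVec (d := d) δ
  have : IsProbabilityMeasure (μ.map (gradVec (d := d) δ)) :=
    Measure.isProbabilityMeasure_map mg.aemeasurable
  have : IsProbabilityMeasure (μ.map (hessVec (d := d) δ)) :=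
    Measure.isProbabilityMeasure_map mh.aemeasurable
  have hchar : ∀ u, ‖charFun (μ.map (gradVec (d := d) δ)) u‖ ≤
      Real.exp (-l * ‖u‖ ^ 2 / 2) := by
    intro u
    rw [charFun_apply, integral_map (by fun_prop) (by fun_prop)]
    simp_rw [← ev_gradCoeff]
    rw [h, Complex.norm_of_nonneg (Real.exp_nonneg _)]
    gcongr
    linarith [hδ u]
  let A : Set (EuclideanSpace ℝ (Fin d) × EuclideanSpace ℝ (Fin d)) :=
    {p | ∀ i, |p.1 i| ≤ δ / 2 * (|p.2 i| + 1)}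
  have hA : MeasurableSet A := by
    have : A = ⋂ i, {p | |p.1 i| ≤ δ / 2 * (|p.2 i| + 1)} := by ext; simp [A]
    rw [this]
    exact MeasurableSet.iInter fun i => measurableSet_le (by fun_prop) (by fun_prop)
  calc μ {f | IsGridExtr δ f}
      ≤ μ ((fun f => (gradVec δ f, hessVec δ f)) ⁻¹' A) :=
        measure_mono fun f hf i => abs_gradVec_le_of_isGridExtr hδ0 hf i
    _ = ((μ.map (gradVec δ)).prod (μ.map (hessVec δ))) A := by
        rw [← (indepFun_iff_map_prod_eq_prod_map_map mg.aemeasurable mh.aemeasurable).1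
          (indepFun_gradVec_hessVec h δ), Measure.map_apply (by fun_prop) hA]
    _ = ∫⁻ y, μ.map (gradVec δ) {x | ∀ i, |x i| ≤ δ / 2 * (|y i| + 1)} ∂(μ.map (hessVec δ)) :=
        Measure.prod_apply_symm hA
    _ ≤ ∫⁻ y, ENNReal.ofReal (Real.exp (d / 2) * (1 / (2 * √l)) ^ d) * ENNReal.ofReal δ ^ d *
          ENNReal.ofReal (∏ i, (|y i| + 1)) ∂(μ.map (hessVec δ)) := by
        refine lintegral_mono fun y => ?_
        have hb := measure_box_le (μ.map (gradVec δ)) hl hchar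
          (a := fun i => δ / 2 * (|y i| + 1)) (fun i => by positivity)
        rw [← ofReal_measureReal, ← ENNReal.ofReal_pow hδ0.le,
          ← ENNReal.ofReal_mul (by positivity), ← ENNReal.ofReal_mul (by positivity)]
        refine ENNReal.ofReal_le_ofReal (hb.trans (le_of_eq ?_))
        have : ∀ i, δ / 2 * (|y i| + 1) / √l = (1 / (2 * √l) * δ) * (|y i| + 1) := by
          intro i
          field_simp
        simp_rw [this]
        rw [Finset.prod_mul_distrib]
        simp only [Finset.prod_const, Finset.card_univ, Fintype.card_fin]
        ring
    _ = ENNReal.ofReal (Real.exp (d / 2) * (1 / (2 * √l)) ^ d) * ENNReal.ofReal δ ^ d *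
          ∫⁻ f, ENNReal.ofReal (∏ i, (|hessVec δ f i| + 1)) ∂μ := by
        rw [lintegral_const_mul' _ _ (by finiteness), lintegral_map (by fun_prop) mh]
    _ ≤ ENNReal.ofReal (Real.exp (d / 2) * (1 / (2 * √l)) ^ d) * ENNReal.ofReal δ ^ d * C := by
        gcongr
        exact hhess δ hδ0
    _ = _ := by ring

end GridProb

section Expectation

variable {d : ℕ} {ρ : Measure (EuclideanSpace ℝ (Fin d))} [IsFiniteMeasure ρ]
  {μ : Measure C(EuclideanSpace ℝ (Fin d), ℝ)} [IsProbabilityMeasure μ]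

theorem exists_lintegral_liminf_extrCount_le (hd : 0 < d) (h : HasSpectralMeasure μ ρ)
    (h4 : Integrable (fun t => ‖t‖ ^ 4) ρ)
    (hρ : ∀ u : EuclideanSpace ℝ (Fin d), u ≠ 0 → ρ {t | ⟪u, t⟫ ≠ 0} ≠ 0) :
    ∃ C : ℝ≥0∞, C ≠ ∞ ∧ ∀ r : ℕ,
      ∫⁻ f, liminf (fun k => extrCount r k f) atTop ∂μ ≤ C * (2 * r + 1) ^ d := by
  obtain ⟨C, hC, hCδ⟩ := exists_measure_isGridExtr_le hd h h4 hρ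
  refine ⟨C, hC, fun r => (lintegral_liminf_le fun k => measurable_extrCount r k).trans ?_⟩
  have hmesh : Tendsto mesh atTop (𝓝[>] 0) :=
    tendsto_nhdsWithin_iff.2 ⟨tendsto_one_div_add_atTop_nhds_zero_nat,
      Eventually.of_forall mesh_pos⟩
  rw [← liminf_const (f := (atTop : Filter ℕ)) (C * (2 * (r : ℝ≥0∞) + 1) ^ d)]
  refine liminf_le_liminf ?_
  filter_upwards [hmesh.eventually hCδ] with k hk
  rw [lintegral_extrCount h.map_shift]
  have h1 : ENNReal.ofReal (mesh k) = ((k + 1 : ℕ) : ℝ≥0∞)⁻¹ := by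
    rw [mesh, one_div, ENNReal.ofReal_inv_of_pos (by positivity)]
    congr 1
    exact_mod_cast ENNReal.ofReal_natCast (k + 1)
  rw [h1] at hk
  have hne : ((k + 1 : ℕ) : ℝ≥0∞) ≠ 0 := by exact_mod_cast Nat.succ_ne_zero k
  have h2 : (((2 * (r * (k + 1)) + 1) ^ d : ℕ) : ℝ≥0∞) ≤
      (2 * (r : ℝ≥0∞) + 1) ^ d * ((k + 1 : ℕ) : ℝ≥0∞) ^ d := by
    rw [← mul_pow]
    have : (2 * (r * (k + 1)) + 1) ^ d ≤ ((2 * r + 1) * (k + 1)) ^ d := by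
      refine Nat.pow_le_pow_left ?_ d
      ring_nf
      omega
    exact_mod_cast this
  calc (((2 * (r * (k + 1)) + 1) ^ d : ℕ) : ℝ≥0∞) * μ {f | IsGridExtr (mesh k) f}
      ≤ ((2 * (r : ℝ≥0∞) + 1) ^ d * ((k + 1 : ℕ) : ℝ≥0∞) ^ d) *
          (C * ((k + 1 : ℕ) : ℝ≥0∞)⁻¹ ^ d) := by gcongr
    _ = C * (2 * (r : ℝ≥0∞) + 1) ^ d *
          (((k + 1 : ℕ) : ℝ≥0∞) * ((k + 1 : ℕ) : ℝ≥0∞)⁻¹) ^ d := by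
        rw [mul_pow]; ring
    _ = C * (2 * (r : ℝ≥0∞) + 1) ^ d := by
        rw [ENNReal.mul_inv_cancel hne (ENNReal.natCast_ne_top _), one_pow, mul_one]

/-- The expected number of nodal domains per unit volume is finite. -/
theorem lintegral_totalDensity_ne_top (hd : 0 < d) (h : HasSpectralMeasure μ ρ)
    (h4 : Integrable (fun t => ‖t‖ ^ 4) ρ)
    (hρ : ∀ u : EuclideanSpace ℝ (Fin d), u ≠ 0 → ρ {t | ⟪u, t⟫ ≠ 0} ≠ 0) :
    ∫⁻ f, totalDensity f ∂μ ≠ ∞ := by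
  obtain ⟨C, hC, hCr⟩ := exists_lintegral_liminf_extrCount_le hd h h4 hρ
  set v := volume (Metric.closedBall (0 : EuclideanSpace ℝ (Fin d)) 1) with hv
  have hv0 : v ≠ 0 := (Metric.measure_closedBall_pos _ _ one_pos).ne'
  have hvt : v ≠ ∞ := measure_closedBall_lt_top.ne
  have hbound : ∀ n : ℕ, 1 ≤ n → ∫⁻ f, density n f ∂μ ≤ C * 5 ^ d / v := by
    intro n hn
    have hn0 : (n : ℝ≥0∞) ≠ 0 := by exact_mod_cast (show n ≠ 0 by omega)
    have h1 := lintegral_lintegral_shift h.map_shift (measurable_density (n : ℝ))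
      (Metric.closedBall (0 : EuclideanSpace ℝ (Fin d)) n)
    have h2 : ∫⁻ f, (∫⁻ x in Metric.closedBall (0 : EuclideanSpace ℝ (Fin d)) n,
        density n (shift x f)) ∂μ ≤ C * (5 * (n : ℝ≥0∞)) ^ d := by
      calc _ ≤ ∫⁻ f, liminf (fun k => extrCount (2 * n) k f) atTop ∂μ := by
            refine lintegral_mono fun f => le_trans ?_ (encard_comps_le_liminf (2 * n) f)
            refine lintegral_density_le (fun x hx => ?_) measurableSet_closedBall
            refine Metric.closedBall_subset_closedBall' ?_
            have := Metric.mem_closedBall.1 hx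
            push_cast
            linarith
        _ ≤ C * (2 * ((2 * n : ℕ) : ℝ≥0∞) + 1) ^ d := hCr (2 * n)
        _ ≤ C * (5 * (n : ℝ≥0∞)) ^ d := by
            gcongr
            exact_mod_cast (show 2 * (2 * n) + 1 ≤ 5 * n by omega)
    have hvol := volume_closedBall_mul (0 : EuclideanSpace ℝ (Fin d))
      (Nat.cast_nonneg (α := ℝ) n) zero_le_one
    rw [mul_one, finrank_euclideanSpace_fin, ENNReal.ofReal_natCast, ← hv] at hvol
    rw [h1, hvol, mul_pow] at h2
    rw [ENNReal.le_div_iff_mul_le (Or.inl hv0) (Or.inl hvt)]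
    refine (ENNReal.mul_le_mul_iff_right (a := (n : ℝ≥0∞) ^ d) (pow_ne_zero _ hn0)
      (by finiteness)).1 ?_
    calc _ = (n : ℝ≥0∞) ^ d * v * ∫⁻ f, density n f ∂μ := by ring
      _ ≤ _ := h2
      _ = _ := by ring
  have hsup : ∫⁻ f, totalDensity f ∂μ = ⨆ n : ℕ, ∫⁻ f, density n f ∂μ :=
    lintegral_iSup (fun n => measurable_density n)
      fun m n hmn f => density_mono (by exact_mod_cast hmn) f
  rw [hsup]
  refine ((iSup_le fun n => ?_).trans_lt
    (ENNReal.div_lt_top (x := C * 5 ^ d) (by finiteness) hv0)).ne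
  refine le_trans (lintegral_mono fun f => ?_) (hbound (n + 1) (by omega))
  exact density_mono (by push_cast; linarith) f

end Expectation

section Sandwich

variable {E : Type*} [NormedAddCommGroup E] [InnerProductSpace ℝ E] [FiniteDimensional ℝ E]
  [MeasureSpace E] [BorelSpace E] [(volume : Measure E).IsAddHaarMeasure]

theorem measurable_lintegral_shift {G : C(E, ℝ) → ℝ≥0∞} (hG : Measurable G) (W : Set E) :
    Measurable fun f : C(E, ℝ) => ∫⁻ x in W, G (shift x f) :=
  (measurable_comp_shift hG).lintegral_prod_right' (ν := volume.restrict W)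

/-- The average over `R • S` of a nonnegative observable along the translates of `f`. -/
noncomputable def lavg (S : Set E) (G : C(E, ℝ) → ℝ≥0∞) (R : ℝ) (f : C(E, ℝ)) : ℝ :=
  (∫⁻ x in R • S, G (shift x f)).toReal / (R ^ Module.finrank ℝ E * (volume S).toReal)

theorem measurable_lavg (S : Set E) {G : C(E, ℝ) → ℝ≥0∞} (hG : Measurable G) (R : ℝ) :
    Measurable (lavg S G R) :=
  (measurable_lintegral_shift hG _).ennreal_toReal.div_const _

theorem avg_toReal {S : Set E} {G : C(E, ℝ) → ℝ≥0∞} (hG : Measurable G) {R : ℝ} {f : C(E, ℝ)}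
    (hf : ∫⁻ x in R • S, G (shift x f) ≠ ∞) :
    avg S (fun f => (G f).toReal) R f = lavg S G R f := by
  have hm : Measurable fun x : E => G (shift x f) :=
    (measurable_comp_shift hG).comp (measurable_const.prodMk measurable_id)
  rw [avg, lavg, integral_toReal hm.aemeasurable (ae_lt_top hm hf)]

/-- The normalized number of nodal domains of `f` in `R • S`. -/
noncomputable def nodalRatio (S : Set E) (R : ℝ) (f : C(E, ℝ)) : ℝ :=
  (Nat.card (comps f (R • S)) : ℝ) / (R ^ Module.finrank ℝ E * (volume S).toReal)

theorem closedBall_subset_smul {S : Set E} (hSc : Convex ℝ S) {r L m R : ℝ}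
    (hr : Metric.closedBall 0 r ⊆ S) (hm : 0 < m) (hL : L ≤ m * r) (hR : m ≤ R) {x : E}
    (hx : x ∈ (R - m) • S) : Metric.closedBall x L ⊆ R • S := by
  obtain ⟨s, hs, rfl⟩ := hx
  have hR0 : 0 < R := hm.trans_le hR
  intro y hy
  have hz : m⁻¹ • (y - (R - m) • s) ∈ S := by
    refine hr ?_
    rw [mem_closedBall_zero_iff, norm_smul, Real.norm_of_nonneg (by positivity),
      inv_mul_le_iff₀ hm]
    exact (mem_closedBall_iff_norm.1 hy).trans hL
  refine ⟨((R - m) / R) • s + (m / R) • (m⁻¹ • (y - (R - m) • s)), ?_, ?_⟩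
  · refine hSc hs hz (div_nonneg (by linarith) hR0.le) (by positivity) ?_
    field_simp
    ring
  · simp only
    rw [smul_add, smul_smul, smul_smul, smul_smul, mul_div_cancel₀ _ hR0.ne',
      show R * (m / R) * m⁻¹ = 1 by field_simp, one_smul]
    abel

theorem nodalRatio_le_lavg {S : Set E} (hS : Bornology.IsBounded S) {R : ℝ} (hR : 0 ≤ R)
    {f : C(E, ℝ)} (hf : ∫⁻ x in R • S, totalDensity (shift x f) ≠ ∞) :
    nodalRatio S R f ≤ lavg S totalDensity R f := by
  unfold nodalRatio lavg
  gcongr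
  have h := encard_comps_le (f := f) (hS.smul₀ R)
  have h1 : ((Nat.card (comps f (R • S)) : ℕ) : ℝ≥0∞) ≤ ((comps f (R • S)).encard : ℝ≥0∞) := by
    by_cases hs : (comps f (R • S)).Finite
    · rw [Nat.card_coe_set_eq, ← hs.cast_ncard_eq]
      simp
    · rw [Set.Infinite.encard_eq hs]
      exact le_top
  have h2 := ENNReal.toReal_mono hf (h1.trans h)
  simpa using h2

theorem lavg_le_nodalRatio {S : Set E} (hS : Bornology.IsBounded S) (hSo : IsOpen S)
    (hSc : Convex ℝ S) {r L m R : ℝ}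
    (hr : Metric.closedBall 0 r ⊆ S) (hm : 0 < m) (hL : L ≤ m * r) (hR : m < R)
    {f : C(E, ℝ)} (hf : ∫⁻ x in R • S, totalDensity (shift x f) ≠ ∞) :
    ((R - m) / R) ^ Module.finrank ℝ E * lavg S (density L) (R - m) f ≤ nodalRatio S R f := by
  have hR0 : 0 < R := hm.trans hR
  have hRm : 0 < R - m := by linarith
  have h := lintegral_density_le (f := f) (L := L)
    (fun x hx => closedBall_subset_smul hSc hr hm hL hR.le hx)
    (hSo.smul₀ hRm.ne').measurableSet
  have hs : (comps f (R • S)).Finite := by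
    by_contra hs
    have h1 := encard_comps_le (f := f) (hS.smul₀ R)
    rw [Set.Infinite.encard_eq hs] at h1
    exact hf (top_le_iff.1 h1)
  have h1 : ((comps f (R • S)).encard : ℝ≥0∞) = ((Nat.card (comps f (R • S)) : ℕ) : ℝ≥0∞) := by
    rw [Nat.card_coe_set_eq, ← hs.cast_ncard_eq]
    simp
  rw [h1] at h
  have h2 := ENNReal.toReal_mono (ENNReal.natCast_ne_top _) h
  rw [ENNReal.toReal_natCast] at h2
  unfold nodalRatio lavg
  calc _ = (∫⁻ x in (R - m) • S, density L (shift x f)).toReal /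
        (R ^ Module.finrank ℝ E * (volume S).toReal) := by
        rw [div_pow]
        field_simp
    _ ≤ _ := by gcongr

end Sandwich

section Limit

variable {E : Type*} [NormedAddCommGroup E] [InnerProductSpace ℝ E] [FiniteDimensional ℝ E]
  [MeasureSpace E] [BorelSpace E] [(volume : Measure E).IsAddHaarMeasure]
  {ρ : Measure E} [IsFiniteMeasure ρ] {μ : Measure C(E, ℝ)} [IsProbabilityMeasure μ]

/-- The limiting constant of the law of large numbers. -/
noncomputable def nodalConst (μ : Measure C(E, ℝ)) : ℝ := (∫⁻ f, totalDensity f ∂μ).toReal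

theorem ae_lintegral_shift_ne_top (hinv : ∀ x : E, μ.map (shift x) = μ) {G : C(E, ℝ) → ℝ≥0∞}
    (hG : Measurable G) (hfin : ∫⁻ f, G f ∂μ ≠ ∞) :
    ∀ᵐ f ∂μ, ∀ A : Set E, Bornology.IsBounded A → ∫⁻ x in A, G (shift x f) ≠ ∞ := by
  have : ∀ᵐ f ∂μ, ∀ n : ℕ, ∫⁻ x in Metric.closedBall (0 : E) n, G (shift x f) < ∞ := by
    rw [ae_all_iff]
    intro n
    refine ae_lt_top (measurable_lintegral_shift hG _) ?_
    rw [lintegral_lintegral_shift hinv hG]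
    exact ENNReal.mul_ne_top measure_closedBall_lt_top.ne hfin
  filter_upwards [this] with f hf A hA
  obtain ⟨r, hr⟩ := hA.subset_closedBall 0
  obtain ⟨n, hn⟩ := exists_nat_ge r
  refine ((lintegral_mono_set (hr.trans (Metric.closedBall_subset_closedBall hn))).trans_lt
    (hf n)).ne

theorem ae_tendsto_lavg (h : HasSpectralMeasure μ ρ) (hρ : ∀ t, ρ {t} = 0) {S : Set E}
    (hS : Bornology.IsBounded S) (hSo : IsOpen S) (hSc : Convex ℝ S) (h0 : (0 : E) ∈ S)
    {G : C(E, ℝ) → ℝ≥0∞} (hG : Measurable G) (hfin : ∫⁻ f, G f ∂μ ≠ ∞) :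
    ∀ᵐ f ∂μ, Tendsto (fun R : ℝ => lavg S G R f) atTop (𝓝 (∫⁻ f, G f ∂μ).toReal) := by
  obtain ⟨s, hs, hSs⟩ := hS.subset_closedBall_lt 0 0
  have hgood := good_of_integrable h hρ hs hSs hSo hSc h0 hG.ennreal_toReal
    (integrable_toReal_of_lintegral_ne_top hG.aemeasurable hfin)
  filter_upwards [hgood.tendsto_real h.map_shift hSs hSo hSc h0 fun f => ENNReal.toReal_nonneg,
    ae_lintegral_shift_ne_top h.map_shift hG hfin] with f h1 h2
  rw [integral_toReal hG.aemeasurable (ae_lt_top hG hfin)] at h1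
  exact h1.congr fun R => avg_toReal hG (h2 _ (hS.smul₀ R))

theorem tendsto_lintegral_density (hfin : ∫⁻ f, totalDensity f ∂μ ≠ ∞) :
    Tendsto (fun n : ℕ => (∫⁻ f, density n f ∂μ).toReal) atTop (𝓝 (nodalConst μ)) := by
  have hmono : Monotone fun (n : ℕ) (f : C(E, ℝ)) => density (n : ℝ) f :=
    fun m n hmn f => density_mono (by exact_mod_cast hmn) f
  have hsup : ∫⁻ f, totalDensity f ∂μ = ⨆ n : ℕ, ∫⁻ f, density n f ∂μ :=
    lintegral_iSup (fun n => measurable_density (n : ℝ)) hmono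
  refine (ENNReal.tendsto_toReal hfin).comp ?_
  rw [hsup]
  exact tendsto_atTop_iSup fun m n hmn => lintegral_mono (hmono hmn)

theorem lintegral_density_ne_top (hfin : ∫⁻ f, totalDensity f ∂μ ≠ ∞) (L : ℝ) :
    ∫⁻ f, density L f ∂μ ≠ ∞ :=
  ((lintegral_mono fun f => density_le_totalDensity L f).trans_lt hfin.lt_top).ne

theorem tendsto_scaled_lavg {S : Set E} {G : C(E, ℝ) → ℝ≥0∞} {f : C(E, ℝ)} {c : ℝ} (m : ℝ)
    (h : Tendsto (fun R : ℝ => lavg S G R f) atTop (𝓝 c)) :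
    Tendsto (fun R : ℝ => ((R - m) / R) ^ Module.finrank ℝ E * lavg S G (R - m) f) atTop
      (𝓝 c) := by
  have h1 : Tendsto (fun R : ℝ => (R - m) / R) atTop (𝓝 1) := by
    have : Tendsto (fun R : ℝ => 1 - m / R) atTop (𝓝 (1 - 0)) :=
      tendsto_const_nhds.sub (tendsto_const_nhds.div_atTop tendsto_id)
    rw [sub_zero] at this
    refine this.congr' ?_
    filter_upwards [eventually_ne_atTop 0] with R hR
    field_simp
  have h2 := (h1.pow (Module.finrank ℝ E)).mul
    (h.comp (tendsto_atTop_add_const_right _ (-m) tendsto_id))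
  simpa [sub_eq_add_neg] using h2

theorem ae_tendsto_nodalRatio (h : HasSpectralMeasure μ ρ) (hρ : ∀ t, ρ {t} = 0) {S : Set E}
    (hS : Bornology.IsBounded S) (hSo : IsOpen S) (hSc : Convex ℝ S) (h0 : (0 : E) ∈ S)
    (hfin : ∫⁻ f, totalDensity f ∂μ ≠ ∞) :
    ∀ᵐ f ∂μ, Tendsto (fun R : ℝ => nodalRatio S R f) atTop (𝓝 (nodalConst μ)) := by
  obtain ⟨r, hr0, hr⟩ := Metric.nhds_basis_closedBall.mem_iff.1 (hSo.mem_nhds h0)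
  have hdens : ∀ᵐ f ∂μ, ∀ n : ℕ, Tendsto (fun R : ℝ => lavg S (density n) R f) atTop
      (𝓝 (∫⁻ f, density n f ∂μ).toReal) := by
    rw [ae_all_iff]
    exact fun n => ae_tendsto_lavg h hρ hS hSo hSc h0 (measurable_density _)
      (lintegral_density_ne_top hfin _)
  filter_upwards [hdens, ae_tendsto_lavg h hρ hS hSo hSc h0 measurable_totalDensity hfin,
    ae_lintegral_shift_ne_top h.map_shift measurable_totalDensity hfin] with f h1 h2 h3
  refine tendsto_order.2 ⟨fun a ha => ?_, fun b hb => ?_⟩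
  · obtain ⟨n, hn⟩ := ((tendsto_lintegral_density hfin).eventually_const_lt ha).exists
    set m := (n + 1 : ℝ) / r
    have hm : 0 < m := by positivity
    have hmr : (n : ℝ) ≤ m * r := by
      simp only [m]
      rw [div_mul_cancel₀ _ hr0.ne']
      linarith
    filter_upwards [(tendsto_scaled_lavg m (h1 n)).eventually_const_lt hn,
      eventually_gt_atTop m] with R hR1 hR2
    exact hR1.trans_le (lavg_le_nodalRatio hS hSo hSc hr hm hmr hR2 (h3 _ (hS.smul₀ R)))
  · filter_upwards [h2.eventually_lt_const hb, eventually_ge_atTop 0] with R hR1 hR2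
    exact (nodalRatio_le_lavg hS hR2 (h3 _ (hS.smul₀ R))).trans_lt hR1

theorem lavg_nonneg (S : Set E) (G : C(E, ℝ) → ℝ≥0∞) {R : ℝ} (hR : 0 ≤ R) (f : C(E, ℝ)) :
    0 ≤ lavg S G R f := by
  unfold lavg
  positivity

theorem integrable_lavg (hinv : ∀ x : E, μ.map (shift x) = μ) {S : Set E}
    (hS : Bornology.IsBounded S) {G : C(E, ℝ) → ℝ≥0∞} (hG : Measurable G)
    (hfin : ∫⁻ f, G f ∂μ ≠ ∞) (R : ℝ) : Integrable (lavg S G R) μ := by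
  refine (integrable_toReal_of_lintegral_ne_top
    (measurable_lintegral_shift hG _).aemeasurable ?_).div_const _
  rw [lintegral_lintegral_shift hinv hG]
  exact ENNReal.mul_ne_top (hS.smul₀ R).measure_lt_top.ne hfin

theorem integral_lavg (hinv : ∀ x : E, μ.map (shift x) = μ) {S : Set E}
    (hS : Bornology.IsBounded S) (hSo : IsOpen S) (h0 : (0 : E) ∈ S)
    {G : C(E, ℝ) → ℝ≥0∞} (hG : Measurable G)
    (hfin : ∫⁻ f, G f ∂μ ≠ ∞) {R : ℝ} (hR : 0 < R) :
    ∫ f, lavg S G R f ∂μ = (∫⁻ f, G f ∂μ).toReal := by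
  have hSpos : (volume S).toReal ≠ 0 :=
    (ENNReal.toReal_pos (hSo.measure_pos _ ⟨0, h0⟩).ne' hS.measure_lt_top.ne).ne'
  have hne : ∫⁻ f, (∫⁻ x in R • S, G (shift x f)) ∂μ ≠ ∞ := by
    rw [lintegral_lintegral_shift hinv hG]
    exact ENNReal.mul_ne_top (hS.smul₀ R).measure_lt_top.ne hfin
  have hm := measurable_lintegral_shift hG (R • S)
  unfold lavg
  rw [integral_div, integral_toReal hm.aemeasurable (ae_lt_top hm hne),
    lintegral_lintegral_shift hinv hG, volume_smul_set _ hR.le, ENNReal.toReal_mul,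
    ENNReal.toReal_mul, ENNReal.toReal_ofReal (by positivity)]
  field_simp

/-- Domination of the deviation of the nodal count by integrable functions of small integral. -/
theorem eventually_exists_nodalRatio_bound (h : HasSpectralMeasure μ ρ) (hρ : ∀ t, ρ {t} = 0)
    {S : Set E} (hS : Bornology.IsBounded S) (hSo : IsOpen S) (hSc : Convex ℝ S)
    (h0 : (0 : E) ∈ S) (hfin : ∫⁻ f, totalDensity f ∂μ ≠ ∞) {ε : ℝ} (hε : 0 < ε) :
    ∀ᶠ R : ℝ in atTop, ∃ G : C(E, ℝ) → ℝ, Integrable G μ ∧ ∫ f, G f ∂μ < ε ∧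
      ∀ᵐ f ∂μ, |nodalRatio S R f - nodalConst μ| ≤ G f := by
  obtain ⟨r, hr0, hr⟩ := Metric.nhds_basis_closedBall.mem_iff.1 (hSo.mem_nhds h0)
  set c := nodalConst μ with hc
  have hc0 : 0 ≤ c := ENNReal.toReal_nonneg
  have hlt : c - ε / 2 < c := by linarith
  obtain ⟨n, hn⟩ := ((tendsto_lintegral_density hfin).eventually_const_lt hlt).exists
  set a := (∫⁻ f, density n f ∂μ).toReal with ha
  have hac : a ≤ c := ENNReal.toReal_mono hfin
    (lintegral_mono fun f => density_le_totalDensity _ f)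
  set m := (n + 1 : ℝ) / r
  have hm : 0 < m := by positivity
  have hmr : (n : ℝ) ≤ m * r := by
    simp only [m]
    rw [div_mul_cancel₀ _ hr0.ne']
    linarith
  set Z : ℝ → C(E, ℝ) → ℝ := fun R f =>
    ((R - m) / R) ^ Module.finrank ℝ E * lavg S (density n) (R - m) f with hZ
  have hZm : ∀ R, Measurable (Z R) := fun R => (measurable_lavg S (measurable_density _) _).const_mul _
  have hbd : ∀ R, m < R → ∀ f, ‖max (c - Z R f) 0‖ ≤ c := by
    intro R hR f
    have hRm : 0 < R - m := by linarith
    have hR0 : 0 < R := by linarith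
    have : 0 ≤ Z R f := mul_nonneg (by positivity) (lavg_nonneg _ _ hRm.le _)
    rw [Real.norm_of_nonneg (le_max_right _ _)]
    exact max_le (by linarith) hc0
  have hlim : Tendsto (fun R => ∫ f, max (c - Z R f) 0 ∂μ) atTop (𝓝 (∫ _f, (c - a) ∂μ)) := by
    refine tendsto_integral_filter_of_dominated_convergence (fun _ => c) ?_ ?_
      (integrable_const c) ?_
    · exact Eventually.of_forall fun R =>
        ((measurable_const.sub (hZm R)).max measurable_const).aestronglyMeasurable
    · filter_upwards [eventually_gt_atTop m] with R hR
      exact Eventually.of_forall (hbd R hR)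
    · filter_upwards [ae_tendsto_lavg h hρ hS hSo hSc h0 (measurable_density _)
        (lintegral_density_ne_top hfin n)] with f hf
      have h1 := ((tendsto_scaled_lavg m hf).const_sub c).max
        (tendsto_const_nhds (x := (0 : ℝ)))
      rwa [max_eq_left (show (0 : ℝ) ≤ c - (∫⁻ f, density n f ∂μ).toReal by linarith)] at h1
  rw [integral_const, probReal_univ, one_smul] at hlim
  filter_upwards [hlim.eventually_lt_const (show c - a < ε / 2 by linarith),
    eventually_gt_atTop m] with R hR hRm
  have hR0 : 0 < R := by linarith
  have hiY := integrable_lavg h.map_shift hS measurable_totalDensity hfin R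
  have hiZ : Integrable (fun f => max (c - Z R f) 0) μ :=
    Integrable.of_bound ((measurable_const.sub (hZm R)).max measurable_const).aestronglyMeasurable
      c (Eventually.of_forall (hbd R hRm))
  have hiY' : Integrable (fun f => lavg S totalDensity R f - c) μ := hiY.sub (integrable_const c)
  have hiZ' : Integrable (fun f => 2 * max (c - Z R f) 0) μ := hiZ.const_mul 2
  refine ⟨fun f => (lavg S totalDensity R f - c) + 2 * max (c - Z R f) 0, hiY'.add hiZ', ?_, ?_⟩
  · rw [integral_add hiY' hiZ', integral_sub hiY (integrable_const c), integral_const_mul,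
      integral_lavg h.map_shift hS hSo h0 measurable_totalDensity hfin hR0, integral_const,
      probReal_univ, one_smul]
    change c - c + _ < ε
    linarith
  · filter_upwards [ae_lintegral_shift_ne_top h.map_shift measurable_totalDensity hfin] with f hf
    have h1 := nodalRatio_le_lavg hS hR0.le (hf _ (hS.smul₀ R))
    have h2 := lavg_le_nodalRatio hS hSo hSc hr hm hmr hRm (hf _ (hS.smul₀ R))
    have h3 : Z R f ≤ nodalRatio S R f := h2
    have h4 := le_max_left (c - Z R f) 0
    have h5 := le_max_right (c - Z R f) 0
    rw [abs_le]
    constructor <;> linarith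

end Limit

section Transfer

variable {d : ℕ} {Ω : Type*} [MeasurableSpace Ω] {P : Measure Ω} [IsProbabilityMeasure P]
  {f : EuclideanSpace ℝ (Fin d) → Ω → ℝ} {K : EuclideanSpace ℝ (Fin d) → ℝ}
  {ρ : Measure (EuclideanSpace ℝ (Fin d))} [IsFiniteMeasure ρ]

theorem sum_covariance_eq_var
    (hspec : ∀ x, (K x : ℂ) = ∫ t, Complex.exp (-2 * Real.pi * Complex.I * ⟪x, t⟫) ∂ρ)
    (c : EuclideanSpace ℝ (Fin d) →₀ ℝ) :
    ∑ x ∈ c.support, ∑ y ∈ c.support, c x * c y * K (x - y) = var ρ c := by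
  have h_intble : ∀ x : EuclideanSpace ℝ (Fin d), Integrable (fun t =>
      Complex.exp (-2 * Real.pi * Complex.I * ⟪x, t⟫)) ρ := fun x => by
    refine Integrable.of_bound (C := 1) (Continuous.aestronglyMeasurable (by fun_prop))
      (Eventually.of_forall fun t => ?_)
    rw [show (-2 * Real.pi * Complex.I * ⟪x, t⟫ : ℂ) =
      ((-2 * Real.pi * ⟪x, t⟫ : ℝ) : ℂ) * Complex.I by push_cast; ring,
      Complex.norm_exp_ofReal_mul_I]
  have hpt : ∀ t, ((‖ft c t‖ ^ 2 : ℝ) : ℂ) = ∑ x ∈ c.support, ∑ y ∈ c.support,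
      (c x * c y : ℂ) * Complex.exp (-2 * Real.pi * Complex.I * ⟪x - y, t⟫) := fun t => by
    push_cast
    rw [← Complex.mul_conj', ft, Finsupp.sum, map_sum, Finset.sum_mul_sum]
    refine Finset.sum_congr rfl fun x _ => Finset.sum_congr rfl fun y _ => ?_
    rw [map_mul, Complex.conj_ofReal, ← Complex.exp_conj, map_mul, Complex.conj_ofReal,
      Complex.conj_I, mul_mul_mul_comm, ← Complex.exp_add, inner_sub_left]
    congr 2
    push_cast
    ring
  have hC : ((∑ x ∈ c.support, ∑ y ∈ c.support, c x * c y * K (x - y) : ℝ) : ℂ) = var ρ c := by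
    rw [var, ← integral_complex_ofReal]
    simp_rw [hpt]
    rw [integral_finsetSum _ fun x _ => integrable_finsetSum _ fun y _ => (h_intble _).const_mul _]
    push_cast
    refine Finset.sum_congr rfl fun x _ => ?_
    rw [integral_finsetSum _ fun y _ => (h_intble _).const_mul _]
    refine Finset.sum_congr rfl fun y _ => ?_
    rw [integral_const_mul, hspec]
  exact_mod_cast hC

theorem map_linearCombination (hfield : IsStationaryGaussianField f K P)
    (c : EuclideanSpace ℝ (Fin d) →₀ ℝ) :
    P.map (fun ω => c.sum fun x a => a * f x ω) =
      gaussianReal 0 (∑ x ∈ c.support, ∑ y ∈ c.support, c x * c y * K (x - y)).toNNReal := by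
  have e := c.support.equivFin.symm
  have hsum : ∀ g : EuclideanSpace ℝ (Fin d) → ℝ,
      ∑ i, g (e i) = ∑ x ∈ c.support, g x := fun g => by
    rw [← Finset.sum_coe_sort c.support g]
    exact e.sum_comp fun x => g x
  have h := hfield.2 _ (fun i => c (e i)) fun i => e i
  have h1 : ∀ ω, ∑ i, c (e i) * f (e i) ω = c.sum fun x a => a * f x ω :=
    fun ω => hsum fun x => c x * f x ω
  have h2 : ∑ i, ∑ j, c (e i) * c (e j) * K ((e i : EuclideanSpace ℝ (Fin d)) - e j) =
      ∑ x ∈ c.support, ∑ y ∈ c.support, c x * c y * K (x - y) := by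
    rw [← hsum]
    exact Finset.sum_congr rfl fun i _ => hsum fun y => c (e i) * c y * K (e i - y)
  simpa only [h1, h2] using h

theorem hasSpectralMeasure_map (hfield : IsStationaryGaussianField f K P)
    (hspec : ∀ x, (K x : ℂ) = ∫ t, Complex.exp (-2 * Real.pi * Complex.I * ⟪x, t⟫) ∂ρ)
    {F : Ω → C(EuclideanSpace ℝ (Fin d), ℝ)} (hF : Measurable F)
    (hFf : ∀ᵐ ω ∂P, ∀ x, F ω x = f x ω) : HasSpectralMeasure (P.map F) ρ := by
  intro c
  have hm : Measurable fun ω => c.sum fun x a => a * f x ω :=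
    Finset.measurable_sum _ fun x _ => (hfield.1 x).const_mul _
  rw [integral_map hF.aemeasurable
    (Continuous.aestronglyMeasurable (by have := continuous_ev c; fun_prop))]
  have h1 : ∫ ω, Complex.exp (ev c (F ω) * Complex.I) ∂P =
      charFun (P.map fun ω => c.sum fun x a => a * f x ω) 1 := by
    rw [charFun_apply, integral_map hm.aemeasurable
      (Continuous.aestronglyMeasurable (by fun_prop))]
    refine integral_congr_ae ?_
    filter_upwards [hFf] with ω hω
    simp [ev, hω]
  rw [h1, map_linearCombination hfield, sum_covariance_eq_var hspec, charFun_gaussianReal,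
    Real.coe_toNNReal _ (var_nonneg ρ c)]
  push_cast
  congr 1
  ring

theorem exists_continuousMap_version (hf : ∀ x, Measurable (f x))
    (hcont : ∀ᵐ ω ∂P, Continuous fun x => f x ω) :
    ∃ F : Ω → C(EuclideanSpace ℝ (Fin d), ℝ), Measurable F ∧ ∀ᵐ ω ∂P, ∀ x, F ω x = f x ω := by
  classical
  obtain ⟨B, hB, hBm, hB0⟩ := exists_measurable_superset_of_null (ae_iff.1 hcont)
  have hc : ∀ ω, ω ∉ B → Continuous fun x => f x ω := fun ω hω => by
    by_contra h
    exact hω (hB h)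
  refine ⟨fun ω => if h : ω ∉ B then ⟨fun x => f x ω, hc ω h⟩ else 0,
    measurable_of_eval fun x => ?_, ?_⟩
  · have : (fun ω => (if h : ω ∉ B then (⟨fun x => f x ω, hc ω h⟩ :
        C(EuclideanSpace ℝ (Fin d), ℝ)) else 0) x) = fun ω => if ω ∈ B then 0 else f x ω := by
      ext ω
      by_cases h : ω ∈ B <;> simp [h]
    rw [this]
    exact Measurable.ite hBm measurable_const (hf x)
  · filter_upwards [compl_mem_ae_iff.2 hB0] with ω hω x
    have h : ω ∉ B := hω
    simp only [dif_pos h]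
    rfl

theorem nodalRatio_eq {F : C(EuclideanSpace ℝ (Fin d), ℝ)} {g : EuclideanSpace ℝ (Fin d) → ℝ}
    (h : ∀ x, F x = g x) (S : Set (EuclideanSpace ℝ (Fin d))) (R : ℝ) :
    nodalRatio S R F =
      (componentCountIn {x | g x ≠ 0} (R • S) : ℝ) / (R ^ d * (volume S).toReal) := by
  obtain rfl : (F : EuclideanSpace ℝ (Fin d) → ℝ) = g := funext h
  rw [nodalRatio, finrank_euclideanSpace_fin]
  rfl

end Transfer

end NodalCount

/-- **Nazarov–Sodin law of large numbers.** Let `f` be a centered stationary Gaussian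
field on `ℝⁿ` with covariance kernel `K`, a.s. `C¹` sample paths, whose (finite,
symmetric) spectral measure `ρ` has a finite fourth moment, no atoms, and support not
contained in a linear hyperplane.  Let `S` be a bounded open convex set containing the
origin, and `N_S(R, f)` the number of nodal domains of `f` contained in `R·S`.  Then
there is `c ≥ 0` with `N_S(R, f)/(Rⁿ Vol S) → c` as `R → ∞`, a.s. and in `L¹`. -/
theorem nazarov_sodin_law_of_large_numbers
    {d : ℕ} (hd : 0 < d)
    {Ω : Type*} [MeasurableSpace Ω] (P : Measure Ω) [IsProbabilityMeasure P]
    (f : EuclideanSpace ℝ (Fin d) → Ω → ℝ) (K : EuclideanSpace ℝ (Fin d) → ℝ)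
    (hfield : IsStationaryGaussianField f K P)
    (hsmooth : ∀ᵐ ω ∂P, ContDiff ℝ 1 (fun x => f x ω))
    (ρ : Measure (EuclideanSpace ℝ (Fin d))) (hfin : IsFiniteMeasure ρ)
    (hsymm : ρ.map (fun t => -t) = ρ)
    (hspec : ∀ x, (K x : ℂ) =
      ∫ t, Complex.exp (-2 * Real.pi * Complex.I * ⟪x, t⟫) ∂ρ)
    (hmom4 : Integrable (fun t => ‖t‖ ^ 4) ρ)
    (hnoatom : ∀ t, ρ {t} = 0)
    (hnohyp : ∀ u : EuclideanSpace ℝ (Fin d), u ≠ 0 → ρ {t | ⟪u, t⟫ ≠ 0} ≠ 0)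
    (S : Set (EuclideanSpace ℝ (Fin d)))
    (hSbdd : Bornology.IsBounded S) (hSopen : IsOpen S) (hSconv : Convex ℝ S)
    (hS0 : (0 : EuclideanSpace ℝ (Fin d)) ∈ S) :
    ∃ c : ℝ, 0 ≤ c ∧
      (∀ᵐ ω ∂P, Filter.Tendsto (fun R : ℝ =>
          (componentCountIn {x | f x ω ≠ 0} (R • S) : ℝ) /
            (R ^ d * (volume S).toReal))
        Filter.atTop (nhds c)) ∧
      Filter.Tendsto (fun R : ℝ =>
          ∫ ω, |(componentCountIn {x | f x ω ≠ 0} (R • S) : ℝ) /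
            (R ^ d * (volume S).toReal) - c| ∂P)
        Filter.atTop (nhds 0) := by
  obtain ⟨F, hF, hFf⟩ := NodalCount.exists_continuousMap_version hfield.1
    (hsmooth.mono fun ω h => h.continuous)
  have hprob : IsProbabilityMeasure (P.map F) := Measure.isProbabilityMeasure_map hF.aemeasurable
  have hsp := NodalCount.hasSpectralMeasure_map hfield hspec hF hFf
  have hdens := NodalCount.lintegral_totalDensity_ne_top hd hsp hmom4 hnohyp
  refine ⟨NodalCount.nodalConst (P.map F), ENNReal.toReal_nonneg, ?_, ?_⟩
  · filter_upwards [hFf, ae_of_ae_map hF.aemeasurable (NodalCount.ae_tendsto_nodalRatio hsp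
      hnoatom hSbdd hSopen hSconv hS0 hdens)] with ω hω h
    simpa only [NodalCount.nodalRatio_eq hω] using h
  · refine tendsto_order.2 ⟨fun a ha => Filter.Eventually.of_forall fun R =>
      ha.trans_le (integral_nonneg fun ω => abs_nonneg _), fun ε hε => ?_⟩
    filter_upwards [NodalCount.eventually_exists_nodalRatio_bound hsp hnoatom hSbdd hSopen
      hSconv hS0 hdens hε] with R hR
    obtain ⟨G, hG, hGε, hle⟩ := hR
    rw [integral_map hF.aemeasurable hG.aestronglyMeasurable] at hGε
    refine lt_of_le_of_lt (integral_mono_of_nonneg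
      (Filter.Eventually.of_forall fun ω => abs_nonneg _) (hG.comp_measurable hF) ?_) hGε
    filter_upwards [hFf, ae_of_ae_map hF.aemeasurable hle] with ω hω h
    rw [NodalCount.nodalRatio_eq hω] at h
    exact h
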